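/- (i) For every m ∈ M_θ there exists a unique element G_θ^low(m) ∈ V_θ(0)_A ∩ L_θ(0) such that bar(G_θ^low(m)) = G_θ^low(m) and G_θ^low(m) ≡ P_θ(m)φ̃ (mod qL_θ(0)); (ii) moreover G_θ^low(m) ∈ P_θ(m)φ̃ + Σ_{n ∈ M_θ, n <_cry m} qQ[q]·P_θ(n)φ̃; (iii) {G_θ^low(m) : m ∈ M_θ} is a basis of the A-module V_θ(0)_A, of the A_0-module L_θ(0), and of the K-vector space Ṽ_θ(0); in particular L_θ(0) = ⊕_m A_0·G_θ^low(m), V_θ(0)_A = ⊕_m A·G_θ^low(m), and Ṽ_θ(0) = ⊕_m K·G_θ^low(m). -/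

import Mathlib

/-! Basic setup: `K = ℚ(q)` and the algebra `U_q^-(gl_∞)`. -/

noncomputable section

/-- The base field `K = ℚ(q)`. -/
abbrev K : Type := RatFunc ℚ

/-- The indeterminate `q`. -/
def q : K := RatFunc.X

/-- The `q`-integer `[n]`. -/
def qint (n : ℤ) : K := (q ^ n - q ^ (-n)) / (q - q⁻¹)

/-- The `q`-factorial `[n]!`. -/
def qfact (n : ℕ) : K := ∏ k ∈ Finset.range n, qint (k + 1)

/-- The `q`-Serre relations defining `U_q^-(gl_∞)`; the generator indexed by `a : ℤ`
corresponds to `f_i` for the odd integer `i = 2a+1`, so that `|i - j| > 2 ↔ 1 < |a - b|`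
and `|i - j| = 2 ↔ |a - b| = 1`. -/
inductive URel : FreeAlgebra K ℤ → FreeAlgebra K ℤ → Prop
  | far (a b : ℤ) (h : 1 < |a - b|) :
      URel (FreeAlgebra.ι K a * FreeAlgebra.ι K b) (FreeAlgebra.ι K b * FreeAlgebra.ι K a)
  | serre (a b : ℤ) (h : |a - b| = 1) :
      URel (FreeAlgebra.ι K a * FreeAlgebra.ι K a * FreeAlgebra.ι K b
            + FreeAlgebra.ι K b * (FreeAlgebra.ι K a * FreeAlgebra.ι K a))
           ((q + q⁻¹) • (FreeAlgebra.ι K a * FreeAlgebra.ι K b * FreeAlgebra.ι K a))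

/-- The algebra `U_q^-(gl_∞)`. -/
abbrev U : Type := RingQuot URel

/-- The generator `f_i` of `U_q^-(gl_∞)`, for an odd integer `i`. -/
def fgen (i : ℤ) : U := RingQuot.mkAlgHom K URel (FreeAlgebra.ι K ((i - 1) / 2))

/-- `segAux i n` is the segment `⟨i, i+2n⟩`. -/
def segAux (i : ℤ) : ℕ → U
  | 0 => fgen i
  | n + 1 => segAux i n * fgen (i + 2 * (n + 1)) - q • (fgen (i + 2 * (n + 1)) * segAux i n)

/-- The segment `⟨i,j⟩ ∈ U_q^-(gl_∞)` for odd `i ≤ j`. -/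
def seg (i j : ℤ) : U := segAux i ((j - i) / 2).toNat

/-- The divided power `⟨i,j⟩^{(n)}` (zero for `n < 0`). -/
def segPow (i j : ℤ) (n : ℤ) : U :=
  if n < 0 then 0 else (qfact n.toNat)⁻¹ • seg i j ^ n.toNat

/-- The modified divided power `⟨i,j⟩^{[n]}`. -/
def segPowM (i j : ℤ) (n : ℤ) : U :=
  if i = -j then
    (if n < 0 then 0 else (∏ ν ∈ Finset.range n.toNat, qint (2 * (ν + 1)))⁻¹ • seg i j ^ n.toNat)
  else segPow i j n


open scoped Classical

/-- Multisegments as elements of the free abelian group on the segments `⟨i,j⟩`. -/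
abbrev MS : Type := (ℤ × ℤ) →₀ ℤ

/-- The segment `⟨i,j⟩` viewed as a multisegment. -/
def sg (i j : ℤ) : MS := Finsupp.single (i, j) 1

/-- `m` is a multisegment: supported on pairs of odd integers `i ≤ j`,
with nonnegative multiplicities. -/
def IsMulti (m : MS) : Prop :=
  ∀ i j : ℤ, m (i, j) ≠ 0 → Odd i ∧ Odd j ∧ i ≤ j ∧ 0 < m (i, j)

/-- `m` is a θ-restricted multisegment (`m_{i,j} = 0` unless `−j ≤ i ≤ j`). -/
def IsTheta (m : MS) : Prop :=
  ∀ i j : ℤ, m (i, j) ≠ 0 → Odd i ∧ Odd j ∧ -j ≤ i ∧ i ≤ j ∧ 0 < m (i, j)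

/-- The pairs `(i,j)` in the box `[-N,N]²`, listed in decreasing PBW order,
i.e. decreasing lexicographic order in `(j,i)`. -/
def box (N : ℕ) : List (ℤ × ℤ) :=
  (List.range (2 * N + 1)).flatMap fun a =>
    (List.range (2 * N + 1)).map fun b => (((N : ℤ) - b, (N : ℤ) - a))

/-- A bound on the support of `m`. -/
def bound (m : MS) : ℕ := m.support.sup fun p => max p.1.natAbs p.2.natAbs

/-- The product of the modified divided powers `⟨i,j⟩^{[m_{i,j}]}` over the segments
appearing in `m`, in decreasing PBW order. -/
def PthetaProd (m : MS) : U := ((box (bound m)).map fun p => segPowM p.1 p.2 (m p)).prod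

/-- `P_θ(m)` for a θ-restricted multisegment `m`; it is `0` if `m` is not a
θ-restricted multisegment. -/
def Ptheta (m : MS) : U := if IsTheta m then PthetaProd m else 0

/-- The crystal ordering `m' <_cry m` on multisegments. -/
def CryLt (m' m : MS) : Prop :=
  ∃ i0 j0 : ℤ, i0 ≤ j0 ∧ m' (i0, j0) < m (i0, j0) ∧
    (∀ i : ℤ, i < i0 → m' (i, j0) = m (i, j0)) ∧
    (∀ i j : ℤ, j0 < j → i ≤ j → m' (i, j) = m (i, j))

/-- The left ideal `Σ_k U_q^-(gl_∞)(f_k − f_{−k})` (over odd `k`). -/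
def Jideal : Ideal U := Ideal.span {x : U | ∃ k : ℤ, Odd k ∧ x = fgen k - fgen (-k)}

/-- The quotient module `Ṽ_θ(0)`. -/
abbrev Vt : Type := U ⧸ Jideal

/-- The generator `φ̃ ∈ Ṽ_θ(0)`, image of `1`. -/
def phi : Vt := Submodule.Quotient.mk 1

/-- The subring `A = ℚ[q, q⁻¹] ⊂ K`. -/
def Aring : Set K :=
  {x : K | ∃ (p : Polynomial ℚ) (n : ℕ), x = q ^ (-(n : ℤ)) * Polynomial.aeval q p}

/-- The subring `A_0 ⊂ K` of rational functions regular at `q = 0`. -/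
def Azero : Set K := {x : K | Polynomial.eval 0 x.denom ≠ 0}

/-- `U_q^-(gl_∞)_A`: the `A`-subalgebra generated by the divided powers
`f_i^{(n)} = f_i^n/[n]!`. -/
def UA : Subring U := Subring.closure
  ({x : U | ∃ c ∈ Aring, x = algebraMap K U c} ∪
   {x : U | ∃ (i : ℤ) (n : ℕ), Odd i ∧ x = (qfact n)⁻¹ • fgen i ^ n})

/-- `V_θ(0)_A = U_q^-(gl_∞)_A · φ̃`. -/
def VA : Set Vt := {v : Vt | ∃ u ∈ UA, v = u • phi}

/-- The crystal lattice `L_θ(0) = ⊕_{m ∈ M_θ} A_0·P_θ(m)φ̃`. -/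
def Llat : Set Vt := {v : Vt | ∃ c : MS →₀ K, (∀ m ∈ c.support, IsTheta m) ∧
  (∀ m, c m ∈ Azero) ∧ v = c.sum fun m a => a • (Ptheta m • phi)}

/-- The subset `qL_θ(0) ⊂ Ṽ_θ(0)`. -/
def qLlat : Set Vt := (fun v => q • v) '' Llat

/-- A family of elements satisfying the quantum Serre relations of type `A_∞`. -/
structure SerreFamily {k B : Type*} [Field k] [Ring B] [Algebra k B] (q : k) (g : ℤ → B) :
    Prop where
  far : ∀ a b : ℤ, 1 < |a - b| → g a * g b = g b * g a
  serre : ∀ a b : ℤ, |a - b| = 1 →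
    g a * g a * g b + g b * (g a * g a) = (q + q⁻¹) • (g a * g b * g a)

section Segments

variable {k B : Type*} [Field k] [Ring B] [Algebra k B]

/-- The segment element on the letters `a, …, a + n`. -/
def segOf (q : k) (g : ℤ → B) (a : ℤ) : ℕ → B
  | 0 => g a
  | n + 1 => segOf q g a n * g (a + n + 1) - q • (g (a + n + 1) * segOf q g a n)

variable {q : k} {g : ℤ → B}

theorem segOf_succ (a : ℤ) (n : ℕ) : segOf q g a (n + 1) =
    segOf q g a n * g (a + n + 1) - q • (g (a + n + 1) * segOf q g a n) := rfl

theorem commute_qcomm {y u v : B} (hu : Commute y u) (hv : Commute y v) :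
    Commute y (u * v - q • (v * u)) :=
  (hu.mul_right hv).sub_right ((hv.mul_right hu).smul_right q)

theorem semi_qcomm {c : k} {y u v : B} (hu : Commute y u) (hv : y * v = c • (v * y)) :
    y * (u * v - q • (v * u)) = c • ((u * v - q • (v * u)) * y) := by
  have h1 : y * (u * v) = c • (u * v * y) := by
    rw [← mul_assoc, hu.eq, mul_assoc, hv, mul_smul_comm, mul_assoc]
  have h2 : y * (v * u) = c • (v * u * y) := by
    rw [← mul_assoc, hv, smul_mul_assoc, mul_assoc, hu.eq, mul_assoc]
  rw [mul_sub, mul_smul_comm, h1, h2, sub_mul, smul_sub, smul_mul_assoc, smul_comm]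

theorem semi_qcomm' {c : k} {y u v : B} (hu : y * u = c • (u * y)) (hv : Commute y v) :
    y * (u * v - q • (v * u)) = c • ((u * v - q • (v * u)) * y) := by
  have h1 : y * (v * u) = c • (v * u * y) := by
    rw [← mul_assoc, hv.eq, mul_assoc, hu, mul_smul_comm, mul_assoc]
  have h2 : y * (u * v) = c • (u * v * y) := by
    rw [← mul_assoc, hu, smul_mul_assoc, mul_assoc, hv.eq, mul_assoc]
  rw [mul_sub, mul_smul_comm, h1, h2, sub_mul, smul_sub, smul_mul_assoc, smul_comm]

theorem commute_segOf {y : B} {a : ℤ} {n : ℕ}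
    (h : ∀ c, a ≤ c → c ≤ a + n → Commute y (g c)) : Commute y (segOf q g a n) := by
  induction n with
  | zero => exact h a le_rfl (by simp)
  | succ n ih =>
    exact commute_qcomm (ih fun c h1 h2 => h c h1 (by push_cast; omega))
      (h _ (by omega) (by push_cast; omega))

namespace SerreFamily

variable (H : SerreFamily q g)
include H

theorem commute_far {a b : ℤ} (h : a + 1 < b ∨ b + 1 < a) : Commute (g a) (g b) :=
  H.far a b (by rw [lt_abs]; omega)

theorem commute_far_segOf {c a : ℤ} {n : ℕ} (h : c + 1 < a ∨ a + n + 1 < c) :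
    Commute (g c) (segOf q g a n) :=
  commute_segOf fun d h1 h2 => H.commute_far (by omega)

theorem segOf_succ_left (a : ℤ) (n : ℕ) : segOf q g a (n + 1) =
    g a * segOf q g (a + 1) n - q • (segOf q g (a + 1) n * g a) := by
  induction n with
  | zero => simp [segOf]
  | succ n ih =>
    have hc : g a * g (a + 1 + n + 1) = g (a + 1 + n + 1) * g a :=
      H.commute_far (Or.inl (by omega))
    rw [segOf, ih]
    conv_rhs => rw [segOf]
    have e : a + ((n + 1 : ℕ) : ℤ) + 1 = a + 1 + n + 1 := by push_cast; ring
    rw [e]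
    generalize g (a + 1 + n + 1) = z at *
    generalize segOf q g (a + 1) n = s at *
    have h1 : s * g a * z = s * z * g a := by rw [mul_assoc, hc, mul_assoc]
    have h2 : g a * (z * s) = z * (g a * s) := by rw [← mul_assoc, hc, mul_assoc]
    simp only [mul_sub, sub_mul, mul_smul_comm, smul_mul_assoc, smul_sub, h1, h2]
    simp only [mul_assoc]
    abel

theorem left_mul_segOf (hq : q ≠ 0) (a : ℤ) (n : ℕ) :
    g a * segOf q g a (n + 1) = q⁻¹ • (segOf q g a (n + 1) * g a) := by
  induction n with
  | zero =>
    have := H.serre a (a + 1) (by simp)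
    simp only [segOf, Nat.cast_zero, add_zero]
    rw [← sub_eq_zero] at this ⊢
    rw [← this]
    simp only [mul_sub, sub_mul, mul_smul_comm, smul_mul_assoc, smul_sub, mul_assoc, smul_smul]
    match_scalars <;> field_simp <;> ring
  | succ n ih =>
    rw [segOf]
    exact semi_qcomm' ih (H.commute_far (Or.inl (by push_cast; omega)))

theorem right_mul_segOf (hq : q ≠ 0) (a : ℤ) (n : ℕ) :
    g (a + n + 1) * segOf q g a (n + 1) = q • (segOf q g a (n + 1) * g (a + n + 1)) := by
  induction n generalizing a with
  | zero =>
    have := H.serre (a + 1) a (by simp)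
    simp only [segOf, Nat.cast_zero, add_zero]
    rw [← sub_eq_zero] at this ⊢
    rw [← smul_zero (-q), ← this]
    simp only [mul_sub, sub_mul, mul_smul_comm, smul_mul_assoc, smul_sub, mul_assoc, smul_smul]
    match_scalars <;> field_simp <;> ring
  | succ n ih =>
    rw [H.segOf_succ_left]
    have := ih (a + 1)
    have e : a + ((n + 1 : ℕ) : ℤ) + 1 = a + 1 + n + 1 := by push_cast; ring
    rw [e]
    exact semi_qcomm (H.commute_far (Or.inr (by omega))) this

theorem segOf_mul_right (hq : q ≠ 0) (a : ℤ) (n : ℕ) :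
    segOf q g a (n + 1) * g (a + n + 1) = q⁻¹ • (g (a + n + 1) * segOf q g a (n + 1)) := by
  rw [H.right_mul_segOf hq, smul_smul, inv_mul_cancel₀ hq, one_smul]

theorem commute_middle (hq : q ≠ 0) (hq2 : 1 + q ^ 2 ≠ 0) (c : ℤ) :
    Commute (g c) (segOf q g (c - 1) 2) := by
  have hxz := (H.commute_far (a := c - 1) (b := c + 1) (Or.inl (by omega))).eq
  have h1 := H.serre c (c + 1) (by simp)
  have h2 := H.serre c (c - 1) (by simp)
  have e : segOf q g (c - 1) 2 = (g (c-1) * g c - q • (g c * g (c-1))) * g (c+1)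
      - q • (g (c+1) * (g (c-1) * g c - q • (g c * g (c-1)))) := by
    have e1 : c - 1 + ((0:ℕ):ℤ) + 1 = c := by push_cast; ring
    have e2 : c - 1 + ((1:ℕ):ℤ) + 1 = c + 1 := by push_cast; ring
    simp only [segOf]
    rw [e1]
    simp only [show c - 1 + ((0 + 1:ℕ):ℤ) + 1 = c + 1 by push_cast; ring]
  clear H
  rw [Commute, SemiconjBy, e]
  generalize g (c - 1) = x at *
  generalize g (c + 1) = z at *
  generalize g c = y at *
  clear e
  have hzx : ∀ t, z * (x * t) = x * (z * t) := fun t => by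
    rw [← mul_assoc, ← hxz, mul_assoc]
  rw [← sub_eq_zero] at h1 h2 ⊢
  have key : ∀ R1 R2 : B, R1 = 0 → R2 = 0 → (-q ^ 3 / (1 + q ^ 2)) • (R1 * x)
      + (q / (1 + q ^ 2)) • (x * R1) + (-q / (1 + q ^ 2)) • (R2 * z)
      + (q ^ 3 / (1 + q ^ 2)) • (z * R2) = 0 := by
    rintro _ _ rfl rfl; simp
  rw [← key _ _ h1 h2]
  simp only [mul_sub, sub_mul, mul_add, add_mul, mul_smul_comm, smul_mul_assoc, smul_sub,
    smul_add, mul_assoc, smul_smul, hzx, ← hxz]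
  match_scalars <;> field_simp <;> ring

/-- An interior letter of a segment commutes with the segment. -/
theorem commute_interior (hq : q ≠ 0) (hq2 : 1 + q ^ 2 ≠ 0) {c a : ℤ} {n : ℕ}
    (h1 : a < c) (h2 : c < a + n) : Commute (g c) (segOf q g a n) := by
  have hr : ∀ n : ℕ, Commute (g c) (segOf q g (c - 1) (n + 2)) := by
    intro n
    induction n with
    | zero => exact H.commute_middle hq hq2 c
    | succ n ih =>
      exact commute_qcomm ih (H.commute_far (Or.inl (by push_cast; omega)))
  obtain ⟨j, hj⟩ : ∃ j : ℕ, a = c - 1 - j := ⟨(c - 1 - a).toNat, by omega⟩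
  induction j generalizing a n with
  | zero =>
    obtain ⟨l, rfl⟩ : ∃ l : ℕ, n = l + 2 := ⟨n - 2, by omega⟩
    rw [show a = c - 1 by simpa using hj]
    exact hr l
  | succ j ih =>
    obtain ⟨l, rfl⟩ : ∃ l : ℕ, n = l + 1 := ⟨n - 1, by omega⟩
    rw [H.segOf_succ_left]
    push_cast at hj h2
    exact commute_qcomm (H.commute_far (Or.inr (by omega)))
      (ih (by omega) (by omega) (by omega))

/-- Segments with the same right end. -/
theorem segOf_same_right (hq : q ≠ 0) (hq2 : 1 + q ^ 2 ≠ 0) {a c : ℤ} {n l : ℕ}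
    (h1 : a < c) (h2 : c + l = a + n) :
    segOf q g a n * segOf q g c l = q⁻¹ • (segOf q g c l * segOf q g a n) := by
  induction l generalizing c with
  | zero =>
    obtain ⟨m, rfl⟩ : ∃ m : ℕ, n = m + 1 := ⟨n - 1, by omega⟩
    have := H.segOf_mul_right hq a m
    rw [show a + m + 1 = c by push_cast at h2; omega] at this
    exact this
  | succ l ih =>
    rw [H.segOf_succ_left]
    push_cast at h2
    exact semi_qcomm (H.commute_interior hq hq2 (by omega) (by omega)).symm
      (ih (by omega) (by omega))

/-- Segments with the same left end. -/
theorem segOf_same_left (hq : q ≠ 0) (hq2 : 1 + q ^ 2 ≠ 0) {a : ℤ} {n l : ℕ} (h : l < n) :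
    segOf q g a n * segOf q g a l = q • (segOf q g a l * segOf q g a n) := by
  induction l with
  | zero =>
    obtain ⟨m, rfl⟩ : ∃ m : ℕ, n = m + 1 := ⟨n - 1, by omega⟩
    rw [segOf, H.left_mul_segOf hq, smul_smul, mul_inv_cancel₀ hq, one_smul]
  | succ l ih =>
    conv_lhs => rw [segOf]
    conv_rhs => rw [segOf]
    exact semi_qcomm' (ih (by omega)) (H.commute_interior hq hq2 (by omega) (by omega)).symm

end SerreFamily
end Segments

section Theta

variable {k B M : Type*} [Field k] [Ring B] [Algebra k B] [AddCommGroup M] [Module k M]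
  [Module B M] [IsScalarTower k B M]
variable {q : k} {g : ℤ → B} (H : SerreFamily q g)
include H

theorem SerreFamily.theta_positive {φ : M} (hφ : ∀ c, g c • φ = g (-1 - c) • φ)
    (a : ℤ) (ha : 0 ≤ a) (n : ℕ) :
    segOf q g (-1 - a - n) n • φ = segOf q g a n • φ := by
  induction n with
  | zero => simpa [segOf] using (hφ a).symm
  | succ n ih =>
    rw [H.segOf_succ_left]
    conv_rhs => rw [segOf]
    rw [show -1 - a - ((n + 1 : ℕ) : ℤ) + 1 = -1 - a - n by push_cast; ring,
      show -1 - a - ((n + 1 : ℕ) : ℤ) = -1 - (a + n + 1) by push_cast; ring]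
    have c1 : Commute (g (-1 - (a + n + 1))) (segOf q g a n) :=
      H.commute_far_segOf (Or.inl (by omega))
    have c2 : Commute (g (a + n + 1)) (segOf q g (-1 - a - n) n) :=
      H.commute_far_segOf (Or.inr (by omega))
    rw [sub_smul, sub_smul, smul_assoc, smul_assoc, mul_smul, mul_smul, ih, ← mul_smul, c1.eq,
      mul_smul, ← hφ, ← mul_smul, ← mul_smul, ← c2.eq,
      mul_smul (g _) _ φ, ih, ← mul_smul]

theorem SerreFamily.theta_negative (hq : q ≠ 0) (hq2 : 1 + q ^ 2 ≠ 0) {φ : M}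
    (hφ : ∀ c, g c • φ = g (-1 - c) • φ) (p b : ℕ) (hb : b < p) :
    segOf q g (-1 - p) (p + b + 1) • φ = q⁻¹ • segOf q g (-1 - b) (p + b + 1) • φ := by
  induction b with
  | zero =>
    have h1 := H.theta_positive hφ 0 le_rfl p
    obtain ⟨l, rfl⟩ : ∃ l : ℕ, p = l + 1 := ⟨p - 1, by omega⟩
    have h2 := H.segOf_mul_right hq (-1 - ((l + 1 : ℕ) : ℤ)) l
    have h3 := H.left_mul_segOf hq 0 l
    rw [Nat.add_zero, segOf_succ (-1 - _), H.segOf_succ_left (-1 - ((0 : ℕ) : ℤ))]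
    have e1 : -1 - ((l + 1 : ℕ) : ℤ) + ((l + 1 : ℕ) : ℤ) + 1 = 0 := by ring
    have e2 : -1 - ((l + 1 : ℕ) : ℤ) + l + 1 = -1 := by push_cast; ring
    rw [e1]
    rw [e2] at h2
    simp only [sub_zero, CharP.cast_eq_zero, neg_add_cancel] at *
    have h0 := hφ 0
    simp only [sub_zero] at h0
    have h4 : segOf q g 0 (l + 1) * g 0 = q • (g 0 * segOf q g 0 (l + 1)) := by
      rw [h3, smul_smul, mul_inv_cancel₀ hq, one_smul]
    rw [sub_smul, sub_smul, smul_assoc, smul_assoc, mul_smul _ (g 0), h0, ← mul_smul, h2,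
      mul_smul (g 0), h1, ← mul_smul, h3, smul_assoc, smul_assoc, mul_smul, mul_smul, mul_smul,
      mul_smul, h1, h0, smul_sub, smul_comm q q⁻¹]
  | succ b ih =>
    have ih := ih (by omega)
    have c1 : Commute (g (-1 - (b + 1))) (segOf q g (-1 - p) (p + b + 1)) :=
      H.commute_interior hq hq2 (by omega) (by push_cast; omega)
    have c2 : Commute (g (b + 1)) (segOf q g (-1 - b) (p + b + 1)) :=
      H.commute_interior hq hq2 (by omega) (by push_cast; omega)
    rw [show p + (b + 1) + 1 = (p + b + 1) + 1 by ring, segOf_succ (-1 - (p : ℤ)), H.segOf_succ_left (-1 - ((b + 1 : ℕ) : ℤ)),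
      show -1 - (p : ℤ) + ((p + b + 1 : ℕ) : ℤ) + 1 = b + 1 by push_cast; ring,
      show -1 - ((b + 1 : ℕ) : ℤ) + 1 = -1 - b by push_cast; ring, Nat.cast_add b 1, Nat.cast_one]
    rw [sub_smul, sub_smul, smul_assoc, smul_assoc, mul_smul _ (g (b + 1)), hφ, ← mul_smul,
      ← c1.eq, mul_smul, ih, mul_smul (g (b + 1)), ih, mul_smul, mul_smul _ _ φ, ← hφ,
      ← mul_smul (segOf q g (-1 - b) _) _ φ, ← c2.eq,
      mul_smul _ _ φ]
    rw [smul_comm (g _) q⁻¹, smul_comm _ q⁻¹, smul_sub, smul_comm q q⁻¹]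

end Theta

section QNumbers

variable {k : Type*} [Field k]

/-- The balanced `q`-integer. -/
def qnum (q : k) (n : ℤ) : k := (q ^ n - q ^ (-n)) / (q - q⁻¹)

/-- `q` is nonzero and not a root of unity. -/
structure NonRoot (q : k) : Prop where
  ne_zero : q ≠ 0
  pow_ne : ∀ n : ℕ, 0 < n → q ^ n ≠ 1

variable {q : k} (hq : NonRoot q)
include hq

theorem NonRoot.sq_sub (n : ℤ) (hn : 0 < n) : q ^ n - q ^ (-n) ≠ 0 := by
  intro h
  obtain ⟨m, rfl⟩ := Int.eq_ofNat_of_zero_le hn.le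
  have h0 := hq.ne_zero
  apply hq.pow_ne (2 * m) (by omega)
  rw [zpow_neg, zpow_natCast] at h
  field_simp at h
  rw [two_mul, pow_add]
  linear_combination h

theorem NonRoot.denom : q - q⁻¹ ≠ 0 := by simpa using hq.sq_sub 1 one_pos

theorem NonRoot.qnum_ne_zero {n : ℤ} (hn : 0 < n) : qnum q n ≠ 0 :=
  div_ne_zero (hq.sq_sub n hn) hq.denom

omit hq in
@[simp] theorem qnum_zero : qnum q 0 = 0 := by simp [qnum]

theorem NonRoot.qnum_add (a b : ℤ) : qnum q (a + b) = q ^ (-b) * qnum q a + q ^ a * qnum q b := by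
  have h0 := hq.ne_zero
  have h1 := hq.denom
  unfold qnum
  field_simp
  simp only [neg_add, zpow_add₀ h0, zpow_neg]
  field_simp
  ring

theorem NonRoot.qnum_two_mul (a : ℤ) : qnum q (2 * a) = (q ^ a + q ^ (-a)) * qnum q a := by
  rw [two_mul, hq.qnum_add]
  ring

theorem NonRoot.qnum_one : qnum q 1 = 1 := by
  simpa [qnum] using div_self hq.denom

theorem NonRoot.qnum_three (u c z : ℤ) : qnum q (u + c + 2 * z) =
    q ^ (u + c) * qnum q (2 * z) + q ^ (-2 * z - c) * qnum q u + q ^ (u - 2 * z) * qnum q c := by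
  have h0 := hq.ne_zero
  rw [hq.qnum_add, hq.qnum_add u c, show -2 * z - c = -(2 * z) + (-c) by ring, sub_eq_add_neg u,
    zpow_add₀ h0, zpow_add₀ h0, zpow_add₀ h0]
  ring

theorem NonRoot.one_add_sq : 1 + q ^ 2 ≠ 0 := by
  intro h
  apply hq.pow_ne 4 (by omega)
  linear_combination (q ^ 2 - 1) * h

end QNumbers

section DividedPowers

variable {k B : Type*} [Field k] [Ring B] [Algebra k B]

/-- Divided powers `x^n / (C 1 ⋯ C n)`, extended by zero to negative exponents. -/
def dpow (C : ℤ → k) (x : B) (n : ℤ) : B :=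
  if n < 0 then 0 else (∏ ν ∈ Finset.range n.toNat, C (ν + 1))⁻¹ • x ^ n.toNat

variable {C D : ℤ → k} {x y : B}

theorem dpow_of_neg {n : ℤ} (h : n < 0) : dpow C x n = 0 := if_pos h

theorem dpow_natCast (n : ℕ) :
    dpow C x n = (∏ ν ∈ Finset.range n, C (ν + 1))⁻¹ • x ^ n := by simp [dpow]

@[simp] theorem dpow_zero : dpow C x 0 = 1 := by simp [dpow]

theorem mul_dpow (h0 : C 0 = 0) (hC : ∀ n, 0 < n → C n ≠ 0) (n : ℤ) :
    x * dpow C x n = C (n + 1) • dpow C x (n + 1) := by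
  rcases lt_trichotomy n (-1) with h | rfl | h
  · rw [dpow_of_neg (by omega), dpow_of_neg (by omega)]; simp
  · simp [h0, dpow_of_neg]
  · obtain ⟨m, rfl⟩ := Int.eq_ofNat_of_zero_le (by omega : 0 ≤ n)
    have := hC (m + 1) (by omega)
    have e : (((m : ℕ) : ℤ) + 1) = ((m + 1 : ℕ) : ℤ) := by push_cast; ring
    rw [dpow_natCast, e, dpow_natCast, Finset.prod_range_succ, ← e, smul_smul,
      mul_inv, mul_smul_comm, pow_succ']
    congr 1
    field_simp

theorem semi_pow {c : k} (h : y * x = c • (x * y)) (n : ℕ) :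
    y * x ^ n = c ^ n • (x ^ n * y) := by
  induction n with
  | zero => simp
  | succ n ih =>
    rw [pow_succ, ← mul_assoc, ih, smul_mul_assoc, mul_assoc, h, mul_smul_comm, smul_smul,
      mul_assoc, pow_succ]

theorem semi_dpow {c : k} (h : y * x = c • (x * y)) (n : ℤ) :
    y * dpow C x n = c ^ n • (dpow C x n * y) := by
  by_cases hn : n < 0
  · simp [dpow_of_neg hn]
  · obtain ⟨m, rfl⟩ := Int.eq_ofNat_of_zero_le (by omega : 0 ≤ n)
    rw [dpow_natCast, mul_smul_comm, semi_pow h, zpow_natCast, smul_comm,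
      smul_mul_assoc]

theorem pow_semi {c : k} (h : y * x = c • (x * y)) (n : ℕ) :
    y ^ n * x = c ^ n • (x * y ^ n) := by
  induction n with
  | zero => simp
  | succ n ih =>
    rw [pow_succ, mul_assoc, h, mul_smul_comm, ← mul_assoc, ih, smul_mul_assoc, smul_smul,
      mul_assoc, pow_succ, mul_comm c]

theorem dpow_semi {c : k} (h : y * x = c • (x * y)) (n : ℤ) :
    dpow C y n * x = c ^ n • (x * dpow C y n) := by
  by_cases hn : n < 0
  · simp [dpow_of_neg hn]
  · obtain ⟨m, rfl⟩ := Int.eq_ofNat_of_zero_le (by omega : 0 ≤ n)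
    rw [dpow_natCast, smul_mul_assoc, pow_semi h, zpow_natCast, smul_comm,
      mul_smul_comm]

theorem dpow_semi_dpow {c : k} (h : y * x = c • (x * y)) (m n : ℤ) :
    dpow C y m * dpow D x n = c ^ (m * n) • (dpow D x n * dpow C y m) := by
  rw [semi_dpow (c := c ^ m) (dpow_semi h m), zpow_mul]

theorem commute_dpow (h : Commute y x) (n : ℤ) : Commute y (dpow C x n) := by
  unfold dpow
  split_ifs
  · exact Commute.zero_right y
  · exact (h.pow_right _).smul_right _

/-- Moving `f` through a divided power of `s` when `f s = q s f + t`. -/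
theorem skew_dpow {q : k} (hq : NonRoot q) {f s t : B} (h : f * s = q • (s * f) + t)
    (ht : t * s = q⁻¹ • (s * t)) (hC : ∀ n, 0 < n → C n ≠ 0) (n : ℤ) :
    f * dpow C s n = q ^ n • (dpow C s n * f) + (qnum q n / C n) • (dpow C s (n - 1) * t) := by
  have hp : ∀ m : ℕ, f * s ^ (m + 1) =
      q ^ (m + 1) • (s ^ (m + 1) * f) + qnum q (m + 1) • (s ^ m * t) := by
    intro m
    induction m with
    | zero => simp [h, hq.qnum_one]
    | succ m ih =>
      rw [pow_succ s (m + 1), ← mul_assoc, ih, add_mul, smul_mul_assoc, smul_mul_assoc, mul_assoc,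
        h, mul_assoc _ t, ht, mul_add, smul_add, mul_smul_comm, mul_smul_comm, smul_smul, smul_smul,
        ← mul_assoc, ← mul_assoc, ← pow_succ, ← pow_succ, ← pow_succ, add_assoc, ← add_smul]
      congr 2
      push_cast
      rw [hq.qnum_add (m + 1) 1, hq.qnum_one, ← Nat.cast_add_one m,
        zpow_natCast, zpow_neg_one]
      ring
  by_cases hn : n < 0
  · simp [dpow_of_neg hn, dpow_of_neg (show n - 1 < 0 by omega)]
  obtain ⟨m, rfl⟩ := Int.eq_ofNat_of_zero_le (by omega : 0 ≤ n)
  cases m with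
  | zero => simp
  | succ m =>
    have := hC (m + 1) (by omega)
    rw [show ((m + 1 : ℕ) : ℤ) - 1 = m by push_cast; ring, dpow_natCast, dpow_natCast,
      mul_smul_comm, hp, Finset.prod_range_succ, zpow_natCast]
    push_cast
    rw [smul_add, smul_mul_assoc, smul_mul_assoc, smul_smul, smul_smul, smul_smul, smul_smul]
    congr 2
    · ring
    · field_simp

/-- Moving `h` through a divided power of `s` when `s h = q h s + x`. -/
theorem dpow_skew {q : k} (hq : NonRoot q) {h s x : B} (hs : s * h = q • (h * s) + x)
    (hx : s * x = q⁻¹ • (x * s)) (hC : ∀ n, 0 < n → C n ≠ 0) (n : ℤ) :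
    dpow C s n * h = q ^ n • (h * dpow C s n) + (qnum q n / C n) • (x * dpow C s (n - 1)) := by
  have hp : ∀ m : ℕ, s ^ (m + 1) * h =
      q ^ (m + 1) • (h * s ^ (m + 1)) + qnum q (m + 1) • (x * s ^ m) := by
    intro m
    induction m with
    | zero => simp [hs, hq.qnum_one]
    | succ m ih =>
      rw [pow_succ' s (m + 1), mul_assoc, ih, mul_add, mul_smul_comm, mul_smul_comm, ← mul_assoc,
        hs, ← mul_assoc s x, hx, add_mul, smul_add, smul_mul_assoc, smul_mul_assoc, smul_smul,
        smul_smul, mul_assoc, mul_assoc, ← pow_succ', ← pow_succ', ← pow_succ, add_assoc, ← add_smul]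
      congr 2
      push_cast
      rw [hq.qnum_add (m + 1) 1, hq.qnum_one, ← Nat.cast_add_one m,
        zpow_natCast, zpow_neg_one]
      ring
  by_cases hn : n < 0
  · simp [dpow_of_neg hn, dpow_of_neg (show n - 1 < 0 by omega)]
  obtain ⟨m, rfl⟩ := Int.eq_ofNat_of_zero_le (by omega : 0 ≤ n)
  cases m with
  | zero => simp
  | succ m =>
    have := hC (m + 1) (by omega)
    rw [show ((m + 1 : ℕ) : ℤ) - 1 = m by push_cast; ring, dpow_natCast, dpow_natCast,
      smul_mul_assoc, hp, Finset.prod_range_succ, zpow_natCast]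
    push_cast
    rw [smul_add, mul_smul_comm, mul_smul_comm, smul_smul, smul_smul, smul_smul, smul_smul]
    congr 2
    · ring
    · field_simp

end DividedPowers

section ModuleLemmas

variable {k B M : Type*} [Field k] [Ring B] [Algebra k B] [AddCommGroup M] [Module k M]
  [Module B M] [IsScalarTower k B M]

theorem semi_smul {c : k} {a b a' b' : B} (h : a * b = c • (b' * a')) (v : M) :
    a • b • v = c • b' • a' • v := by
  rw [← mul_smul, h, smul_assoc, mul_smul]

theorem skew_smul {c d : k} {a b a' b' e e' : B} (h : a * b = c • (b' * a') + d • (e * e'))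
    (v : M) : a • b • v = c • b' • a' • v + d • e • e' • v := by
  rw [← mul_smul, h, add_smul, smul_assoc, mul_smul, smul_assoc, mul_smul]

theorem smul_pull (b : B) (c : k) (v : M) : b • c • v = c • b • v := smul_comm _ _ _

omit [Module B M] [IsScalarTower k B M] in
theorem scalar_smul_smul (a b : k) (v : M) : a • b • v = (a * b) • v := smul_smul _ _ _

theorem finsum_add_add {ι : Type*} {F G H : ι → M} (hF : F.HasFiniteSupport)
    (hG : G.HasFiniteSupport) (hH : H.HasFiniteSupport) :
    ∑ᶠ i, (F i + G i + H i) = ∑ᶠ i, F i + ∑ᶠ i, G i + ∑ᶠ i, H i := by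
  exact (finsum_add_distrib (f := fun i => F i + G i) (hF.add hG) hH).trans
    (by rw [finsum_add_distrib hF hG])

theorem finsum_shift {ι : Type*} [AddGroup ι] (F : ι → M) (d : ι) :
    ∑ᶠ i, F i = ∑ᶠ i, F (i - d) :=
  (finsum_comp_equiv (Equiv.subRight d)).symm

theorem finsum_sub_mem {ι : Type*} {F : ι → M} (hF : F.HasFiniteSupport)
    (N : AddSubgroup M) (i₀ : ι) (h : ∀ i, i ≠ i₀ → F i ∈ N) : (∑ᶠ i, F i) - F i₀ ∈ N := by
  rw [finsum_eq_sum_of_support_subset F (s := insert i₀ hF.toFinset) (by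
    intro i hi; exact Finset.mem_insert_of_mem (hF.mem_toFinset.2 hi)),
    ← Finset.add_sum_erase _ _ (Finset.mem_insert_self i₀ _), add_sub_cancel_left]
  exact N.sum_mem fun i hi => h i (Finset.ne_of_mem_erase hi)

theorem finsum_mem_of_forall {ι : Type*} {F : ι → M} (N : AddSubgroup M)
    (h : ∀ i, F i ∈ N) : ∑ᶠ i, F i ∈ N :=
  finsum_induction (· ∈ N) N.zero_mem (fun _ _ => N.add_mem) h

theorem dpow_smul_of_recursion {C : ℤ → k} (h0 : C 0 = 0) (hC : ∀ n, 0 < n → C n ≠ 0) {g : B}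
    (v : ℕ → M) (h : ∀ r, g • v r = C (r + 1) • v (r + 1)) (r : ℕ) :
    dpow C g r • v 0 = v r := by
  induction r with
  | zero => simp
  | succ r ih =>
    have h1 := mul_dpow (x := g) h0 hC r
    have h2 := hC (r + 1) (by omega)
    have h3 : g • dpow C g r • v 0 = C (r + 1) • dpow C g (r + 1) • v 0 := by
      rw [← mul_smul, h1, smul_assoc]
    rw [ih, h] at h3
    push_cast
    exact (smul_right_injective M h2 h3).symm

end ModuleLemmas

section Straightening

variable {k B M : Type*} [Field k] [Ring B] [Algebra k B] [AddCommGroup M] [Module k M]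
  [Module B M] [IsScalarTower k B M]
variable {q : k} (hq : NonRoot q)

/-- Even balanced `q`-integers. -/
def qnumTwo (q : k) (n : ℤ) : k := qnum q (2 * n)

omit [Algebra k B] in
theorem qnumTwo_zero : qnumTwo q 0 = 0 := by simp [qnumTwo]

include hq

theorem NonRoot.qnumTwo_ne {n : ℤ} (h : 0 < n) : qnumTwo q n ≠ 0 :=
  hq.qnum_ne_zero (by omega)

/-- Straightening of a product of divided powers in type `A_2`. -/
theorem dpow_mul_dpow {f s t : B} (h : f * s = q • (s * f) + t) (hf : f * t = q⁻¹ • (t * f))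
    (ht : t * s = q⁻¹ • (s * t)) (r : ℕ) (x : ℤ) :
    dpow (qnum q) f r * dpow (qnum q) s x =
      ∑ᶠ i : ℤ, q ^ ((r - i) * (x - i)) •
        (dpow (qnum q) s (x - i) * dpow (qnum q) t i * dpow (qnum q) f (r - i)) := by
  have h0 := hq.ne_zero
  have hC : ∀ n, 0 < n → qnum q n ≠ 0 := fun n hn => hq.qnum_ne_zero hn
  set E : ℤ → ℤ → B := fun r i =>
    dpow (qnum q) s (x - i) * dpow (qnum q) t i * dpow (qnum q) f (r - i) with hE
  have hE1 : ∀ r i, i < 0 → E r i = 0 := fun r i hi => by simp [hE, dpow_of_neg hi]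
  have hE2 : ∀ r i, r < i → E r i = 0 := fun r i hi => by
    simp [hE, dpow_of_neg (show r - i < 0 by omega)]
  have hfin : ∀ (r : ℤ) (a : ℤ → k) (d : ℤ),
      Function.HasFiniteSupport fun i => a i • E r (i + d) := by
    intro r a d
    refine (Set.finite_Icc (-d) (r - d)).subset fun i hi => ?_
    by_contra hc
    simp only [Set.mem_Icc, not_and_or, not_le] at hc
    rcases hc with hc | hc
    · exact hi (by simp [hE1 r (i + d) (by omega)])
    · exact hi (by simp [hE2 r (i + d) (by omega)])
  have key : ∀ r i, f * E r i = (q ^ (x - 2 * i) * qnum q (r + 1 - i)) • E (r + 1) i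
      + qnum q (i + 1) • E (r + 1) (i + 1) := by
    intro r i
    have e1 : f * dpow (qnum q) s (x - i) = q ^ (x - i) • (dpow (qnum q) s (x - i) * f)
        + dpow (qnum q) s (x - i - 1) * t := by
      rw [skew_dpow hq h ht hC]
      by_cases hx : x - i = 0
      · simp [hx, dpow_of_neg]
      · by_cases hx' : x - i < 0
        · simp [dpow_of_neg hx', dpow_of_neg (show x - i - 1 < 0 by omega)]
        · rw [div_self (hC _ (by omega)), one_smul]
    have e2 := semi_dpow (C := qnum q) hf i
    have e3 := mul_dpow (x := t) qnum_zero hC i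
    have e4 := mul_dpow (x := f) qnum_zero hC (r - i)
    simp only [hE]
    rw [mul_assoc, ← mul_assoc f, e1, add_mul, smul_mul_assoc, mul_assoc _ f, ← mul_assoc f, e2,
      smul_mul_assoc, mul_assoc _ f, e4, mul_assoc _ t, ← mul_assoc t, e3]
    simp only [mul_smul_comm, smul_mul_assoc, smul_smul, mul_assoc]
    rw [show x - (i + 1) = x - i - 1 by ring, show r + 1 - (i + 1) = r - i by ring,
      show r + 1 - i = r - i + 1 by ring, inv_zpow', ← mul_assoc, ← zpow_add₀ h0]
    congr 4; ring_nf
  set v : ℕ → B := fun r => ∑ᶠ i : ℤ, q ^ ((r - i) * (x - i)) • E r i with hv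
  have hv0 : v 0 = dpow (qnum q) s x := by
    rw [hv]
    dsimp only
    rw [finsum_eq_single _ 0]
    · simp [hE]
    · intro i hi
      rcases lt_or_gt_of_ne hi with hi | hi
      · rw [hE1 _ _ hi, smul_zero]
      · rw [hE2 _ _ (by simpa using hi), smul_zero]
  have hrec : ∀ r : ℕ, f • v r = qnum q (r + 1) • v (r + 1) := by
    intro r
    simp only [hv, smul_eq_mul]
    have l1 : f * ∑ᶠ i : ℤ, q ^ (((r : ℤ) - i) * (x - i)) • E r i =
        ∑ᶠ i : ℤ, ((q ^ (((r : ℤ) - i) * (x - i)) * (q ^ (x - 2 * i) * qnum q (r + 1 - i))) •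
          E (r + 1) (i + 0) +
          (q ^ (((r : ℤ) - i) * (x - i)) * qnum q (i + 1)) • E (r + 1) (i + 1)) := by
      have := (AddMonoidHom.mulLeft f).map_finsum (f := fun i : ℤ =>
        q ^ (((r : ℤ) - i) * (x - i)) • E r i) (by simpa using hfin r _ 0)
      refine this.trans (finsum_congr fun i => ?_)
      rw [AddMonoidHom.coe_mulLeft, mul_smul_comm, key, smul_add, smul_smul, smul_smul, add_zero]
    rw [l1, finsum_add_distrib (hfin _ _ _) (hfin _ _ _),
      finsum_shift (fun i : ℤ => (_ * qnum q (i + 1)) • E (r + 1) (i + 1)) 1,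
      ← finsum_add_distrib (hfin _ _ _) (by simpa using hfin (r + 1) _ 0),
      smul_finsum' _ (by simpa using hfin (r + 1) _ 0)]
    refine finsum_congr fun i => ?_
    rw [sub_add_cancel, add_zero, ← add_smul, smul_smul]
    push_cast
    congr 1
    rw [show ((r : ℤ) + 1) = (r + 1 - i) + i by ring, hq.qnum_add]
    rw [show ((r : ℤ) + 1 - i + i - i) * (x - i) = (r - i) * (x - i) + (x - i) by ring,
      show ((r : ℤ) - (i - 1)) * (x - (i - 1)) = (r - i) * (x - i) + (x - i) + (r + 1 - i) by ring,
      show x - 2 * i = (x - i) + (-i) by ring, show (r : ℤ) + 1 - i + i - i = r + 1 - i by ring,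
      zpow_add₀ h0, zpow_add₀ h0, zpow_add₀ h0]
    ring
  have := dpow_smul_of_recursion qnum_zero hC v hrec r
  rwa [hv0, smul_eq_mul] at this

omit hq in
/-- The monomials occurring in the straightening of `g^{(r)} s^{[n]} φ`. -/
def foldTerm (q : k) (h x w s : B) (φ : M) (u c z y : ℤ) : M :=
  dpow (qnum q) h u • dpow (qnum q) x c • dpow (qnumTwo q) w z • dpow (qnumTwo q) s y • φ

omit hq [Module k M] [IsScalarTower k B M] in
theorem foldTerm_eq_zero {h x w s : B} {φ : M} {u c z y : ℤ} (hn : u < 0 ∨ c < 0 ∨ z < 0) :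
    foldTerm q h x w s φ u c z y = 0 := by
  rcases hn with hn | hn | hn <;> simp [foldTerm, dpow_of_neg hn]

/-- The relations between the elements attached to a self-dual segment `s`, with
`g`, `h` the two letters adjacent to it. -/
structure FoldRel (q : k) (g h s x w t : B) (φ : M) : Prop where
  gs : g * s = q • (s * g) + t
  sh : s * h = q • (h * s) + x
  gx : g * x = q • (x * g) + w
  gh : g * h = h * g
  gw : g * w = q⁻¹ • (w * g)
  wh : w * h = q⁻¹ • (h * w)
  xh : x * h = q⁻¹ • (h * x)
  wx : w * x = q⁻¹ • (x * w)
  ts : t * s = q⁻¹ • (s * t)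
  sx : s * x = q⁻¹ • (x * s)
  gφ : g • φ = h • φ
  tφ : t • φ = q⁻¹ • x • φ

variable {g h s x w t : B} {φ : M} (R : FoldRel q g h s x w t φ)
include R

theorem FoldRel.smul_dpow (y : ℤ) : g • dpow (qnumTwo q) s y • φ =
    q ^ (2 * y) • h • dpow (qnumTwo q) s y • φ + x • dpow (qnumTwo q) s (y - 1) • φ := by
  have h0 := hq.ne_zero
  have hC : ∀ n, 0 < n → qnumTwo q n ≠ 0 := fun n hn => hq.qnumTwo_ne hn
  rw [skew_smul (skew_dpow hq R.gs R.ts hC y), R.gφ, skew_smul (dpow_skew hq R.sh R.sx hC y),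
    R.tφ, smul_pull, semi_smul (dpow_semi (C := qnumTwo q) R.sx (y - 1)), smul_add,
    scalar_smul_smul, scalar_smul_smul, scalar_smul_smul, scalar_smul_smul, add_assoc, ← add_smul, ← zpow_add₀ h0, ← two_mul]
  congr 1
  by_cases hy : y ≤ 0
  · simp [dpow_of_neg (show y - 1 < 0 by omega)]
  · have h1 := hC y (by omega)
    conv_rhs => rw [← one_smul k (x • _)]
    congr 1
    rw [← mul_div_right_comm]
    have h2 : qnumTwo q y = (q ^ y + q ^ (-y)) * qnum q y := hq.qnum_two_mul y
    rw [inv_zpow', show -(y - 1) = -y + 1 by ring, zpow_add₀ h0, zpow_one]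
    field_simp
    rw [h2]; ring

theorem FoldRel.smul_foldTerm (u c z y : ℤ) : g • foldTerm q h x w s φ u c z y =
    qnumTwo q (z + 1) • foldTerm q h x w s φ u (c - 1) (z + 1) y
    + (q ^ (2 * y - 2 * z) * qnum q (u + 1)) • foldTerm q h x w s φ (u + 1) c z y
    + (q ^ (c - 2 * z) * qnum q (c + 1)) • foldTerm q h x w s φ u (c + 1) z (y - 1) := by
  have h0 := hq.ne_zero
  have hC : ∀ n, 0 < n → qnum q n ≠ 0 := fun n hn => hq.qnum_ne_zero hn
  have e1 : g * dpow (qnum q) h u = (1 : k) • (dpow (qnum q) h u * g) := by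
    rw [one_smul]; exact commute_dpow R.gh u
  have e2 : g * dpow (qnum q) x c = q ^ c • (dpow (qnum q) x c * g)
      + (1 : k) • (dpow (qnum q) x (c - 1) * w) := by
    rw [skew_dpow hq R.gx R.wx hC]
    by_cases hx : c ≤ 0
    · simp [dpow_of_neg (show c - 1 < 0 by omega)]
    · rw [div_self (hC _ (by omega))]
  have e3 := semi_dpow (C := qnumTwo q) R.gw z
  have e4 := mul_dpow (x := w) qnumTwo_zero (fun n hn => hq.qnumTwo_ne hn) z
  have e5 := mul_dpow (x := h) qnum_zero hC u
  have e6 := mul_dpow (x := x) qnum_zero hC c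
  have e7 := dpow_semi (C := qnumTwo q) R.wh z
  have e8 := dpow_semi (C := qnum q) R.xh c
  have e9 := dpow_semi (C := qnumTwo q) R.wx z
  have e10 : dpow (qnum q) x c * x = x * dpow (qnum q) x c :=
    (commute_dpow (Commute.refl x) c).symm
  have e11 : dpow (qnum q) h u * h = h * dpow (qnum q) h u :=
    (commute_dpow (Commute.refl h) u).symm
  unfold foldTerm
  rw [semi_smul e1, skew_smul e2, semi_smul e3, ← mul_smul w, e4, R.smul_dpow hq]
  simp only [smul_add, smul_pull (B := B), semi_smul e7, semi_smul e8, semi_smul e9, one_smul]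
  rw [← mul_smul (dpow (qnum q) h u) h, e11, e5, ← mul_smul (dpow (qnum q) x c) x, e10, e6]
  simp only [smul_assoc, scalar_smul_smul, smul_pull (B := B)]
  simp only [inv_zpow', ← zpow_add₀ h0, ← mul_assoc]
  rw [add_comm, add_assoc]
  congr 4
  · ring_nf
  · ring_nf

omit hq R in
/-- Triangular numbers. -/
def tri (c : ℤ) : ℤ := c * (c - 1) / 2

omit hq R in
theorem tri_succ (c : ℤ) : tri (c + 1) = tri c + c := by
  unfold tri
  rw [show (c + 1) * (c + 1 - 1) = c * (c - 1) + c * 2 by ring, Int.add_mul_ediv_right _ _ (by simp)]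

omit R in
theorem NonRoot.fold_coeff (u c z : ℤ) {E a₁ a₂ a₃ b₂ b₃ m m₁ m₂ m₃ : ℤ} (h1 : a₁ = E + (u + c))
    (h2 : a₂ + b₂ = E + (-2 * z - c)) (h3 : a₃ + b₃ = E + (u - 2 * z)) (hm : m = u + c + 2 * z)
    (hm₁ : m₁ = 2 * z) (hm₂ : m₂ = u) (hm₃ : m₃ = c) :
    q ^ a₁ * qnum q m₁ + q ^ a₂ * (q ^ b₂ * qnum q m₂) + q ^ a₃ * (q ^ b₃ * qnum q m₃)
      = qnum q m * q ^ E := by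
  have h0 := hq.ne_zero
  rw [← mul_assoc, ← mul_assoc, ← zpow_add₀ h0, ← zpow_add₀ h0, h1, h2, h3, hm, hq.qnum_three, hm₁,
    hm₂, hm₃, zpow_add₀ h0 E, zpow_add₀ h0 E, zpow_add₀ h0 E]
  ring

theorem FoldRel.dpow_smul (r : ℕ) (n : ℤ) : dpow (qnum q) g r • dpow (qnumTwo q) s n • φ =
    ∑ᶠ i : ℤ × ℤ, q ^ ((r - i.1 - 2 * i.2) * (2 * (n - i.1 - i.2) + i.1) + tri i.1) •
      foldTerm q h x w s φ (r - i.1 - 2 * i.2) i.1 i.2 (n - i.1 - i.2) := by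
  have h0 := hq.ne_zero
  have hC : ∀ n, 0 < n → qnum q n ≠ 0 := fun n hn => hq.qnum_ne_zero hn
  set E : ℤ → ℤ × ℤ → M := fun r i =>
    foldTerm q h x w s φ (r - i.1 - 2 * i.2) i.1 i.2 (n - i.1 - i.2) with hE
  set e : ℤ → ℤ × ℤ → ℤ := fun r i =>
    (r - i.1 - 2 * i.2) * (2 * (n - i.1 - i.2) + i.1) + tri i.1 with he
  have hfin : ∀ (r : ℤ) (a : ℤ × ℤ → k) (d : ℤ × ℤ),
      Function.HasFiniteSupport fun i => a i • E r (i + d) := by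
    intro r a d
    refine ((Set.finite_Icc (-d.1) (r - d.1)).prod (Set.finite_Icc (-d.2) (r - d.2))).subset
      fun i hi => ?_
    by_contra hc
    refine hi ?_
    change a i • foldTerm q h x w s φ _ _ _ _ = 0
    rw [foldTerm_eq_zero, smul_zero]
    simp only [Set.mem_prod, Set.mem_Icc, Prod.fst_add, Prod.snd_add] at hc ⊢
    omega
  have hfin0 : ∀ (r : ℤ) (a : ℤ × ℤ → k), Function.HasFiniteSupport fun i => a i • E r i := by
    intro r a
    simpa using hfin r a 0
  have key : ∀ r i, g • E r i = qnumTwo q (i.2 + 1) • E (r + 1) (i + (-1, 1))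
      + (q ^ (2 * (n - i.1 - i.2) - 2 * i.2) * qnum q (r - i.1 - 2 * i.2 + 1)) • E (r + 1) i
      + (q ^ (i.1 - 2 * i.2) * qnum q (i.1 + 1)) • E (r + 1) (i + (1, 0)) := by
    intro r i
    simp only [hE]
    rw [R.smul_foldTerm hq]
    simp only [Prod.fst_add, Prod.snd_add]
    congr 3
    all_goals first | ring1 | (congr 1 <;> ring1)
  set v : ℕ → M := fun r => ∑ᶠ i, q ^ e r i • E r i with hv
  have hv0 : v 0 = dpow (qnumTwo q) s n • φ := by
    rw [hv]
    dsimp only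
    rw [finsum_eq_single _ 0]
    · simp [hE, foldTerm, he, tri]
    · intro i hi
      simp only [hE]
      rw [foldTerm_eq_zero, smul_zero]
      simp only [ne_eq, Prod.ext_iff, Prod.fst_zero, Prod.snd_zero] at hi
      push_cast
      omega
  have hrec : ∀ r : ℕ, g • v r = qnum q (r + 1) • v (r + 1) := by
    intro r
    simp only [hv]
    have l1 : g • ∑ᶠ i, q ^ e r i • E r i =
        ∑ᶠ i, ((q ^ e r i * qnumTwo q (i.2 + 1)) • E (r + 1) (i + (-1, 1)) +
          (q ^ e r i * (q ^ (2 * (n - i.1 - i.2) - 2 * i.2) * qnum q (r - i.1 - 2 * i.2 + 1))) •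
            E (r + 1) (i + 0) +
          (q ^ e r i * (q ^ (i.1 - 2 * i.2) * qnum q (i.1 + 1))) • E (r + 1) (i + (1, 0))) := by
      have := (DistribSMul.toAddMonoidHom M g).map_finsum (f := fun i : ℤ × ℤ =>
        q ^ e r i • E r i) (hfin0 _ _)
      refine this.trans (finsum_congr fun i => ?_)
      rw [DistribSMul.toAddMonoidHom_apply, smul_pull, key, smul_add, smul_add, smul_smul,
        smul_smul, smul_smul, add_zero]
    rw [l1, finsum_add_add (hfin _ _ _) (hfin _ _ _) (hfin _ _ _),
      finsum_shift (fun i : ℤ × ℤ => (_ * qnumTwo q (i.2 + 1)) • E (r + 1) (i + (-1, 1))) (-1, 1),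
      finsum_shift (fun i : ℤ × ℤ => (_ * (_ * qnum q (i.1 + 1))) • E (r + 1) (i + (1, 0))) (1, 0)]
    simp only [sub_add_cancel, add_zero]
    rw [← finsum_add_add (hfin0 _ _) (hfin0 _ _) (hfin0 _ _), smul_finsum' _ (hfin0 _ _)]
    refine finsum_congr fun ⟨c, z⟩ => ?_
    rw [← add_smul, ← add_smul, smul_smul]
    congr 1
    simp only [he, qnumTwo, Prod.fst_sub, Prod.snd_sub]
    push_cast
    have t1 := tri_succ c
    have t2 := tri_succ (c - 1)
    rw [sub_add_cancel] at t2
    rw [sub_neg_eq_add, t1]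
    refine hq.fold_coeff ((r : ℤ) + 1 - c - 2 * z) c z ?_ ?_ ?_ ?_ ?_ ?_ ?_
    · ring
    · ring
    · rw [t2]; ring
    all_goals ring
  have := dpow_smul_of_recursion qnum_zero hC v hrec r
  rwa [hv0] at this

/-- The degenerate case of `FoldRel` in which `s` is empty. -/
structure FoldRelZero (q : k) (g h w : B) (φ : M) : Prop where
  gh : g * h = q • (h * g) + w
  gw : g * w = q⁻¹ • (w * g)
  wh : w * h = q⁻¹ • (h * w)
  gφ : g • φ = h • φ

omit R in
theorem FoldRelZero.dpow_smul (R : FoldRelZero q g h w φ) (r : ℕ) : dpow (qnum q) g r • φ =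
    ∑ᶠ z : ℤ, q ^ tri (r - 2 * z) •
      dpow (qnum q) h (r - 2 * z) • dpow (qnumTwo q) w z • φ := by
  have h0 := hq.ne_zero
  have hC : ∀ n, 0 < n → qnum q n ≠ 0 := fun n hn => hq.qnum_ne_zero hn
  set E : ℤ → ℤ → M := fun r z =>
    dpow (qnum q) h (r - 2 * z) • dpow (qnumTwo q) w z • φ with hE
  have hfin : ∀ (r : ℤ) (a : ℤ → k) (d : ℤ),
      Function.HasFiniteSupport fun i => a i • E r (i + d) := by
    intro r a d
    refine (Set.finite_Icc (-d) (r - d)).subset fun i hi => ?_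
    by_contra hc
    refine hi ?_
    change a i • dpow (qnum q) h _ • dpow (qnumTwo q) w _ • φ = 0
    simp only [Set.mem_Icc, not_and_or, not_le] at hc
    by_cases hc' : i + d < 0
    · simp [dpow_of_neg hc']
    · rw [dpow_of_neg (show r - 2 * (i + d) < 0 by omega)]; simp
  have hfin0 : ∀ (r : ℤ) (a : ℤ → k), Function.HasFiniteSupport fun i => a i • E r i := by
    intro r a
    simpa using hfin r a 0
  have key : ∀ r z, g • E r z = (q ^ (r - 4 * z) * qnum q (r + 1 - 2 * z)) • E (r + 1) z
      + qnumTwo q (z + 1) • E (r + 1) (z + 1) := by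
    intro r z
    have e2 : g * dpow (qnum q) h (r - 2 * z) = q ^ (r - 2 * z) • (dpow (qnum q) h (r - 2 * z) * g)
        + (1 : k) • (dpow (qnum q) h (r - 2 * z - 1) * w) := by
      rw [skew_dpow hq R.gh R.wh hC]
      by_cases hx : r - 2 * z ≤ 0
      · simp [dpow_of_neg (show r - 2 * z - 1 < 0 by omega)]
      · rw [div_self (hC _ (by omega))]
    have e3 := semi_dpow (C := qnumTwo q) R.gw z
    have e4 := mul_dpow (x := w) qnumTwo_zero (fun n hn => hq.qnumTwo_ne hn) z
    have e5 := mul_dpow (x := h) qnum_zero hC (r - 2 * z)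
    have e7 := dpow_semi (C := qnumTwo q) R.wh z
    have e11 : dpow (qnum q) h (r - 2 * z) * h = h * dpow (qnum q) h (r - 2 * z) :=
      (commute_dpow (Commute.refl h) _).symm
    simp only [hE]
    rw [skew_smul e2, semi_smul e3, R.gφ, semi_smul e7, ← mul_smul w, e4]
    simp only [smul_pull (B := B)]
    rw [← mul_smul _ h, e11, e5]
    simp only [smul_assoc, scalar_smul_smul, smul_pull (B := B)]
    simp only [inv_zpow', ← zpow_add₀ h0, ← mul_assoc, one_mul]
    congr 3
    all_goals ring_nf
  set v : ℕ → M := fun r => ∑ᶠ i, q ^ tri (r - 2 * i) • E r i with hv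
  have hv0 : v 0 = φ := by
    rw [hv]
    dsimp only
    rw [finsum_eq_single _ 0]
    · simp [hE, tri]
    · intro i hi
      simp only [hE]
      by_cases hc' : i < 0
      · simp [dpow_of_neg hc']
      · rw [dpow_of_neg (show ((0 : ℕ) : ℤ) - 2 * i < 0 by push_cast; omega)]; simp
  have hrec : ∀ r : ℕ, g • v r = qnum q (r + 1) • v (r + 1) := by
    intro r
    simp only [hv]
    have l1 : g • ∑ᶠ i, q ^ tri (r - 2 * i) • E r i =
        ∑ᶠ i : ℤ, ((q ^ tri (r - 2 * i) * (q ^ (r - 4 * i) * qnum q (r + 1 - 2 * i))) •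
          E (r + 1) (i + 0) +
          (q ^ tri (r - 2 * i) * qnumTwo q (i + 1)) • E (r + 1) (i + 1)) := by
      have := (DistribSMul.toAddMonoidHom M g).map_finsum (f := fun i : ℤ =>
        q ^ tri (r - 2 * i) • E r i) (hfin0 _ _)
      refine this.trans (finsum_congr fun i => ?_)
      rw [DistribSMul.toAddMonoidHom_apply, smul_pull, key, smul_add, smul_smul, smul_smul,
        add_zero]
    rw [l1, finsum_add_distrib (hfin _ _ _) (hfin _ _ _),
      finsum_shift (fun i : ℤ => (_ * qnumTwo q (i + 1)) • E (r + 1) (i + 1)) 1]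
    simp only [sub_add_cancel, add_zero]
    rw [← finsum_add_distrib (hfin0 _ _) (hfin0 _ _), smul_finsum' _ (hfin0 _ _)]
    refine finsum_congr fun z => ?_
    rw [← add_smul, smul_smul]
    congr 1
    simp only [qnumTwo]
    push_cast
    have t1 := tri_succ ((r : ℤ) + 1 - 2 * z)
    have t2 := tri_succ ((r : ℤ) - 2 * z)
    rw [show (r : ℤ) - 2 * (z - 1) = r + 1 - 2 * z + 1 by ring, t1,
      show (r : ℤ) + 1 - 2 * z = r - 2 * z + 1 by ring, t2]
    have := hq.fold_coeff (E := tri (r - 2 * z) + (r - 2 * z)) ((r : ℤ) - 2 * z + 1) 0 z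
      (m := r + 1) (m₁ := 2 * z) (m₂ := r - 2 * z + 1) (m₃ := 0) (b₂ := r - 4 * z)
      (a₂ := tri (r - 2 * z)) (a₃ := tri (r - 2 * z) + (r - 2 * z) + ((r : ℤ) - 2 * z + 1 - 2 * z))
      (b₃ := 0)
      rfl (by ring) (by ring) (by ring) rfl rfl rfl
    rw [← this]
    simp
    ring
  have := dpow_smul_of_recursion qnum_zero hC v hrec r
  rwa [hv0] at this

end Straightening

theorem nonRoot_q : NonRoot q where
  ne_zero := RatFunc.X_ne_zero
  pow_ne n hn h := by
    have : algebraMap (Polynomial ℚ) (RatFunc ℚ) (Polynomial.X ^ n) = algebraMap _ _ 1 := by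
      rw [map_pow, map_one, RatFunc.algebraMap_X]; exact h
    have := congrArg Polynomial.natDegree (RatFunc.algebraMap_injective ℚ this)
    simp at this
    omega

/-- The generators of `U_q^-(gl_∞)`, indexed by all integers. -/
def gen (a : ℤ) : U := RingQuot.mkAlgHom K URel (FreeAlgebra.ι K a)

theorem serreFamily_gen : SerreFamily q gen where
  far a b h := by
    have := RingQuot.mkAlgHom_rel K (URel.far a b h)
    simp only [map_mul] at this
    exact this
  serre a b h := by
    have := RingQuot.mkAlgHom_rel K (URel.serre a b h)
    simp only [map_mul, map_add, map_smul] at this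
    exact this

theorem fgen_odd (a : ℤ) : fgen (2 * a + 1) = gen a := by
  unfold fgen gen
  congr 2
  omega

theorem qint_eq_qnum : qint = qnum q := rfl

theorem segAux_eq (a : ℤ) (n : ℕ) : segAux (2 * a + 1) n = segOf q gen a n := by
  induction n with
  | zero => exact fgen_odd a
  | succ n ih =>
    rw [segAux, segOf, ih, show 2 * a + 1 + 2 * ((n : ℤ) + 1) = 2 * (a + n + 1) + 1 by ring, fgen_odd]

theorem smul_phi (u : U) : u • phi = (Submodule.Quotient.mk u : Vt) := by
  rw [phi, ← Submodule.Quotient.mk_smul, smul_eq_mul, mul_one]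

theorem gen_smul_phi (c : ℤ) : gen c • phi = gen (-1 - c) • phi := by
  have h : (gen c - gen (-1 - c)) ∈ Jideal := by
    apply Ideal.subset_span
    refine ⟨2 * c + 1, ⟨c, rfl⟩, ?_⟩
    rw [fgen_odd, show -(2 * c + 1) = 2 * (-1 - c) + 1 by ring, fgen_odd]
  have h2 : (Submodule.Quotient.mk (gen c) : Vt) = Submodule.Quotient.mk (gen (-1 - c)) :=
    (Submodule.Quotient.eq _).2 h
  rw [smul_phi, smul_phi, h2]

/-- The module `Ṽ_θ(0)`, with its module structures sealed. -/
def ThetaMod : Type := Vt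

instance : AddCommGroup ThetaMod := inferInstanceAs (AddCommGroup Vt)
instance : Module K ThetaMod := inferInstanceAs (Module K Vt)
instance : Module U ThetaMod := inferInstanceAs (Module U Vt)
instance : IsScalarTower K U ThetaMod := inferInstanceAs (IsScalarTower K U Vt)

/-- The generator of `ThetaMod`. -/
def vac : ThetaMod := phi

theorem gen_smul_vac (c : ℤ) : gen c • vac = gen (-1 - c) • vac := gen_smul_phi c

/-- Evaluation of Laurent polynomials at `q`. -/
def levalHom : LaurentPolynomial ℚ →+* K :=
  LaurentPolynomial.eval₂ (algebraMap ℚ K) (Units.mk0 q nonRoot_q.ne_zero)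

/-- The subring `ℚ[q, q⁻¹]` of `K`. -/
def Lring : Subring K := levalHom.range

@[simp] theorem levalHom_T (n : ℤ) : levalHom (LaurentPolynomial.T n) = q ^ n := by
  simp [levalHom, LaurentPolynomial.eval₂_T]

@[simp] theorem levalHom_C (a : ℚ) : levalHom (LaurentPolynomial.C a) = algebraMap ℚ K a := by
  simp [levalHom, LaurentPolynomial.eval₂_C]

theorem zpow_mem_Lring (n : ℤ) : q ^ n ∈ Lring := ⟨LaurentPolynomial.T n, levalHom_T n⟩

theorem q_mem_Lring : q ∈ Lring := by simpa using zpow_mem_Lring 1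

theorem levalHom_polynomial (p : Polynomial ℚ) :
    levalHom (Polynomial.toLaurent p) = Polynomial.aeval q p := by
  induction p using Polynomial.induction_on' with
  | add p r hp hr => rw [map_add, map_add, map_add, hp, hr]
  | monomial n a =>
    rw [Polynomial.toLaurent_C_mul_T, map_mul, levalHom_C, levalHom_T, Polynomial.aeval_monomial,
      zpow_natCast]

theorem mem_Lring_iff (x : K) : x ∈ Lring ↔ x ∈ Aring := by
  constructor
  · rintro ⟨f, rfl⟩
    obtain ⟨n, p, hp⟩ := f.exists_T_pow
    refine ⟨p, n, ?_⟩
    rw [← levalHom_polynomial, hp, map_mul, levalHom_T, mul_comm, mul_assoc,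
      ← zpow_add₀ nonRoot_q.ne_zero]
    simp
  · rintro ⟨p, n, rfl⟩
    exact Lring.mul_mem (zpow_mem_Lring _) ⟨_, levalHom_polynomial p⟩

/-- The generalised factorial `C 1 ⋯ C n`. -/
def cfact (C : ℤ → K) (n : ℕ) : K := ∏ ν ∈ Finset.range n, C (ν + 1)

/-- The two families of `q`-integers used for divided powers. -/
structure QInts (C : ℤ → K) : Prop where
  zero : C 0 = 0
  ne : ∀ n, 0 < n → C n ≠ 0
  add : ∀ a b, ∃ α ∈ Lring, ∃ β ∈ Lring, C (a + b) = α * C a + β * C b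
  two : ∀ n, ∃ α ∈ Lring, C n = α * qnum q n

theorem qInts_qnum : QInts (qnum q) where
  zero := qnum_zero
  ne _ hn := nonRoot_q.qnum_ne_zero hn
  add a b := ⟨_, zpow_mem_Lring _, _, zpow_mem_Lring _, nonRoot_q.qnum_add a b⟩
  two _ := ⟨1, Lring.one_mem, by simp⟩

theorem qInts_qnumTwo : QInts (qnumTwo q) where
  zero := qnumTwo_zero
  ne _ hn := nonRoot_q.qnumTwo_ne hn
  add a b := ⟨_, zpow_mem_Lring _, _, zpow_mem_Lring _, by
    rw [qnumTwo, mul_add, nonRoot_q.qnum_add]; rfl⟩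
  two n := ⟨_, Lring.add_mem (zpow_mem_Lring n) (zpow_mem_Lring (-n)), nonRoot_q.qnum_two_mul n⟩

namespace QInts
variable {C : ℤ → K} (hC : QInts C)
include hC

theorem cfact_ne (n : ℕ) : cfact C n ≠ 0 :=
  Finset.prod_ne_zero_iff.2 fun ν _ => hC.ne _ (by omega)

theorem cfact_add (m n : ℕ) : ∃ b ∈ Lring, cfact C (m + n) = b * (cfact C m * cfact C n) := by
  induction hs : m + n generalizing m n with
  | zero =>
    obtain ⟨rfl, rfl⟩ : m = 0 ∧ n = 0 := by omega
    exact ⟨1, Lring.one_mem, by simp [cfact]⟩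
  | succ s ih =>
    rcases m with _ | m
    · exact ⟨1, Lring.one_mem, by simp [cfact, show n = s + 1 by omega]⟩
    rcases n with _ | n
    · exact ⟨1, Lring.one_mem, by simp [cfact, show m = s by omega]⟩
    obtain ⟨b, hb, h1⟩ := ih m (n + 1) (by omega)
    obtain ⟨c, hc, h2⟩ := ih (m + 1) n (by omega)
    obtain ⟨α, hα, β, hβ, h3⟩ := hC.add (m + 1) (n + 1)
    refine ⟨α * b + β * c, Lring.add_mem (Lring.mul_mem hα hb) (Lring.mul_mem hβ hc), ?_⟩
    have hsucc : ∀ l, cfact C (l + 1) = cfact C l * C (l + 1) := fun l =>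
      Finset.prod_range_succ _ _
    have e : ((s : ℤ) + 1) = (m + 1) + (n + 1) := by
      have : s = m + n + 1 := by omega
      subst this; push_cast; ring
    rw [hsucc s, e, h3, mul_add, ← mul_assoc, ← mul_assoc, mul_comm _ α, mul_comm _ β]
    nth_rw 1 [h1]
    rw [h2, hsucc m, hsucc n]
    ring

theorem cfact_two (n : ℕ) : ∃ d ∈ Lring, cfact C n = d * cfact (qnum q) n := by
  induction n with
  | zero => exact ⟨1, Lring.one_mem, by simp [cfact]⟩
  | succ n ih =>
    obtain ⟨d, hd, h⟩ := ih
    obtain ⟨α, hα, h2⟩ := hC.two (n + 1)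
    refine ⟨d * α, Lring.mul_mem hd hα, ?_⟩
    rw [cfact, Finset.prod_range_succ, ← cfact, h, h2, cfact, cfact, Finset.prod_range_succ]
    ring

variable {B : Type*} [Ring B] [Algebra K B]

theorem dpow_mul (x : B) (m n : ℤ) :
    ∃ b ∈ Lring, dpow C x m * dpow C x n = b • dpow C x (m + n) := by
  by_cases hm : m < 0
  · exact ⟨0, Lring.zero_mem, by simp [dpow_of_neg hm]⟩
  by_cases hn : n < 0
  · exact ⟨0, Lring.zero_mem, by simp [dpow_of_neg hn]⟩
  lift m to ℕ using not_lt.1 hm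
  lift n to ℕ using not_lt.1 hn
  obtain ⟨b, hb, h⟩ := hC.cfact_add m n
  refine ⟨b, hb, ?_⟩
  have h1 := hC.cfact_ne m
  have h2 := hC.cfact_ne n
  have h3 := hC.cfact_ne (m + n)
  rw [← Nat.cast_add, dpow_natCast, dpow_natCast, dpow_natCast, smul_mul_smul_comm, ← pow_add,
    smul_smul]
  congr 1
  change (cfact C m)⁻¹ * (cfact C n)⁻¹ = b * (cfact C (m + n))⁻¹
  rw [h] at h3 ⊢
  have h4 : b ≠ 0 := left_ne_zero_of_mul h3
  field_simp

theorem dpow_qnum (x : B) (n : ℤ) : ∃ d ∈ Lring, dpow (qnum q) x n = d • dpow C x n := by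
  by_cases hn : n < 0
  · exact ⟨0, Lring.zero_mem, by simp [dpow_of_neg hn]⟩
  lift n to ℕ using not_lt.1 hn
  obtain ⟨d, hd, h⟩ := hC.cfact_two n
  refine ⟨d, hd, ?_⟩
  have h1 := hC.cfact_ne n
  have h2 := qInts_qnum.cfact_ne n
  rw [dpow_natCast, dpow_natCast, smul_smul]
  congr 1
  change (cfact _ n)⁻¹ = d * (cfact C n)⁻¹
  rw [h] at h1 ⊢
  have h4 : d ≠ 0 := left_ne_zero_of_mul h1
  field_simp

end QInts

section Spans

variable {M : Type*} [AddCommGroup M] [Module K M] {R : Subring K} {S : Set M}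

/-- The span of `S` over a subring `R` of `K`. -/
def rspan (R : Subring K) (S : Set M) : AddSubgroup M :=
  AddSubgroup.closure {v | ∃ c ∈ R, ∃ s ∈ S, v = c • s}

theorem subset_rspan {v : M} (hv : v ∈ S) : v ∈ rspan R S :=
  AddSubgroup.subset_closure ⟨1, R.one_mem, v, hv, (one_smul K v).symm⟩

theorem rspan_induction {p : M → Prop} (hs : ∀ v ∈ S, p v) (h0 : p 0)
    (ha : ∀ v w, p v → p w → p (v + w)) (hc : ∀ c ∈ R, ∀ v, p v → p (c • v)) {v : M}
    (hv : v ∈ rspan R S) : p v := by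
  induction hv using AddSubgroup.closure_induction with
  | mem v hv =>
    obtain ⟨c, hc', s, h, rfl⟩ := hv
    exact hc c hc' s (hs s h)
  | zero => exact h0
  | add v w _ _ h1 h2 => exact ha v w h1 h2
  | neg v _ h =>
    have := hc (-1) (R.neg_mem R.one_mem) v h
    rwa [neg_one_smul] at this

theorem smul_mem_rspan {c : K} (hc : c ∈ R) {v : M} (hv : v ∈ rspan R S) : c • v ∈ rspan R S := by
  induction hv using AddSubgroup.closure_induction with
  | mem v hv =>
    obtain ⟨d, hd, s, h, rfl⟩ := hv
    exact AddSubgroup.subset_closure ⟨c * d, R.mul_mem hc hd, s, h, smul_smul c d s⟩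
  | zero => rw [smul_zero]; exact AddSubgroup.zero_mem _
  | add v w _ _ h1 h2 => rw [smul_add]; exact AddSubgroup.add_mem _ h1 h2
  | neg v _ h => rw [smul_neg]; exact AddSubgroup.neg_mem _ h

theorem rspan_le_rspan {R' : Subring K} (hR : R ≤ R') {S' : Set M} (h : ∀ v ∈ S, v ∈ rspan R' S') :
    rspan R S ≤ rspan R' S' := fun _ hv =>
  rspan_induction h (AddSubgroup.zero_mem _) (fun _ _ => AddSubgroup.add_mem _)
    (fun _ hc _ => smul_mem_rspan (hR hc)) hv

/-- An element mapping a set into a span maps the span of that set into it. -/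
theorem smul_mem_rspan_of_forall {B : Type*} [Ring B] [Algebra K B] [Module B M]
    [IsScalarTower K B M] {u : B} {S' : Set M} (h : ∀ v ∈ S, u • v ∈ rspan R S') {v : M}
    (hv : v ∈ rspan R S) : u • v ∈ rspan R S' :=
  rspan_induction (p := fun v => u • v ∈ rspan R S') h
    (by rw [smul_zero]; exact AddSubgroup.zero_mem _)
    (fun _ _ h1 h2 => by rw [smul_add]; exact AddSubgroup.add_mem _ h1 h2)
    (fun c hc v hv => by
      have := smul_mem_rspan hc hv
      rwa [smul_comm c u v] at this) hv

end Spans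

section Monomials

variable {B : Type*} [Ring B] [Algebra K B]

/-- The ordered monomial `X_0^{[n_0]} ⋯ X_{L-1}^{[n_{L-1}]}`. -/
def mon (C : ℕ → ℤ → K) (X : ℕ → B) (n : ℕ → ℤ) : ℕ → B
  | 0 => 1
  | L + 1 => mon C X n L * dpow (C L) (X L) (n L)

variable {C : ℕ → ℤ → K} {X : ℕ → B} {n m : ℕ → ℤ}

theorem mon_congr {L : ℕ} (h : ∀ s < L, n s = m s) : mon C X n L = mon C X m L := by
  induction L with
  | zero => rfl
  | succ L ih => rw [mon, mon, ih fun s hs => h s (by omega), h L (by omega)]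

theorem mon_add (L l : ℕ) : mon C X n (L + l) = mon C X n L *
    mon (fun s => C (L + s)) (fun s => X (L + s)) (fun s => n (L + s)) l := by
  induction l with
  | zero => simp [mon]
  | succ l ih => rw [← add_assoc, mon, ih, mon, mul_assoc]

theorem mon_zero {L : ℕ} : mon C X 0 L = 1 := by
  induction L with
  | zero => rfl
  | succ L ih => rw [mon, ih]; simp

theorem mon_of_neg {L s : ℕ} (hs : s < L) (h : n s < 0) : mon C X n L = 0 := by
  induction L with
  | zero => omega
  | succ L ih =>
    rw [mon]
    rcases Nat.lt_succ_iff_lt_or_eq.1 hs with h' | rfl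
    · rw [ih h', zero_mul]
    · rw [dpow_of_neg h, mul_zero]

theorem commute_mon {y : B} {L : ℕ} (h : ∀ s < L, Commute y (X s)) : Commute y (mon C X n L) := by
  induction L with
  | zero => exact Commute.one_right y
  | succ L ih =>
    exact (ih fun s hs => h s (by omega)).mul_right (commute_dpow (h L (by omega)) _)

/-- Move `i` units of the exponent from index `t` to index `t + 1`. -/
def moveIdx (n : ℕ → ℤ) (t : ℕ) (i : ℤ) : ℕ → ℤ :=
  fun s => if s = t then n s - i else if s = t + 1 then n s + i else n s

theorem mon_moveIdx (t l : ℕ) (i : ℤ) : mon C X (moveIdx n t i) (t + 2 + l) =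
    mon C X n t * dpow (C t) (X t) (n t - i) * dpow (C (t + 1)) (X (t + 1)) (n (t + 1) + i) *
      mon (fun s => C (t + 2 + s)) (fun s => X (t + 2 + s)) (fun s => n (t + 2 + s)) l := by
  rw [mon_add, mon, mon, mon_congr (L := t) (m := n)
    (fun s hs => by simp [moveIdx, show s ≠ t by omega, show s ≠ t + 1 by omega]),
    mon_congr (L := l) (m := fun s => n (t + 2 + s))
    (fun s hs => by simp [moveIdx, show t + 2 + s ≠ t by omega, show t + 2 + s ≠ t + 1 by omega])]
  simp [moveIdx]

theorem mon_moveIdx_zero (t l : ℕ) : mon C X n (t + 2 + l) =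
    mon C X n t * dpow (C t) (X t) (n t) * dpow (C (t + 1)) (X (t + 1)) (n (t + 1)) *
      mon (fun s => C (t + 2 + s)) (fun s => X (t + 2 + s)) (fun s => n (t + 2 + s)) l := by
  have := mon_moveIdx (C := C) (X := X) (n := n) t l 0
  simpa [show moveIdx n t 0 = n by funext s; simp [moveIdx]] using this

/-- The relations inside one column of segments `X_0, …, X_T`, together with the letters
`f_0, …, f_{T-1}` that produce `X_{t+1}` from `X_t`. -/
structure Column (T : ℕ) (X f : ℕ → B) (C : ℕ → ℤ → K) : Prop where
  skew : ∀ t < T, f t * X t = q • (X t * f t) + X (t + 1)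
  semi : ∀ t < T, f t * X (t + 1) = q⁻¹ • (X (t + 1) * f t)
  comm : ∀ t < T, ∀ s ≤ T, s ≠ t → s ≠ t + 1 → Commute (f t) (X s)
  qcomm : ∀ s t, s < t → t ≤ T → X t * X s = q⁻¹ • (X s * X t)
  qints : ∀ t, QInts (C t)
  qnum_eq : ∀ t < T, C t = qnum q

namespace Column

variable {T : ℕ} {f : ℕ → B} (H : Column T X f C)
include H

theorem dpow_mul_mon {t : ℕ} (ht : t < T) (r : ℕ) (n : ℕ → ℤ) :
    dpow (qnum q) (f t) r * mon C X n (T + 1) ∈ rspan Lring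
      {v : B | ∃ (i : ℤ) (j : ℕ), v = mon C X (moveIdx n t i) (T + 1) * dpow (qnum q) (f t) j} := by
  obtain ⟨l, hl⟩ : ∃ l, T + 1 = t + 2 + l := ⟨T - t - 1, by omega⟩
  set N := rspan Lring
      {v : B | ∃ (i : ℤ) (j : ℕ), v = mon C X (moveIdx n t i) (T + 1) * dpow (qnum q) (f t) j}
  set P := mon C X n t
  set S := mon (fun s => C (t + 2 + s)) (fun s => X (t + 2 + s)) (fun s => n (t + 2 + s)) l
  have hP : ∀ r, Commute (dpow (qnum q) (f t) r) P := fun r => (commute_dpow (commute_mon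
    fun s hs => H.comm t ht s (by omega) (by omega) (by omega)).symm r).symm
  have hS : ∀ r, Commute (dpow (qnum q) (f t) r) S := fun r => (commute_dpow (commute_mon
    fun s hs => H.comm t ht _ (by omega) (by omega) (by omega)).symm r).symm
  rw [hl, mon_moveIdx_zero, H.qnum_eq t ht]
  have e1 := dpow_mul_dpow nonRoot_q (H.skew t ht) (H.semi t ht)
    (H.qcomm t (t + 1) (by omega) (by omega)) r (n t)
  have e2 : dpow (qnum q) (f t) r * (P * dpow (qnum q) (X t) (n t) *
      dpow (C (t + 1)) (X (t + 1)) (n (t + 1)) * S) =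
      P * (dpow (qnum q) (f t) r * dpow (qnum q) (X t) (n t)) *
        (dpow (C (t + 1)) (X (t + 1)) (n (t + 1)) * S) := by
    simp only [← mul_assoc]
    rw [(hP r).eq]
  rw [e2, e1]
  let Φ : B →+ B := (AddMonoidHom.mulRight
    (dpow (C (t + 1)) (X (t + 1)) (n (t + 1)) * S)).comp (AddMonoidHom.mulLeft P)
  change Φ _ ∈ N
  refine finsum_induction (p := fun v => Φ v ∈ N) (by rw [map_zero]; exact N.zero_mem)
    (fun x y hx hy => by rw [map_add]; exact N.add_mem hx hy) fun i => ?_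
  change P * _ * _ ∈ N
  by_cases hr : (r : ℤ) - i < 0
  · simp [dpow_of_neg hr]
  obtain ⟨j, hj⟩ := Int.eq_ofNat_of_zero_le (not_lt.1 hr)
  obtain ⟨d, hd, ed⟩ := (H.qints (t + 1)).dpow_qnum (X (t + 1)) i
  obtain ⟨b, hb, eb⟩ := (H.qints (t + 1)).dpow_mul (X (t + 1)) i (n (t + 1))
  have e3 := dpow_semi_dpow (C := qnum q) (D := C (t + 1)) (H.semi t ht) (r - i) (n (t + 1))
  have key : P * (q ^ ((r - i) * (n t - i)) • (dpow (qnum q) (X t) (n t - i) *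
      dpow (qnum q) (X (t + 1)) i * dpow (qnum q) (f t) (r - i))) *
      (dpow (C (t + 1)) (X (t + 1)) (n (t + 1)) * S) =
      (q ^ ((r - i) * (n t - i)) * q⁻¹ ^ ((r - i) * (n (t + 1))) * d * b) •
      (P * dpow (qnum q) (X t) (n t - i) * dpow (C (t + 1)) (X (t + 1)) (n (t + 1) + i) * S *
        dpow (qnum q) (f t) (r - i)) := by
    calc _ = q ^ ((r - i) * (n t - i)) • (P * dpow (qnum q) (X t) (n t - i) *
        (dpow (qnum q) (X (t + 1)) i * (dpow (qnum q) (f t) (r - i) *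
          dpow (C (t + 1)) (X (t + 1)) (n (t + 1)))) * S) := by
          simp only [mul_smul_comm, smul_mul_assoc, mul_assoc]
      _ = (q ^ ((r - i) * (n t - i)) * q⁻¹ ^ ((r - i) * (n (t + 1))) * d) •
        (P * dpow (qnum q) (X t) (n t - i) * ((dpow (C (t + 1)) (X (t + 1)) i *
          dpow (C (t + 1)) (X (t + 1)) (n (t + 1))) * (dpow (qnum q) (f t) (r - i))) * S) := by
          rw [e3, ed]
          simp only [mul_smul_comm, smul_mul_assoc, mul_assoc, smul_smul]
      _ = _ := by
          rw [eb, add_comm i]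
          simp only [mul_smul_comm, smul_mul_assoc, mul_assoc, smul_smul, (hS _).eq]
  rw [key]
  have hm : P * dpow (qnum q) (X t) (n t - i) * dpow (C (t + 1)) (X (t + 1)) (n (t + 1) + i) * S
      = mon C X (moveIdx n t i) (T + 1) := by
    rw [hl, mon_moveIdx, H.qnum_eq t ht]
  rw [hm, hj]
  refine smul_mem_rspan ?_ (subset_rspan ⟨i, j, rfl⟩)
  rw [inv_zpow, ← zpow_neg]
  exact Lring.mul_mem (Lring.mul_mem (Lring.mul_mem (zpow_mem_Lring _) (zpow_mem_Lring _)) hd) hb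

theorem mul_mon {t : ℕ} (ht : t < T) (n : ℕ → ℤ) : ∃ c d : K, f t * mon C X n (T + 1) =
    c • (mon C X n (T + 1) * f t) + d • mon C X (moveIdx n t 1) (T + 1) := by
  obtain ⟨l, hl⟩ : ∃ l, T + 1 = t + 2 + l := ⟨T - t - 1, by omega⟩
  set P := mon C X n t
  set S := mon (fun s => C (t + 2 + s)) (fun s => X (t + 2 + s)) (fun s => n (t + 2 + s)) l
  have hP : Commute (f t) P := commute_mon
    fun s hs => H.comm t ht s (by omega) (by omega) (by omega)
  have hS : Commute (f t) S := commute_mon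
    fun s hs => H.comm t ht _ (by omega) (by omega) (by omega)
  have e1 := skew_dpow nonRoot_q (C := qnum q) (H.skew t ht)
    (H.qcomm t (t + 1) (by omega) (by omega)) (fun n hn => nonRoot_q.qnum_ne_zero hn) (n t)
  have e2 := semi_dpow (C := C (t + 1)) (H.semi t ht) (n (t + 1))
  have e3 := mul_dpow (C := C (t + 1)) (x := X (t + 1)) (H.qints (t + 1)).zero
    (H.qints (t + 1)).ne (n (t + 1))
  rw [hl, mon_moveIdx_zero, mon_moveIdx, H.qnum_eq t ht]
  refine ⟨q ^ n t * q⁻¹ ^ n (t + 1), qnum q (n t) / qnum q (n t) * C (t + 1) (n (t + 1) + 1), ?_⟩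
  calc f t * (P * dpow (qnum q) (X t) (n t) * dpow (C (t + 1)) (X (t + 1)) (n (t + 1)) * S)
      = P * (f t * dpow (qnum q) (X t) (n t)) * dpow (C (t + 1)) (X (t + 1)) (n (t + 1)) * S := by
        simp only [← mul_assoc]
        rw [hP.eq]
    _ = q ^ n t • (P * dpow (qnum q) (X t) (n t) *
          (f t * dpow (C (t + 1)) (X (t + 1)) (n (t + 1))) * S) +
        (qnum q (n t) / qnum q (n t)) • (P * dpow (qnum q) (X t) (n t - 1) *
          (X (t + 1) * dpow (C (t + 1)) (X (t + 1)) (n (t + 1))) * S) := by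
        rw [e1]
        simp only [mul_add, add_mul, mul_smul_comm, smul_mul_assoc, mul_assoc]
    _ = _ := by
        rw [e2, e3]
        simp only [mul_smul_comm, smul_mul_assoc, mul_assoc, smul_smul, hS.eq]
        rfl

theorem mon_mul_mon {L : ℕ} (hL : L ≤ T + 1) (n m : ℕ → ℤ) :
    ∃ b ∈ Lring, mon C X n L * mon C X m L = b • mon C X (n + m) L := by
  induction L with
  | zero => exact ⟨1, Lring.one_mem, by simp [mon]⟩
  | succ L ih =>
    obtain ⟨b, hb, e⟩ := ih (by omega)
    obtain ⟨d, hd, e'⟩ := (H.qints L).dpow_mul (X L) (n L) (m L)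
    have key : ∃ c ∈ Lring, dpow (C L) (X L) (n L) * mon C X m L =
        c • (mon C X m L * dpow (C L) (X L) (n L)) := by
      clear ih e e'
      have : ∀ l ≤ L, ∃ c ∈ Lring, dpow (C L) (X L) (n L) * mon C X m l =
        c • (mon C X m l * dpow (C L) (X L) (n L)) := by
        intro l hl
        induction l with
        | zero => exact ⟨1, Lring.one_mem, by simp [mon]⟩
        | succ l ih =>
          obtain ⟨c, hc, e⟩ := ih (by omega)
          refine ⟨c * q⁻¹ ^ (n L * m l), Lring.mul_mem hc ?_, ?_⟩
          · rw [inv_zpow, ← zpow_neg]; exact zpow_mem_Lring _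
          rw [mon, ← mul_assoc, e, smul_mul_assoc, mul_assoc,
            dpow_semi_dpow (H.qcomm l L (by omega) (by omega)), mul_smul_comm, smul_smul, mul_assoc]
      exact this L le_rfl
    obtain ⟨c, hc, e''⟩ := key
    refine ⟨c * b * d, Lring.mul_mem (Lring.mul_mem hc hb) hd, ?_⟩
    calc _ = mon C X n L * (dpow (C L) (X L) (n L) * mon C X m L) * dpow (C L) (X L) (m L) := by
          simp only [mon, mul_assoc]
      _ = c • (mon C X n L * mon C X m L * (dpow (C L) (X L) (n L) * dpow (C L) (X L) (m L))) := by
          rw [e'']; simp only [mul_smul_comm, smul_mul_assoc, mul_assoc]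
      _ = _ := by
          rw [e, e', mon]; simp only [mul_smul_comm, smul_mul_assoc, smul_smul, Pi.add_apply]
          ring_nf

end Column
end Monomials

/-- The segment with `t + 1` letters ending in the letter `p`. -/
def colX (p t : ℕ) : U := segOf q gen ((p : ℤ) - t) t

/-- The letter extending `colX p t` to `colX p (t + 1)`. -/
def colF (p t : ℕ) : U := gen ((p : ℤ) - 1 - t)

/-- The `q`-integers used for the powers of `colX p t`. -/
def colC (p t : ℕ) : ℤ → K := if t = 2 * p + 1 then qnumTwo q else qnum q

theorem colC_last (p : ℕ) : colC p (2 * p + 1) = qnumTwo q := if_pos rfl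

theorem colC_of_lt {p t : ℕ} (h : t < 2 * p + 1) : colC p t = qnum q := if_neg (by omega)

theorem column (p : ℕ) : Column (2 * p + 1) (colX p) (colF p) (colC p) where
  skew t ht := by
    have := serreFamily_gen.segOf_succ_left ((p : ℤ) - 1 - t) t
    rw [colX, colX, colF, Nat.cast_add, Nat.cast_one, show (p : ℤ) - (t + 1) = p - 1 - t by ring,
      this, show (p : ℤ) - 1 - t + 1 = p - t by ring]
    abel
  semi t ht := by
    have := serreFamily_gen.left_mul_segOf nonRoot_q.ne_zero ((p : ℤ) - 1 - t) t
    rwa [colX, colF, Nat.cast_add, Nat.cast_one, show (p : ℤ) - (t + 1) = p - 1 - t by ring]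
  comm t ht s hs h1 h2 := by
    rcases lt_or_ge s t with h | h
    · exact serreFamily_gen.commute_far_segOf (Or.inl (by omega))
    · exact serreFamily_gen.commute_interior nonRoot_q.ne_zero nonRoot_q.one_add_sq
        (by omega) (by omega)
  qcomm s t h ht :=
    serreFamily_gen.segOf_same_right nonRoot_q.ne_zero nonRoot_q.one_add_sq (by omega) (by omega)
  qints t := by
    unfold colC
    split_ifs
    exacts [qInts_qnumTwo, qInts_qnum]
  qnum_eq t ht := colC_of_lt ht

theorem foldRel (p : ℕ) : FoldRel q (colF (p + 1) (2 * (p + 1))) (colX (p + 1) 0)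
    (colX p (2 * p + 1)) (colX (p + 1) (2 * (p + 1))) (colX (p + 1) (2 * (p + 1) + 1))
    (segOf q gen (-1 - ((p + 1 : ℕ) : ℤ)) (2 * p + 2)) vac := by
  have h0 := nonRoot_q.ne_zero
  have h1 := nonRoot_q.one_add_sq
  have H := serreFamily_gen
  have eg : colF (p + 1) (2 * (p + 1)) = gen (-2 - p) := by
    unfold colF; congr 1; push_cast; ring
  have eh : colX (p + 1) 0 = gen (p + 1) := by
    rw [colX, segOf]; congr 1
  have es : colX p (2 * p + 1) = segOf q gen (-1 - p) (2 * p + 1) := by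
    unfold colX; congr 1; push_cast; ring
  have ex : colX (p + 1) (2 * (p + 1)) = segOf q gen (-1 - p) (2 * p + 2) := by
    unfold colX; congr 1; push_cast; ring
  have ew : colX (p + 1) (2 * (p + 1) + 1) = segOf q gen (-2 - p) (2 * p + 3) := by
    unfold colX; congr 1; push_cast; ring
  have et : segOf q gen (-1 - ((p + 1 : ℕ) : ℤ)) (2 * p + 2) = segOf q gen (-2 - p) (2 * p + 2) := by
    congr 1; push_cast; ring
  rw [eg, eh, es, ex, ew, et]
  refine ⟨?_, ?_, ?_, ?_, ?_, ?_, ?_, ?_, ?_, ?_, ?_, ?_⟩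
  · have := H.segOf_succ_left (-2 - p) (2 * p + 1)
    rw [show (-2 - p : ℤ) + 1 = -1 - p by ring] at this
    rw [this]; abel
  · have := segOf_succ (q := q) (g := gen) (-1 - p) (2 * p + 1)
    rw [show (-1 - p : ℤ) + ((2 * p + 1 : ℕ) : ℤ) + 1 = p + 1 by push_cast; ring] at this
    rw [this]; abel
  · have := H.segOf_succ_left (-2 - p) (2 * p + 2)
    rw [show (-2 - p : ℤ) + 1 = -1 - p by ring] at this
    rw [this]; abel
  · exact H.commute_far (Or.inl (by omega))
  · exact H.left_mul_segOf h0 _ _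
  · have h := H.segOf_mul_right h0 (-2 - p) (2 * p + 2)
    rwa [show (-2 - p : ℤ) + ((2 * p + 2 : ℕ) : ℤ) + 1 = p + 1 by push_cast; ring] at h
  · have h := H.segOf_mul_right h0 (-1 - p) (2 * p + 1)
    rwa [show (-1 - p : ℤ) + ((2 * p + 1 : ℕ) : ℤ) + 1 = p + 1 by push_cast; ring] at h
  · exact H.segOf_same_right h0 h1 (by omega) (by push_cast; ring)
  · exact H.segOf_same_right h0 h1 (by omega) (by push_cast; ring)
  · have := H.segOf_same_left h0 h1 (a := -1 - p) (l := 2 * p + 1) (n := 2 * p + 2) (by omega)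
    rw [this, smul_smul, inv_mul_cancel₀ h0, one_smul]
  · rw [gen_smul_vac]; congr 2; ring
  · have := H.theta_negative h0 h1 gen_smul_vac (p + 1) p (by omega)
    rw [show p + 1 + p + 1 = 2 * p + 2 by ring, show (-1 - ((p + 1 : ℕ) : ℤ)) = -2 - p by
      push_cast; ring] at this
    exact this

theorem foldRelZero : FoldRelZero q (colF 0 0) (colX 0 0) (colX 0 1) vac where
  gh := (column 0).skew 0 (by omega)
  gw := (column 0).semi 0 (by omega)
  wh := (column 0).qcomm 0 1 (by omega) (by omega)
  gφ := by
    unfold colF colX segOf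
    rw [gen_smul_vac]; congr 2

/-- The product of the columns `N - 1, …, 0` of the PBW monomial with exponents `m`. -/
def colProd (m : ℕ → ℕ → ℤ) : ℕ → U
  | 0 => 1
  | N + 1 => mon (colC N) (colX N) (m N) (2 * N + 2) * colProd m N

theorem colProd_congr {m n : ℕ → ℕ → ℤ} {N : ℕ} (h : ∀ p < N, ∀ t < 2 * p + 2, m p t = n p t) :
    colProd m N = colProd n N := by
  induction N with
  | zero => rfl
  | succ N ih => rw [colProd, colProd, ih fun p hp => h p (by omega), mon_congr (h N (by omega))]

/-- The span of the PBW vectors supported on the first `N` columns. -/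
def pbwSpan (R : Subring K) (N : ℕ) : AddSubgroup ThetaMod :=
  rspan R (Set.range fun m => colProd m N • vac)

section
variable {R : Subring K}

theorem vac_mem_pbwSpan : vac ∈ pbwSpan R 0 :=
  subset_rspan ⟨0, by simp [colProd]⟩

theorem mon_smul_mem {N : ℕ} (n : ℕ → ℤ) {v : ThetaMod} (hv : v ∈ pbwSpan R N) :
    mon (colC N) (colX N) n (2 * N + 2) • v ∈ pbwSpan R (N + 1) := by
  refine smul_mem_rspan_of_forall (B := U) ?_ hv
  rintro _ ⟨m, rfl⟩
  refine subset_rspan ⟨fun p => if p = N then n else m p, ?_⟩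
  change colProd _ _ • _ = _
  rw [colProd, if_pos rfl, mul_smul, colProd_congr (n := m)]
  intro p hp t ht
  rw [if_neg (by omega)]

theorem pbwSpan_succ (N : ℕ) : pbwSpan R (N + 1) = rspan R
    {v | ∃ n, ∃ w ∈ pbwSpan R N, v = mon (colC N) (colX N) n (2 * N + 2) • w} := by
  apply le_antisymm
  · refine rspan_le_rspan le_rfl ?_
    rintro _ ⟨m, rfl⟩
    exact subset_rspan ⟨m N, _, subset_rspan ⟨m, rfl⟩, by
      change colProd _ _ • _ = _; rw [colProd, mul_smul]⟩
  · refine rspan_le_rspan le_rfl ?_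
    rintro _ ⟨n, w, hw, rfl⟩
    exact mon_smul_mem n hw

theorem pbwSpan_le_succ (N : ℕ) : pbwSpan R N ≤ pbwSpan R (N + 1) := fun v hv => by
  have := mon_smul_mem (n := 0) hv
  rwa [mon_zero, one_smul] at this

theorem pbwSpan_mono : Monotone (pbwSpan R) := monotone_nat_of_le_succ pbwSpan_le_succ
end

theorem mon_eq_head {B : Type*} [Ring B] [Algebra K B] {C : ℕ → ℤ → K} {X : ℕ → B} {n : ℕ → ℤ}
    {L : ℕ} (h : ∀ s, 0 < s → s < L + 1 → n s = 0) :
    mon C X n (L + 1) = dpow (C 0) (X 0) (n 0) := by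
  induction L with
  | zero => simp [mon]
  | succ L ih => rw [mon, ih fun s h1 h2 => h s h1 (by omega), h (L + 1) (by omega) (by omega)]; simp

/-- A monomial supported on the first and the last two segments of a column. -/
theorem mon_three (p : ℕ) (a c z : ℤ) : mon (colC (p + 1)) (colX (p + 1))
    (fun s => if s = 0 then a else if s = 2 * (p + 1) then c else
      if s = 2 * (p + 1) + 1 then z else 0) (2 * (p + 1) + 2) =
    dpow (qnum q) (colX (p + 1) 0) a * dpow (qnum q) (colX (p + 1) (2 * (p + 1))) c *
      dpow (qnumTwo q) (colX (p + 1) (2 * (p + 1) + 1)) z := by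
  rw [mon, mon, colC_last, colC_of_lt (by omega), show 2 * (p + 1) = 2 * p + 1 + 1 by ring,
    mon_eq_head, colC_of_lt (by omega)]
  · simp
  · intro s h1 h2
    rw [if_neg (by omega), if_neg (by omega), if_neg (by omega)]

theorem mon_two (a z : ℤ) : mon (colC 0) (colX 0) (fun s => if s = 0 then a else z) 2 =
    dpow (qnum q) (colX 0 0) a * dpow (qnumTwo q) (colX 0 1) z := by
  rw [mon, mon, mon, colC_last 0, colC_of_lt (by omega)]
  simp

/-- The `ℚ[q,q⁻¹]`-subalgebra generated by the divided powers of the letters in `[-N, N)`. -/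
def divAlg (N : ℕ) : Subring U := Subring.closure
  ({x : U | ∃ c ∈ Lring, x = algebraMap K U c} ∪
   {x : U | ∃ k : ℤ, -(N : ℤ) ≤ k ∧ k < N ∧ ∃ r : ℕ, x = dpow (qnum q) (gen k) r})

theorem dpow_gen_mem_divAlg {N : ℕ} {k : ℤ} (h1 : -(N : ℤ) ≤ k) (h2 : k < N) (r : ℤ) :
    dpow (qnum q) (gen k) r ∈ divAlg N := by
  by_cases hr : r < 0
  · rw [dpow_of_neg hr]; exact Subring.zero_mem _
  lift r to ℕ using not_lt.1 hr
  exact Subring.subset_closure (Or.inr ⟨k, h1, h2, r, rfl⟩)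

theorem smul_mem_divAlg {N : ℕ} {c : K} (hc : c ∈ Lring) {u : U} (hu : u ∈ divAlg N) :
    c • u ∈ divAlg N := by
  rw [Algebra.smul_def]
  exact Subring.mul_mem _ (Subring.subset_closure (Or.inl ⟨c, hc, rfl⟩)) hu

theorem divAlg_mono : Monotone divAlg := fun M N h => Subring.closure_mono <| by
  rintro x (hx | ⟨k, h1, h2, hx⟩)
  · exact Or.inl hx
  · exact Or.inr ⟨k, by omega, by omega, hx⟩

theorem commute_divAlg {N : ℕ} {y u : U} (hu : u ∈ divAlg N)
    (h : ∀ k, -(N : ℤ) ≤ k → k < N → Commute y (gen k)) : Commute y u := by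
  induction hu using Subring.closure_induction with
  | mem x hx =>
    rcases hx with ⟨c, hc, rfl⟩ | ⟨k, h1, h2, r, rfl⟩
    · exact (Algebra.commutes c y).symm
    · exact commute_dpow (h k h1 h2) r
  | zero => exact Commute.zero_right y
  | one => exact Commute.one_right y
  | add _ _ _ _ h1 h2 => exact h1.add_right h2
  | neg _ _ h1 => exact h1.neg_right
  | mul _ _ _ _ h1 h2 => exact h1.mul_right h2

theorem colF_mem_divAlg {p t : ℕ} (ht : t < 2 * p + 1) (r : ℤ) :
    dpow (qnum q) (colF p t) r ∈ divAlg (p + 1) :=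
  dpow_gen_mem_divAlg (by push_cast; omega) (by push_cast; omega) r

/-- Divided powers of segments belong to the integral form. -/
theorem dpow_segOf_mem_divAlg {N : ℕ} {b : ℤ} (hb : b < N) (t : ℕ) (ht : -(N : ℤ) ≤ b - t) (r : ℤ) :
    dpow (qnum q) (segOf q gen (b - t) t) r ∈ divAlg N := by
  induction t generalizing r with
  | zero => exact dpow_gen_mem_divAlg (by simpa using ht) (by simpa using hb) r
  | succ t ih =>
    by_cases hr : r < 0
    · rw [dpow_of_neg hr]; exact Subring.zero_mem _
    lift r to ℕ using not_lt.1 hr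
    clear hr
    push_cast at ht
    have ih := ih (by omega)
    have H := serreFamily_gen
    have e : b - ((t + 1 : ℕ) : ℤ) = b - 1 - t := by push_cast; ring
    rw [e]
    induction r using Nat.strong_induction_on with
    | _ r ihr =>
    set f := gen (b - 1 - t)
    set x := segOf q gen (b - 1 - t) (t + 1)
    set s := segOf q gen (b - t) t
    have h1 : f * s = q • (s * f) + x := by
      have := H.segOf_succ_left (b - 1 - t) t
      rw [show b - 1 - (t : ℤ) + 1 = b - t by ring] at this
      rw [show x = _ from this]; abel
    have h2 : f * x = q⁻¹ • (x * f) := H.left_mul_segOf nonRoot_q.ne_zero _ _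
    have h3 : x * s = q⁻¹ • (s * x) := H.segOf_same_right nonRoot_q.ne_zero nonRoot_q.one_add_sq
      (by omega) (by push_cast; ring)
    have key := dpow_mul_dpow nonRoot_q h1 h2 h3 r r
    have hf : ∀ i : ℤ, dpow (qnum q) f i ∈ divAlg N :=
      fun i => dpow_gen_mem_divAlg (by omega) (by omega) i
    have := finsum_sub_mem (F := fun i : ℤ => q ^ (((r : ℤ) - i) * (r - i)) •
        (dpow (qnum q) s (r - i) * dpow (qnum q) x i * dpow (qnum q) f (r - i)))
      ?_ (divAlg N).toAddSubgroup r ?_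
    · rw [← key] at this
      simp only [sub_self, dpow_zero, one_mul, mul_one, mul_zero, zpow_zero, one_smul] at this
      have h4 := AddSubgroup.sub_mem _ ((divAlg N).mul_mem (hf r) (ih r)) this
      rwa [sub_sub_cancel] at h4
    · refine (Set.finite_Icc (0 : ℤ) r).subset fun i hi => ?_
      by_contra hc
      apply hi
      rw [Set.mem_Icc, not_and_or, not_le, not_le] at hc
      rcases hc with hc | hc
      · simp [dpow_of_neg hc]
      · simp [dpow_of_neg (show (r : ℤ) - i < 0 by omega)]
    · intro i hi
      by_cases h0 : i < 0 ∨ (r : ℤ) < i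
      · have : dpow (qnum q) s (r - i) * dpow (qnum q) x i = 0 := by
          rcases h0 with h0 | h0
          · rw [dpow_of_neg h0, mul_zero]
          · rw [dpow_of_neg (show (r : ℤ) - i < 0 by omega), zero_mul]
        simp only [this, zero_mul, smul_zero]
        exact AddSubgroup.zero_mem _
      · lift i to ℕ using by omega
        exact smul_mem_divAlg (zpow_mem_Lring _) (Subring.mul_mem _
          (Subring.mul_mem _ (ih _) (ihr i (by omega))) (hf _))

theorem dpow_colX_mem_divAlg {p t : ℕ} (ht : t < 2 * p + 2) (r : ℤ) :
    dpow (qnum q) (colX p t) r ∈ divAlg (p + 1) :=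
  dpow_segOf_mem_divAlg (by push_cast; omega) t (by push_cast; omega) r

/-- The image of `divAlg N` in the module. -/
def divSpan (N : ℕ) : AddSubgroup ThetaMod :=
  (divAlg N).toAddSubgroup.map ((smulAddHom U ThetaMod).flip vac)

theorem mem_divSpan {N : ℕ} {v : ThetaMod} : v ∈ divSpan N ↔ ∃ u ∈ divAlg N, v = u • vac := by
  constructor
  · rintro ⟨u, hu, rfl⟩
    exact ⟨u, hu, rfl⟩
  · rintro ⟨u, hu, rfl⟩
    exact ⟨u, hu, rfl⟩

theorem smul_mem_divSpan {N : ℕ} {u : U} (hu : u ∈ divAlg N) {v : ThetaMod} (hv : v ∈ divSpan N) :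
    u • v ∈ divSpan N := by
  obtain ⟨w, hw, rfl⟩ := mem_divSpan.1 hv
  exact mem_divSpan.2 ⟨u * w, Subring.mul_mem _ hu hw, (mul_smul _ _ _).symm⟩

theorem coeff_smul_mem_divSpan {N : ℕ} {c : K} (hc : c ∈ Lring) {v : ThetaMod} (hv : v ∈ divSpan N) :
    c • v ∈ divSpan N := by
  obtain ⟨w, hw, rfl⟩ := mem_divSpan.1 hv
  exact mem_divSpan.2 ⟨c • w, smul_mem_divAlg hc hw, (smul_assoc _ _ _).symm⟩

theorem divSpan_mono : Monotone divSpan := fun _ _ h => AddSubgroup.map_mono (divAlg_mono h)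

/-- The letters of the column `p` of index less than `p` commute with the self-dual segment. -/
theorem commute_last_gen (p : ℕ) {k : ℤ} (h1 : -(p : ℤ) ≤ k) (h2 : k < p) :
    Commute (colX p (2 * p + 1)) (gen k) :=
  (serreFamily_gen.commute_interior nonRoot_q.ne_zero nonRoot_q.one_add_sq (by omega)
    (by push_cast; omega)).symm

theorem commute_last_divAlg (p : ℕ) {u : U} (hu : u ∈ divAlg p) :
    Commute (colX p (2 * p + 1)) u :=
  commute_divAlg hu fun _ h1 h2 => commute_last_gen p h1 h2

/-- Modified divided powers of self-dual segments act integrally on the generator. -/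
theorem dpow_last_mem_divSpan (p : ℕ) (z : ℤ) :
    dpow (qnumTwo q) (colX p (2 * p + 1)) z • vac ∈ divSpan (p + 1) := by
  by_cases hz : z < 0
  · rw [dpow_of_neg hz, zero_smul]; exact AddSubgroup.zero_mem _
  lift z to ℕ using not_lt.1 hz
  clear hz
  have hvac : ∀ N, vac ∈ divSpan N := fun N => mem_divSpan.2 ⟨1, Subring.one_mem _, (one_smul U _).symm⟩
  induction p generalizing z with
  | zero =>
    induction z using Nat.strong_induction_on with
    | _ z ihz =>
    have key := foldRelZero.dpow_smul nonRoot_q (2 * z)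
    have := finsum_sub_mem (F := fun i : ℤ => q ^ tri (((2 * z : ℕ) : ℤ) - 2 * i) •
        dpow (qnum q) (colX 0 0) (((2 * z : ℕ) : ℤ) - 2 * i) • dpow (qnumTwo q) (colX 0 1) i • vac)
      ?_ (divSpan 1) z ?_
    · rw [← key] at this
      have h4 := AddSubgroup.sub_mem _ (smul_mem_divSpan
        (colF_mem_divAlg (p := 0) (t := 0) (by omega) (2 * z : ℕ)) (hvac 1)) this
      rw [sub_sub_cancel] at h4
      simpa [tri] using h4
    · refine (Set.finite_Icc (0 : ℤ) z).subset fun i hi => ?_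
      by_contra hc
      apply hi
      rw [Set.mem_Icc, not_and_or, not_le, not_le] at hc
      rcases hc with hc | hc
      · simp only [dpow_of_neg hc, zero_smul, smul_zero]
      · simp only [dpow_of_neg (show ((2 * z : ℕ) : ℤ) - 2 * i < 0 by push_cast; omega),
          zero_smul, smul_zero]
    · intro i hi
      by_cases h0 : i < 0 ∨ (z : ℤ) < i
      · rcases h0 with h0 | h0
        · simp only [dpow_of_neg h0, zero_smul, smul_zero]
          exact AddSubgroup.zero_mem _
        · simp only [dpow_of_neg (show ((2 * z : ℕ) : ℤ) - 2 * i < 0 by push_cast; omega),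
            zero_smul, smul_zero]
          exact AddSubgroup.zero_mem _
      · lift i to ℕ using by omega
        exact coeff_smul_mem_divSpan (zpow_mem_Lring _) (smul_mem_divSpan
          (dpow_colX_mem_divAlg (p := 0) (t := 0) (by omega) _) (ihz i (by omega)))
  | succ p ih =>
    induction z using Nat.strong_induction_on with
    | _ z ihz =>
    have key := (foldRel p).dpow_smul nonRoot_q (2 * z) z
    have ihall : ∀ y : ℤ, dpow (qnumTwo q) (colX p (2 * p + 1)) y • vac ∈ divSpan (p + 1) := by
      intro y
      by_cases hy : y < 0
      · rw [dpow_of_neg hy, zero_smul]; exact AddSubgroup.zero_mem _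
      lift y to ℕ using not_lt.1 hy
      exact ih y
    have := finsum_sub_mem (F := fun i : ℤ × ℤ => q ^ ((((2 * z : ℕ) : ℤ) - i.1 - 2 * i.2) *
        (2 * ((z : ℤ) - i.1 - i.2) + i.1) + tri i.1) •
      foldTerm q (colX (p + 1) 0) (colX (p + 1) (2 * (p + 1))) (colX (p + 1) (2 * (p + 1) + 1))
        (colX p (2 * p + 1)) vac (((2 * z : ℕ) : ℤ) - i.1 - 2 * i.2) i.1 i.2 ((z : ℤ) - i.1 - i.2))
      ?_ (divSpan (p + 2)) (0, (z : ℤ)) ?_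
    · rw [← key] at this
      have h4 := AddSubgroup.sub_mem _ (smul_mem_divSpan
        (colF_mem_divAlg (p := p + 1) (t := 2 * (p + 1)) (by omega) (2 * z : ℕ))
          (divSpan_mono (Nat.le_succ (p + 1)) (ih z))) this
      rw [sub_sub_cancel] at h4
      simpa [tri, foldTerm] using h4
    · refine ((Set.finite_Icc (0 : ℤ) z).prod (Set.finite_Icc (0 : ℤ) z)).subset fun i hi => ?_
      by_contra hc
      apply hi
      have : i.1 < 0 ∨ i.2 < 0 ∨ (z : ℤ) - i.1 - i.2 < 0 := by
        rw [Set.mem_prod, Set.mem_Icc, Set.mem_Icc] at hc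
        omega
      rcases this with h | h | h <;> simp [foldTerm, dpow_of_neg h]
    · intro i hi
      by_cases h0 : i.1 < 0 ∨ i.2 < 0 ∨ (z : ℤ) - i.1 - i.2 < 0
      · rcases h0 with h | h | h <;> simp only [foldTerm, dpow_of_neg h, zero_smul, smul_zero] <;>
          exact AddSubgroup.zero_mem _
      · obtain ⟨i, j⟩ := i
        simp only [not_or, not_lt] at h0
        obtain ⟨h1, h2, h3⟩ := h0
        lift j to ℕ using h2
        have hj : j < z := by
          have : (i, (j : ℤ)) ≠ (0, (z : ℤ)) := hi
          rw [Ne, Prod.mk.injEq] at this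
          omega
        refine coeff_smul_mem_divSpan (zpow_mem_Lring _) (smul_mem_divSpan
          (dpow_colX_mem_divAlg (p := p + 1) (t := 0) (by omega) _) (smul_mem_divSpan
          (dpow_colX_mem_divAlg (p := p + 1) (by omega) _) ?_))
        obtain ⟨u, hu, e⟩ := mem_divSpan.1 (ihall ((z : ℤ) - i - j))
        have hc := commute_dpow (C := qnumTwo q) (commute_last_divAlg (p + 1) hu).symm j
        change dpow (qnumTwo q) (colX (p + 1) (2 * (p + 1) + 1)) (j : ℤ) • _ ∈ _
        rw [e, ← mul_smul, ← hc.eq, mul_smul]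
        exact smul_mem_divSpan (divAlg_mono (Nat.le_succ (p + 1)) hu) (ihz j hj)

theorem mon_mem_divAlg (p : ℕ) (n : ℕ → ℤ) {L : ℕ} (hL : L ≤ 2 * p + 1) :
    mon (colC p) (colX p) n L ∈ divAlg (p + 1) := by
  induction L with
  | zero => exact Subring.one_mem _
  | succ L ih =>
    rw [mon, colC_of_lt (by omega)]
    exact Subring.mul_mem _ (ih (by omega)) (dpow_colX_mem_divAlg (by omega) _)

theorem mon_last_mul (p : ℕ) (n : ℕ → ℤ) {u : U} (hu : u ∈ divAlg p) :
    mon (colC p) (colX p) n (2 * p + 2) * u = mon (colC p) (colX p) n (2 * p + 1) * u *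
      dpow (qnumTwo q) (colX p (2 * p + 1)) (n (2 * p + 1)) := by
  rw [mon, colC_last, mul_assoc, mul_assoc]
  congr 1
  exact (commute_dpow (commute_last_divAlg p hu).symm _).eq.symm

theorem pbwSpan_le_divSpan (N : ℕ) : pbwSpan Lring N ≤ divSpan N := by
  induction N with
  | zero =>
    intro v hv
    refine rspan_induction (p := (· ∈ divSpan 0)) ?_ (AddSubgroup.zero_mem _)
      (fun _ _ => AddSubgroup.add_mem _) (fun c hc v hv => coeff_smul_mem_divSpan hc hv) hv
    rintro _ ⟨m, rfl⟩
    exact mem_divSpan.2 ⟨1, Subring.one_mem _, rfl⟩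
  | succ N ih =>
    intro v hv
    rw [pbwSpan_succ] at hv
    refine rspan_induction (p := (· ∈ divSpan (N + 1))) ?_ (AddSubgroup.zero_mem _)
      (fun _ _ => AddSubgroup.add_mem _) (fun c hc v hv => coeff_smul_mem_divSpan hc hv) hv
    rintro _ ⟨n, w, hw, rfl⟩
    obtain ⟨u, hu, rfl⟩ := mem_divSpan.1 (ih hw)
    rw [← mul_smul, mon_last_mul N n hu, mul_smul]
    exact smul_mem_divSpan (Subring.mul_mem _ (mon_mem_divAlg N n le_rfl)
      (divAlg_mono (Nat.le_succ N) hu)) (dpow_last_mem_divSpan N _)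

section
variable {R : Subring K} (hR : Lring ≤ R)
include hR

theorem mon_smul_mem_succ {N : ℕ} (n : ℕ → ℤ) {v : ThetaMod} (hv : v ∈ pbwSpan R (N + 1)) :
    mon (colC N) (colX N) n (2 * N + 2) • v ∈ pbwSpan R (N + 1) := by
  have hv' := hv
  rw [pbwSpan_succ] at hv'
  refine smul_mem_rspan_of_forall (B := U) ?_ hv'
  rintro _ ⟨m, w, hw, rfl⟩
  obtain ⟨b, hb, e⟩ := (column N).mon_mul_mon le_rfl n m
  rw [← mul_smul, e, smul_assoc]
  exact smul_mem_rspan (hR hb) (mon_smul_mem _ hw)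

omit hR in
theorem divAlg_smul_mem_of_letters {N : ℕ} {S : AddSubgroup ThetaMod}
    (hS : ∀ c ∈ Lring, ∀ v ∈ S, c • v ∈ S)
    (h : ∀ k : ℤ, -(N : ℤ) ≤ k → k < N → ∀ r : ℕ, ∀ v ∈ S, dpow (qnum q) (gen k) r • v ∈ S)
    {u : U} (hu : u ∈ divAlg N) : ∀ v ∈ S, u • v ∈ S := by
  induction hu using Subring.closure_induction with
  | mem x hx =>
    rcases hx with ⟨c, hc, rfl⟩ | ⟨k, h1, h2, r, rfl⟩
    · intro v hv; rw [algebraMap_smul]; exact hS c hc v hv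
    · exact h k h1 h2 r
  | zero => intro v _; rw [zero_smul]; exact S.zero_mem
  | one => intro v hv; rwa [one_smul]
  | add _ _ _ _ h1 h2 => intro v hv; rw [add_smul]; exact S.add_mem (h1 v hv) (h2 v hv)
  | neg _ _ h1 => intro v hv; rw [neg_smul]; exact S.neg_mem (h1 v hv)
  | mul _ _ _ _ h1 h2 => intro v hv; rw [mul_smul]; exact h1 _ (h2 v hv)

end

theorem head_smul_mem {p : ℕ} (r : ℤ) {v : ThetaMod} (hv : v ∈ pbwSpan Lring (p + 1)) :
    dpow (qnum q) (colX p 0) r • v ∈ pbwSpan Lring (p + 1) := by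
  have := mon_smul_mem_succ le_rfl (fun s => if s = 0 then r else 0) hv
  rw [mon_eq_head (L := 2 * p + 1) (fun s h1 _ => if_neg (by omega)), colC_of_lt (by omega)] at this
  simpa using this

theorem letter_smul_mem {p t : ℕ} (ht : t < 2 * p + 1) (r : ℕ)
    (h : ∀ j : ℕ, ∀ v ∈ pbwSpan Lring p, dpow (qnum q) (colF p t) j • v ∈ pbwSpan Lring (p + 1))
    {v : ThetaMod} (hv : v ∈ pbwSpan Lring (p + 1)) :
    dpow (qnum q) (colF p t) r • v ∈ pbwSpan Lring (p + 1) := by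
  have hv' := hv
  rw [pbwSpan_succ] at hv'
  refine smul_mem_rspan_of_forall (B := U) ?_ hv'
  rintro _ ⟨m, w, hw, rfl⟩
  rw [← mul_smul]
  refine rspan_induction (p := fun u : U => u • w ∈ pbwSpan Lring (p + 1)) ?_ ?_ ?_ ?_
    ((column p).dpow_mul_mon ht r m)
  · rintro _ ⟨i, j, rfl⟩
    rw [mul_smul]
    exact mon_smul_mem_succ le_rfl _ (h j w hw)
  · rw [zero_smul]; exact AddSubgroup.zero_mem _
  · intro a b ha hb; rw [add_smul]; exact AddSubgroup.add_mem _ ha hb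
  · intro c hc a ha; rw [smul_assoc]; exact smul_mem_rspan hc ha

theorem colX_zero (p : ℕ) : colX p 0 = gen p := by
  rw [colX, segOf]; congr 1

theorem inner_smul_mem {p : ℕ} (ih : ∀ u ∈ divAlg p, ∀ v ∈ pbwSpan Lring p, u • v ∈ pbwSpan Lring p)
    {u : U} (hu : u ∈ divAlg p) {v : ThetaMod} (hv : v ∈ pbwSpan Lring (p + 1)) :
    u • v ∈ pbwSpan Lring (p + 1) := by
  refine divAlg_smul_mem_of_letters (fun c hc v hv => smul_mem_rspan hc hv) ?_ hu v hv
  intro k h1 h2 r v hv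
  obtain ⟨t, ht, rfl⟩ : ∃ t : ℕ, t < 2 * p ∧ (p : ℤ) - 1 - t = k := ⟨(p - 1 - k).toNat, by omega, by omega⟩
  exact letter_smul_mem (by omega) r (fun j w hw => pbwSpan_le_succ p
    (ih _ (dpow_gen_mem_divAlg h1 h2 _) w hw)) hv

theorem fold_smul_mem {p : ℕ} (ih : ∀ u ∈ divAlg p, ∀ v ∈ pbwSpan Lring p, u • v ∈ pbwSpan Lring p)
    (r : ℕ) {v : ThetaMod} (hv : v ∈ pbwSpan Lring p) :
    dpow (qnum q) (colF p (2 * p)) r • v ∈ pbwSpan Lring (p + 1) := by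
  cases p with
  | zero =>
    refine smul_mem_rspan_of_forall (B := U) ?_ hv
    rintro _ ⟨m, rfl⟩
    have e : colProd m 0 • vac = vac := one_smul _ _
    change dpow _ _ _ • colProd m 0 • vac ∈ pbwSpan Lring 1
    rw [e]
    have key := foldRelZero.dpow_smul nonRoot_q r
    rw [show 2 * 0 = 0 by rfl, key]
    refine finsum_mem_of_forall _ fun i => smul_mem_rspan (zpow_mem_Lring _) ?_
    rw [← mul_smul, ← mon_two]
    exact mon_smul_mem _ vac_mem_pbwSpan
  | succ p =>
    have hv' := hv
    rw [pbwSpan_succ] at hv'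
    refine smul_mem_rspan_of_forall (B := U) ?_ hv'
    rintro _ ⟨n, w, hw, rfl⟩
    obtain ⟨u, hu, rfl⟩ := mem_divSpan.1 (pbwSpan_le_divSpan p hw)
    set g := colF (p + 1) (2 * (p + 1)) with hg
    have hgu : Commute g u := commute_divAlg hu fun k h1 h2 => by
      rw [hg, colF]
      exact serreFamily_gen.commute_far (by push_cast; omega)
    have hgm : Commute g (mon (colC p) (colX p) n (2 * p + 1)) := by
      refine commute_mon fun s hs => ?_
      rw [hg, colF, colX]
      exact serreFamily_gen.commute_far_segOf (Or.inl (by push_cast; omega))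
    have hc := (commute_dpow (C := qnum q) (hgm.mul_right hgu).symm r).eq
    rw [← mul_smul, ← mul_smul, mul_assoc, mon_last_mul p n hu, ← mul_assoc, ← hc,
      mul_smul, mul_smul _ (dpow _ _ _)]
    refine inner_smul_mem ih (Subring.mul_mem _ (mon_mem_divAlg p n le_rfl)
      (divAlg_mono (Nat.le_succ p) hu)) ?_
    rw [(foldRel p).dpow_smul nonRoot_q]
    refine finsum_mem_of_forall _ fun i => smul_mem_rspan (zpow_mem_Lring _) ?_
    rw [foldTerm, ← mul_smul, ← mul_smul, ← mon_three]
    refine mon_smul_mem _ ?_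
    have := mon_smul_mem (R := Lring) (N := p)
      (fun s => if s = 2 * p + 1 then n (2 * p + 1) - i.1 - i.2 else 0)
      (pbwSpan_mono (Nat.zero_le p) vac_mem_pbwSpan)
    rw [mon, mon_congr (m := 0) (L := 2 * p + 1) (fun s hs => by
      rw [if_neg (by omega), Pi.zero_apply]), mon_zero, one_mul, colC_last, if_pos rfl] at this
    exact this

/-- The integral span of the PBW vectors is stable under the integral form. -/
theorem divAlg_smul_mem_pbwSpan (N : ℕ) :
    ∀ u ∈ divAlg N, ∀ v ∈ pbwSpan Lring N, u • v ∈ pbwSpan Lring N := by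
  induction N with
  | zero =>
    intro u hu
    exact divAlg_smul_mem_of_letters (fun c hc v hv => smul_mem_rspan hc hv)
      (fun k h1 h2 => by omega) hu
  | succ p ih =>
    intro u hu
    refine divAlg_smul_mem_of_letters (fun c hc v hv => smul_mem_rspan hc hv) ?_ hu
    intro k h1 h2 r v hv
    by_cases hk : k = p
    · rw [hk, ← colX_zero]
      exact head_smul_mem r hv
    · by_cases hk' : k < -p
      · have : gen k = colF p (2 * p) := by unfold colF; congr 1; push_cast at h1 ⊢; omega
        rw [this]
        exact letter_smul_mem (by omega) r (fun j w hw => fold_smul_mem ih j hw) hv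
      · exact inner_smul_mem ih (dpow_gen_mem_divAlg (by omega) (by omega) r) hv

theorem pbwSpan_eq_divSpan (N : ℕ) : pbwSpan Lring N = divSpan N := by
  refine le_antisymm (pbwSpan_le_divSpan N) fun v hv => ?_
  obtain ⟨u, hu, rfl⟩ := mem_divSpan.1 hv
  exact divAlg_smul_mem_pbwSpan N u hu _ (pbwSpan_mono (Nat.zero_le N) vac_mem_pbwSpan)

theorem qfact_smul_pow (a : ℤ) (n : ℕ) :
    (qfact n)⁻¹ • fgen (2 * a + 1) ^ n = dpow (qnum q) (gen a) n := by
  rw [dpow_natCast, fgen_odd, qfact]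
  simp only [qint_eq_qnum]

theorem mem_UA_iff {u : U} : u ∈ UA ↔ ∃ N, u ∈ divAlg N := by
  constructor
  · intro hu
    have dir : Directed (· ≤ ·) divAlg := divAlg_mono.directed_le
    have : UA ≤ ⨆ N, divAlg N := by
      refine Subring.closure_le.2 ?_
      rintro x (⟨c, hc, rfl⟩ | ⟨i, n, hi, rfl⟩)
      · exact Subring.mem_iSup_of_directed dir |>.2
          ⟨0, Subring.subset_closure (Or.inl ⟨c, (mem_Lring_iff _).2 hc, rfl⟩)⟩
      · obtain ⟨a, rfl⟩ := hi
        rw [qfact_smul_pow]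
        exact Subring.mem_iSup_of_directed dir |>.2
          ⟨a.natAbs + 1, dpow_gen_mem_divAlg (by omega) (by omega) _⟩
    exact (Subring.mem_iSup_of_directed dir).1 (this hu)
  · rintro ⟨N, hu⟩
    revert u
    change divAlg N ≤ UA
    refine Subring.closure_le.2 ?_
    rintro x (⟨c, hc, rfl⟩ | ⟨k, _, _, r, rfl⟩)
    · exact Subring.subset_closure (Or.inl ⟨c, (mem_Lring_iff _).1 hc, rfl⟩)
    · exact Subring.subset_closure (Or.inr ⟨2 * k + 1, r, ⟨k, rfl⟩, (qfact_smul_pow k r).symm⟩)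

theorem mem_VA_iff {v : ThetaMod} : (show Vt from v) ∈ VA ↔ ∃ N, v ∈ pbwSpan Lring N := by
  constructor
  · rintro ⟨u, hu, rfl⟩
    obtain ⟨N, hN⟩ := mem_UA_iff.1 hu
    exact ⟨N, by rw [pbwSpan_eq_divSpan]; exact mem_divSpan.2 ⟨u, hN, rfl⟩⟩
  · rintro ⟨N, hv⟩
    rw [pbwSpan_eq_divSpan] at hv
    obtain ⟨u, hu, rfl⟩ := mem_divSpan.1 hv
    exact ⟨u, mem_UA_iff.2 ⟨N, hu⟩, rfl⟩

theorem prod_map_range_of_eq_one {F : ℕ → U} {L L' : ℕ} (h : L ≤ L')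
    (hF : ∀ b, L ≤ b → b < L' → F b = 1) :
    ((List.range L').map F).prod = ((List.range L).map F).prod := by
  induction L', h using Nat.le_induction with
  | base => rfl
  | succ L' h ih =>
    rw [List.range_succ, List.map_append, List.prod_append, ih fun b h1 h2 => hF b h1 (by omega)]
    simp [hF L' h (by omega)]

/-- The exponents of a multisegment, by column. -/
def cols (m : MS) (p t : ℕ) : ℤ := m (2 * ((p : ℤ) - t) + 1, 2 * p + 1)

theorem segPowM_zero (i j : ℤ) : segPowM i j 0 = 1 := by
  simp [segPowM, segPow, qfact]

theorem segPowM_eq (p t : ℕ) (n : ℤ) : segPowM (2 * ((p : ℤ) - t) + 1) (2 * p + 1) n =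
    dpow (colC p t) (colX p t) n := by
  have e : seg (2 * ((p : ℤ) - t) + 1) (2 * p + 1) = colX p t := by
    rw [seg, show (((2 * p + 1 : ℤ) - (2 * ((p : ℤ) - t) + 1)) / 2).toNat = t by omega, segAux_eq]
    rfl
  rw [segPowM, colC]
  by_cases h : t = 2 * p + 1
  · rw [if_pos (by omega), if_pos h, e, dpow]
    simp only [qint_eq_qnum, qnumTwo]
  · rw [if_neg (by omega), if_neg h, segPow, e, dpow, qfact]
    simp only [qint_eq_qnum]

theorem inner_prod {m : MS} (hm : IsTheta m) {N p : ℕ} (hp : 2 * p + 1 ≤ N) :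
    ((List.range (2 * N + 1)).map fun b : ℕ =>
      segPowM ((N : ℤ) - b) (2 * p + 1) (m ((N : ℤ) - b, 2 * p + 1))).prod =
    mon (colC p) (colX p) (cols m p) (2 * p + 2) := by
  set F : ℕ → U := fun b : ℕ => segPowM ((N : ℤ) - b) (2 * p + 1) (m ((N : ℤ) - b, 2 * p + 1))
    with hF
  have hone : ∀ b : ℕ, ¬ (Odd ((N : ℤ) - b) ∧ -(2 * p + 1 : ℤ) ≤ N - b ∧ (N : ℤ) - b ≤ 2 * p + 1) →
      F b = 1 := by
    intro b hb
    have : m ((N : ℤ) - b, 2 * p + 1) = 0 := by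
      by_contra h
      obtain ⟨h1, _, h2, h3, _⟩ := hm _ _ h
      exact hb ⟨h1, h2, h3⟩
    rw [hF]
    dsimp only
    rw [this, segPowM_zero]
  obtain ⟨d, rfl⟩ : ∃ d, N = 2 * p + 1 + d := ⟨N - (2 * p + 1), by omega⟩
  have key : ∀ t : ℕ, ((List.range (d + 2 * t)).map F).prod = mon (colC p) (colX p) (cols m p) t := by
    intro t
    induction t with
    | zero =>
      rw [prod_map_range_of_eq_one (Nat.zero_le (d + 2 * 0))]
      · rfl
      · intro b _ hb
        exact hone b fun h => by omega
    | succ t ih =>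
      rw [show d + 2 * (t + 1) = d + 2 * t + 1 + 1 by ring, List.range_succ, List.range_succ]
      rw [List.map_append, List.map_append, List.prod_append, List.prod_append, ih, mon]
      rw [List.map_singleton, List.map_singleton, List.prod_singleton, List.prod_singleton,
        hone (d + 2 * t + 1), mul_one]
      · congr 1
        rw [hF]
        dsimp only
        rw [show (((2 * p + 1 + d : ℕ) : ℤ) - (d + 2 * t : ℕ)) = 2 * ((p : ℤ) - t) + 1 by
          push_cast; ring, segPowM_eq]
        rfl
      · rintro ⟨⟨x, hx⟩, _⟩
        push_cast at hx
        omega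
  rw [← key (2 * p + 2)]
  rcases le_total (2 * (2 * p + 1 + d) + 1) (d + 2 * (2 * p + 2)) with h | h
  · refine (prod_map_range_of_eq_one h ?_).symm
    intro b h1 h2
    exact hone b fun h => by push_cast at h; omega
  · refine prod_map_range_of_eq_one h ?_
    intro b h1 h2
    exact hone b fun h => by push_cast at h; omega

theorem inner_prod_one {m : MS} (hm : IsTheta m) {N : ℕ} {j : ℤ} (hj : ¬ (Odd j ∧ 0 < j)) :
    ((List.range (2 * N + 1)).map fun b : ℕ => segPowM ((N : ℤ) - b) j (m ((N : ℤ) - b, j))).prod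
      = 1 := by
  rw [prod_map_range_of_eq_one (Nat.zero_le _)]
  · rfl
  · intro b _ _
    have : m ((N : ℤ) - b, j) = 0 := by
      by_contra h
      obtain ⟨h1, h2, h3, h4, _⟩ := hm _ _ h
      refine hj ⟨h2, ?_⟩
      obtain ⟨x, rfl⟩ := h2
      omega
    rw [this, segPowM_zero]

theorem PthetaProd_eq_colProd {m : MS} (hm : IsTheta m) :
    PthetaProd m = colProd (cols m) ((bound m + 1) / 2) := by
  set N := bound m
  set D : ℤ → U := fun j => ((List.range (2 * N + 1)).map fun b : ℕ =>
    segPowM ((N : ℤ) - b) j (m ((N : ℤ) - b, j))).prod with hD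
  have h1 : PthetaProd m = ((List.range (2 * N + 1)).map fun a : ℕ => D ((N : ℤ) - a)).prod := by
    rw [PthetaProd, box, List.map_flatMap, List.flatMap_def, List.prod_flatten]
    simp only [List.map_map, bind_pure_comp, List.map_eq_map]
    rfl
  have h2 : ∀ J : ℕ, J ≤ N → ((List.range J).map fun a : ℕ => D ((J : ℤ) - a)).prod =
      colProd (cols m) ((J + 1) / 2) := by
    intro J
    induction J with
    | zero => intro _; rfl
    | succ J ih =>
      intro hJ
      rw [List.range_succ_eq_map, List.map_cons, List.prod_cons, List.map_map]
      have : ((fun a : ℕ => D (((J + 1 : ℕ) : ℤ) - a)) ∘ Nat.succ) = fun a : ℕ => D ((J : ℤ) - a) := by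
        funext a
        simp only [Function.comp, Nat.succ_eq_add_one]
        congr 1; push_cast; ring
      rw [this, ih (by omega)]
      rcases Nat.even_or_odd' J with ⟨p, rfl | rfl⟩
      · rw [show (2 * p + 1 + 1) / 2 = p + 1 by omega, show (2 * p + 1) / 2 = p by omega, colProd,
          ← inner_prod hm hJ]
        simp [hD]
      · rw [show (2 * p + 1 + 1 + 1) / 2 = p + 1 by omega, show (2 * p + 1 + 1) / 2 = p + 1 by omega,
          hD]
        dsimp only
        rw [inner_prod_one hm, one_mul]
        rintro ⟨⟨x, hx⟩, _⟩
        push_cast at hx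
        omega
  rw [h1, ← h2 N le_rfl]
  refine prod_map_range_of_eq_one (by omega) ?_
  intro b hb _
  exact inner_prod_one hm fun h => by omega

theorem eq_zero_of_bound_lt {m : MS} {i j : ℤ} (h : (bound m : ℤ) < j) : m (i, j) = 0 := by
  by_contra hc
  have := Finset.le_sup (f := fun p : ℤ × ℤ => max p.1.natAbs p.2.natAbs)
    (Finsupp.mem_support_iff.2 hc)
  change _ ≤ bound m at this
  have : j.natAbs ≤ bound m := (le_max_right _ _).trans this
  omega

theorem colProd_eq_of_zero {n : ℕ → ℕ → ℤ} {N M : ℕ} (h : N ≤ M)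
    (hn : ∀ p, N ≤ p → ∀ t, n p t = 0) : colProd n M = colProd n N := by
  induction M, h using Nat.le_induction with
  | base => rfl
  | succ M h ih =>
    rw [colProd, ih, show n M = 0 from funext (hn M h), mon_zero, one_mul]

theorem Ptheta_eq_colProd {m : MS} (hm : IsTheta m) {N : ℕ} (hN : bound m ≤ 2 * N) :
    Ptheta m = colProd (cols m) N := by
  rw [Ptheta, if_pos hm, PthetaProd_eq_colProd hm]
  refine (colProd_eq_of_zero (by omega) ?_).symm
  intro p hp t
  exact eq_zero_of_bound_lt (by omega)

/-- The PBW vectors. -/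
def pbwVec (m : MS) : ThetaMod := Ptheta m • vac

/-- Every nonnegative exponent function on the first `N` columns comes from a multisegment. -/
theorem exists_multisegment (n : ℕ → ℕ → ℤ) (N : ℕ) (h : ∀ p < N, ∀ t < 2 * p + 2, 0 ≤ n p t) :
    ∃ m : MS, IsTheta m ∧ bound m ≤ 2 * N ∧ (∀ p < N, ∀ t < 2 * p + 2, cols m p t = n p t) := by
  set F : ℤ × ℤ → ℤ := fun x => if Odd x.1 ∧ Odd x.2 ∧ -x.2 ≤ x.1 ∧ x.1 ≤ x.2 ∧ x.2 < 2 * N then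
    n (x.2 / 2).toNat ((x.2 - x.1) / 2).toNat else 0 with hF
  have hsupp : ∀ x, F x ≠ 0 → Odd x.1 ∧ Odd x.2 ∧ -x.2 ≤ x.1 ∧ x.1 ≤ x.2 ∧ x.2 < 2 * N := by
    intro x hx
    by_contra hc
    exact hx (if_neg hc)
  have hfin : F.support.Finite := by
    refine ((Set.finite_Icc (-(2 * N) : ℤ) (2 * N)).prod (Set.finite_Icc (-(2 * N) : ℤ) (2 * N))).subset
      fun x hx => ?_
    have := hsupp x hx
    rw [Set.mem_prod, Set.mem_Icc, Set.mem_Icc]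
    omega
  refine ⟨Finsupp.ofSupportFinite F hfin, ?_, ?_, ?_⟩
  · intro i j hij
    obtain ⟨h1, h2, h3, h4, h5⟩ := hsupp (i, j) hij
    refine ⟨h1, h2, h3, h4, lt_of_le_of_ne ?_ (Ne.symm hij)⟩
    change 0 ≤ F (i, j)
    rw [hF]
    dsimp only
    rw [if_pos ⟨h1, h2, h3, h4, h5⟩]
    obtain ⟨a, rfl⟩ := h1
    obtain ⟨b, rfl⟩ := h2
    dsimp only at *
    exact h _ (by omega) _ (by omega)
  · refine Finset.sup_le fun x hx => ?_
    have := hsupp x (Finsupp.mem_support_iff.1 hx)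
    rw [max_le_iff]
    omega
  · intro p hp t ht
    change F _ = _
    rw [hF]
    dsimp only
    rw [if_pos ⟨⟨_, rfl⟩, ⟨_, rfl⟩, by omega, by omega, by omega⟩]
    congr 2 <;> omega

theorem colProd_of_neg {n : ℕ → ℕ → ℤ} {N p t : ℕ} (hp : p < N) (ht : t < 2 * p + 2)
    (h : n p t < 0) : colProd n N = 0 := by
  induction N with
  | zero => omega
  | succ N ih =>
    rw [colProd]
    rcases Nat.lt_succ_iff_lt_or_eq.1 hp with h' | rfl
    · rw [ih h', mul_zero]
    · rw [mon_of_neg ht h, zero_mul]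

theorem pbwVec_mem_pbwSpan {R : Subring K} {m : MS} (hm : IsTheta m) {N : ℕ}
    (hN : bound m ≤ 2 * N) : pbwVec m ∈ pbwSpan R N :=
  subset_rspan ⟨cols m, by rw [pbwVec, Ptheta_eq_colProd hm hN]⟩

theorem mem_rspan_pbwVec_iff {R : Subring K} {v : ThetaMod} :
    v ∈ rspan R (pbwVec '' {m | IsTheta m}) ↔ ∃ N, v ∈ pbwSpan R N := by
  constructor
  · intro hv
    refine rspan_induction (p := fun v => ∃ N, v ∈ pbwSpan R N) ?_ ⟨0, AddSubgroup.zero_mem _⟩ ?_ ?_ hv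
    · rintro _ ⟨m, hm, rfl⟩
      exact ⟨bound m, pbwVec_mem_pbwSpan hm (by omega)⟩
    · rintro v w ⟨N, hv⟩ ⟨M, hw⟩
      exact ⟨max N M, AddSubgroup.add_mem _ (pbwSpan_mono (le_max_left _ _) hv)
        (pbwSpan_mono (le_max_right _ _) hw)⟩
    · rintro c hc v ⟨N, hv⟩
      exact ⟨N, smul_mem_rspan hc hv⟩
  · rintro ⟨N, hv⟩
    refine rspan_le_rspan le_rfl ?_ hv
    rintro _ ⟨n, rfl⟩
    change colProd n N • vac ∈ _
    by_cases h : ∀ p < N, ∀ t < 2 * p + 2, 0 ≤ n p t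
    · obtain ⟨m, hm, hb, e⟩ := exists_multisegment n N h
      refine subset_rspan ⟨m, hm, ?_⟩
      rw [pbwVec, Ptheta_eq_colProd hm hb, colProd_congr e]
    · push Not at h
      obtain ⟨p, hp, t, ht, h⟩ := h
      rw [colProd_of_neg hp ht h, zero_smul]
      exact AddSubgroup.zero_mem _

theorem gen_smul_mem_pbwSpan {N : ℕ} {k : ℤ} (h1 : -(N : ℤ) ≤ k) (h2 : k < N) {v : ThetaMod}
    (hv : v ∈ pbwSpan ⊤ N) : gen k • v ∈ pbwSpan ⊤ N := by
  refine smul_mem_rspan_of_forall (B := U) ?_ hv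
  rintro _ ⟨m, rfl⟩
  have := divAlg_smul_mem_pbwSpan N _ (dpow_gen_mem_divAlg h1 h2 1) _ (subset_rspan ⟨m, rfl⟩)
  have e : dpow (qnum q) (gen k) 1 = gen k := by
    have := dpow_natCast (C := qnum q) (x := gen k) 1
    rw [Nat.cast_one] at this
    rw [this]
    simp [nonRoot_q.qnum_one]
  rw [e] at this
  exact rspan_le_rspan le_top (fun v hv => subset_rspan hv) this

/-- The span of the monomials of column `p` with exponents satisfying `P`, applied to the
span of the previous columns. -/
def expSpan (p : ℕ) (P : (ℕ → ℤ) → Prop) : AddSubgroup ThetaMod :=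
  rspan ⊤ {v | ∃ n, P n ∧ ∃ w ∈ pbwSpan ⊤ p, v = mon (colC p) (colX p) n (2 * p + 2) • w}

section
variable {p : ℕ} {P P' : (ℕ → ℤ) → Prop}

theorem mem_expSpan {n : ℕ → ℤ} (h : P n) {w : ThetaMod} (hw : w ∈ pbwSpan ⊤ p) :
    mon (colC p) (colX p) n (2 * p + 2) • w ∈ expSpan p P :=
  subset_rspan ⟨n, h, w, hw, rfl⟩

theorem coeff_smul_mem_expSpan (c : K) {v : ThetaMod} (hv : v ∈ expSpan p P) :
    c • v ∈ expSpan p P := smul_mem_rspan (Subring.mem_top c) hv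

theorem expSpan_mono (h : ∀ n, P n → P' n) : expSpan p P ≤ expSpan p P' := by
  refine rspan_le_rspan le_rfl ?_
  rintro _ ⟨n, hn, w, hw, rfl⟩
  exact mem_expSpan (h n hn) hw

theorem smul_mem_expSpan {u : U} (h : ∀ n, P n → ∀ w ∈ pbwSpan ⊤ p,
    u • mon (colC p) (colX p) n (2 * p + 2) • w ∈ expSpan p P') {v : ThetaMod}
    (hv : v ∈ expSpan p P) : u • v ∈ expSpan p P' := by
  refine smul_mem_rspan_of_forall (B := U) ?_ hv
  rintro _ ⟨n, hn, w, hw, rfl⟩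
  exact h n hn w hw

theorem mon_smul_mon_smul (p : ℕ) (n m : ℕ → ℤ) : ∃ c : K, ∀ w : ThetaMod,
    mon (colC p) (colX p) n (2 * p + 2) • mon (colC p) (colX p) m (2 * p + 2) • w =
    c • mon (colC p) (colX p) (n + m) (2 * p + 2) • w := by
  obtain ⟨b, _, e⟩ := (column p).mon_mul_mon le_rfl n m
  exact ⟨b, fun w => by rw [← mul_smul, e, smul_assoc]⟩

theorem mon_single {p t : ℕ} (ht : t < 2 * p + 2) (a : ℤ) :
    mon (colC p) (colX p) (Pi.single t a) (2 * p + 2) = dpow (colC p t) (colX p t) a := by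
  obtain ⟨l, hl⟩ : ∃ l, 2 * p + 2 = t + 1 + l := ⟨2 * p + 2 - (t + 1), by omega⟩
  rw [hl, mon_add, mon, mon_congr (L := t) (m := 0) (fun s hs => by simp [show s ≠ t by omega]),
    mon_zero, one_mul, mon_congr (L := l) (m := 0) (fun s hs => by
      simp [show t + 1 + s ≠ t by omega]), mon_zero, mul_one, Pi.single_eq_same]

theorem colX_eq_smul_mon {p t : ℕ} (ht : t < 2 * p + 2) : ∃ c : K, c ≠ 0 ∧
    colX p t = c • mon (colC p) (colX p) (Pi.single t 1) (2 * p + 2) := by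
  have hne : colC p t 1 ≠ 0 := ((column p).qints t).ne 1 (by omega)
  refine ⟨colC p t 1, hne, ?_⟩
  rw [mon_single ht]
  have := dpow_natCast (C := colC p t) (x := colX p t) 1
  rw [Nat.cast_one] at this
  rw [this]
  simp [smul_smul, hne]

theorem colX_smul_mon_smul {t : ℕ} (ht : t < 2 * p + 2) (n : ℕ → ℤ) : ∃ c : K, ∀ w : ThetaMod,
    colX p t • mon (colC p) (colX p) n (2 * p + 2) • w =
    c • mon (colC p) (colX p) (Pi.single t 1 + n) (2 * p + 2) • w := by
  obtain ⟨c, _, e⟩ := colX_eq_smul_mon ht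
  obtain ⟨b, hb⟩ := mon_smul_mon_smul p (Pi.single t 1) n
  exact ⟨c * b, fun w => by rw [e, smul_assoc, hb, scalar_smul_smul]⟩

theorem colX_smul_mem_of_mem {t : ℕ} (ht : t < 2 * p + 2) (hP : P (Pi.single t 1)) {w : ThetaMod}
    (hw : w ∈ pbwSpan ⊤ p) : colX p t • w ∈ expSpan p P := by
  obtain ⟨c, _, e⟩ := colX_eq_smul_mon ht
  rw [e, smul_assoc]
  exact coeff_smul_mem_expSpan _ (mem_expSpan hP hw)

theorem colX_smul_mem {t : ℕ} (ht : t < 2 * p + 2) {v : ThetaMod} (hP : ∀ n, P n → P' (Pi.single t 1 + n))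
    (hv : v ∈ expSpan p P) : colX p t • v ∈ expSpan p P' := by
  refine smul_mem_expSpan (fun n hn w hw => ?_) hv
  obtain ⟨c, hc⟩ := colX_smul_mon_smul ht n
  rw [hc]
  exact coeff_smul_mem_expSpan _ (mem_expSpan (hP n hn) hw)

theorem colF_smul_mon {t : ℕ} (ht : t < 2 * p) (n : ℕ → ℤ) {w : ThetaMod} (hw : w ∈ pbwSpan ⊤ p) :
    ∃ d : K, ∃ w' ∈ pbwSpan ⊤ p, colF p t • mon (colC p) (colX p) n (2 * p + 2) • w =
      mon (colC p) (colX p) n (2 * p + 2) • w' +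
      d • mon (colC p) (colX p) (moveIdx n t 1) (2 * p + 2) • w := by
  obtain ⟨c, d, e⟩ := (column p).mul_mon (t := t) (by omega) n
  refine ⟨d, c • colF p t • w, smul_mem_rspan (Subring.mem_top c)
    (gen_smul_mem_pbwSpan (by omega) (by omega) hw), ?_⟩
  rw [← mul_smul, e, add_smul, smul_assoc, smul_assoc, mul_smul, smul_pull]

theorem fold_smul_mem_expSpan {w : ThetaMod} (hw : w ∈ pbwSpan ⊤ p) :
    colF p (2 * p) • w ∈ expSpan p fun n => ∀ s, 2 * p < s → n s = 0 := by
  refine smul_mem_rspan_of_forall (B := U) ?_ hw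
  rintro _ ⟨m, rfl⟩
  cases p with
  | zero =>
    have e : colProd m 0 • vac = vac := one_smul _ _
    change colF 0 0 • colProd m 0 • vac ∈ _
    rw [e, foldRelZero.gφ]
    refine colX_smul_mem_of_mem (by omega) ?_ vac_mem_pbwSpan
    intro s hs
    simp [show s ≠ 0 by omega]
  | succ p =>
    change colF (p + 1) (2 * (p + 1)) • (mon _ _ (m p) _ * colProd m p) • vac ∈ _
    have hLA : colProd m p • vac ∈ pbwSpan Lring p := subset_rspan ⟨m, rfl⟩
    obtain ⟨u, hu, e⟩ := mem_divSpan.1 (pbwSpan_le_divSpan p hLA)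
    set n := m p
    set g := colF (p + 1) (2 * (p + 1)) with hg
    have hgu : Commute g u := commute_divAlg hu fun k h1 h2 => by
      rw [hg, colF]
      exact serreFamily_gen.commute_far (by push_cast; omega)
    have hgm : Commute g (mon (colC p) (colX p) n (2 * p + 1)) := by
      refine commute_mon fun s hs => ?_
      rw [hg, colF, colX]
      exact serreFamily_gen.commute_far_segOf (Or.inl (by push_cast; omega))
    have hc := (hgm.mul_right hgu).eq
    rw [mul_smul, e, ← mul_smul (mon _ _ _ _) u, mon_last_mul p n hu, ← mul_smul, ← mul_assoc, hc, mul_smul,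
      mul_smul, (foldRel p).smul_dpow nonRoot_q]
    refine divAlg_smul_mem_of_letters (N := p + 1) (fun c _ v hv => coeff_smul_mem_expSpan c hv) ?_
      (Subring.mul_mem _ (mon_mem_divAlg p n le_rfl) (divAlg_mono (Nat.le_succ p) hu)) _ ?_
    · intro k h1 h2 r v hv
      rw [dpow_natCast, smul_assoc]
      refine coeff_smul_mem_expSpan _ ?_
      induction r with
      | zero => rwa [pow_zero, one_smul]
      | succ r ih =>
        rw [pow_succ', mul_smul]
        obtain ⟨t, ht, rfl⟩ : ∃ t : ℕ, t < 2 * (p + 1) ∧ ((p + 1 : ℕ) : ℤ) - 1 - t = k :=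
          ⟨((p + 1 : ℕ) - 1 - k).toNat, by push_cast at h1; omega, by push_cast at h1 h2 ⊢; omega⟩
        refine smul_mem_expSpan (fun n' hn w hw => ?_) ih
        obtain ⟨d, w', hw', e'⟩ := colF_smul_mon ht n' hw
        change colF (p + 1) t • _ ∈ _
        rw [e']
        refine AddSubgroup.add_mem _ (mem_expSpan hn hw')
          (coeff_smul_mem_expSpan _ (mem_expSpan (fun s hs => ?_) hw))
        rw [moveIdx, if_neg (by omega), if_neg (by omega)]
        exact hn s hs
    · have hs : ∀ y : ℤ, dpow (qnumTwo q) (colX p (2 * p + 1)) y • vac ∈ pbwSpan ⊤ (p + 1) := by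
        intro y
        have := mon_smul_mem (R := ⊤) (Pi.single (2 * p + 1) y)
          (pbwSpan_mono (Nat.zero_le p) vac_mem_pbwSpan)
        rwa [mon_single (by omega), colC_last] at this
      have hs' : ∀ (t : ℕ) (y : ℤ), t < 2 * (p + 1) + 1 → colX (p + 1) t •
          dpow (qnumTwo q) (colX p (2 * p + 1)) y • vac ∈
          expSpan (p + 1) fun n => ∀ s, 2 * (p + 1) < s → n s = 0 := by
        intro t y ht
        refine colX_smul_mem_of_mem (by omega) ?_ (hs y)
        intro s hs
        simp [show s ≠ t by omega]
      exact AddSubgroup.add_mem _ (coeff_smul_mem_expSpan _ (hs' _ _ (by omega))) (hs' _ _ (by omega))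

/-- The action of the letter `colF p t` is triangular. -/
theorem colF_smul_mem {t : ℕ} (ht : t < 2 * p + 1) (n : ℕ → ℤ) {w : ThetaMod}
    (hw : w ∈ pbwSpan ⊤ p) : ∃ d : K, colF p t • mon (colC p) (colX p) n (2 * p + 2) • w -
      d • mon (colC p) (colX p) (moveIdx n t 1) (2 * p + 2) • w ∈
      expSpan p fun n' => ∀ s, t < s → n' s = n s := by
  rcases Nat.lt_or_ge t (2 * p) with h | h
  · obtain ⟨d, w', hw', e⟩ := colF_smul_mon h n hw
    refine ⟨d, ?_⟩
    rw [e, add_sub_cancel_right]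
    exact mem_expSpan (fun _ _ => rfl) hw'
  · obtain rfl : t = 2 * p := by omega
    obtain ⟨c, d, e⟩ := (column p).mul_mon (t := 2 * p) (by omega) n
    refine ⟨d, ?_⟩
    rw [← mul_smul, e, add_smul, smul_assoc, smul_assoc, mul_smul, add_sub_cancel_right]
    refine coeff_smul_mem_expSpan _ ?_
    refine smul_mem_expSpan (fun n' hn' w' hw' => ?_) (fold_smul_mem_expSpan hw)
    obtain ⟨b, hb⟩ := mon_smul_mon_smul p n n'
    rw [hb]
    refine coeff_smul_mem_expSpan _ (mem_expSpan (fun s hs => ?_) hw')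
    rw [Pi.add_apply, hn' s hs, add_zero]

theorem colF_smul_mem_of_nonpos {t : ℕ} (ht : t < 2 * p + 1) {n : ℕ → ℤ} (hn : n t ≤ 0)
    {w : ThetaMod} (hw : w ∈ pbwSpan ⊤ p) :
    colF p t • mon (colC p) (colX p) n (2 * p + 2) • w ∈
      expSpan p fun n' => ∀ s, t < s → n' s = n s := by
  obtain ⟨d, h⟩ := colF_smul_mem ht n hw
  rwa [mon_of_neg (n := moveIdx n t 1) (s := t) (by omega) (by rw [moveIdx, if_pos rfl]; omega), zero_smul, smul_zero, sub_zero] at h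

theorem colF_smul_mem' {t : ℕ} (ht : t < 2 * p + 1) (n : ℕ → ℤ) {w : ThetaMod}
    (hw : w ∈ pbwSpan ⊤ p) : colF p t • mon (colC p) (colX p) n (2 * p + 2) • w ∈
      expSpan p fun n' => n' (t + 1) ≤ n (t + 1) + 1 ∧ ∀ s, t + 1 < s → n' s = n s := by
  obtain ⟨d, h⟩ := colF_smul_mem ht n hw
  rw [← sub_add_cancel (colF p t • _) (d • mon (colC p) (colX p) (moveIdx n t 1) (2 * p + 2) • w)]
  refine AddSubgroup.add_mem _ (expSpan_mono ?_ h) (coeff_smul_mem_expSpan _ (mem_expSpan ?_ hw))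
  · intro n' hn'
    exact ⟨by rw [hn' _ (by omega)]; omega, fun s hs => hn' s (by omega)⟩
  · refine ⟨by simp [moveIdx], fun s hs => ?_⟩
    rw [moveIdx, if_neg (by omega), if_neg (by omega)]

end

theorem levalPoly_injective : Function.Injective
    (Polynomial.eval₂RingHom (algebraMap ℚ K) q⁻¹) := by
  have h1 : Transcendental ℚ q := by
    have := RatFunc.transcendental_X (K := ℚ)
    convert this
    · exact Subsingleton.elim _ _
    · rfl
  have h2 : Transcendental ℚ q⁻¹ := fun h => h1 (by simpa using h.inv)
  exact transcendental_iff_injective.1 h2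

/-- The automorphism `q ↦ q⁻¹` of `K`. -/
def sigma : K →+* K :=
  RatFunc.liftRingHom (Polynomial.eval₂RingHom (algebraMap ℚ K) q⁻¹)
    (nonZeroDivisors_le_comap_nonZeroDivisors_of_injective _ levalPoly_injective)

theorem sigma_polynomial (f : Polynomial ℚ) :
    sigma (algebraMap (Polynomial ℚ) K f) = f.eval₂ (algebraMap ℚ K) q⁻¹ := by
  rw [sigma, RatFunc.liftRingHom_apply, RatFunc.num_algebraMap, RatFunc.denom_algebraMap]
  simp

theorem sigma_q : sigma q = q⁻¹ := by
  have := sigma_polynomial Polynomial.X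
  rwa [RatFunc.algebraMap_X, Polynomial.eval₂_X] at this

theorem sigma_rat (r : ℚ) : sigma (algebraMap ℚ K r) = algebraMap ℚ K r :=
  RingHom.congr_fun (Subsingleton.elim (sigma.comp (algebraMap ℚ K)) (algebraMap ℚ K)) r

theorem sigma_qnum (n : ℤ) : sigma (qnum q n) = qnum q n := by
  simp only [qnum, map_div₀, map_sub, map_zpow₀, sigma_q, map_inv₀, inv_inv, inv_zpow', neg_neg]
  rw [← neg_sub (q ^ n), ← neg_sub q, neg_div_neg_eq]

theorem algebraMap_eq_eval₂ (f : Polynomial ℚ) :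
    algebraMap (Polynomial ℚ) K f = f.eval₂ (algebraMap ℚ K) q := by
  induction f using Polynomial.induction_on' with
  | add f g hf hg => rw [map_add, hf, hg, Polynomial.eval₂_add]
  | monomial n a =>
    rw [Polynomial.eval₂_monomial, ← Polynomial.C_mul_X_pow_eq_monomial, map_mul, map_pow,
      RatFunc.algebraMap_X, RatFunc.algebraMap_C]
    congr 1
    exact RingHom.congr_fun (Subsingleton.elim RatFunc.C (algebraMap ℚ K)) a

/-- Two ring homomorphisms out of `K` into a ring agree if they agree at `q`. -/
theorem ringHom_ext_q {B : Type*} [Ring B] {f g : K →+* B} (h : f q = g q) : f = g := by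
  have hp : ∀ p : Polynomial ℚ, f (algebraMap (Polynomial ℚ) K p) = g (algebraMap _ K p) := by
    intro p
    rw [algebraMap_eq_eval₂]
    induction p using Polynomial.induction_on' with
    | add p r hp hr => rw [Polynomial.eval₂_add, map_add, map_add, hp, hr]
    | monomial n a =>
      rw [Polynomial.eval₂_monomial, map_mul, map_mul, map_pow, map_pow, h]
      congr 1
      exact RingHom.congr_fun (Subsingleton.elim (f.comp (algebraMap ℚ K)) (g.comp _)) a
  ext x
  have hx : x * algebraMap (Polynomial ℚ) K x.denom = algebraMap _ K x.num := by
    rw [← eq_div_iff (RatFunc.algebraMap_ne_zero x.denom_ne_zero)]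
    exact (RatFunc.num_div_denom x).symm
  have hu : IsUnit (f (algebraMap (Polynomial ℚ) K x.denom)) :=
    (IsUnit.mk0 _ (RatFunc.algebraMap_ne_zero x.denom_ne_zero)).map f
  refine hu.mul_left_injective ?_
  change f x * _ = g x * _
  rw [← map_mul, hx]
  rw [hp, hp, ← map_mul, hx]

theorem sigma_sigma (x : K) : sigma (sigma x) = x := by
  have : sigma.comp sigma = RingHom.id K := ringHom_ext_q (by simp [sigma_q])
  exact RingHom.congr_fun this x

/-- `bar` and `barV` are compatible lifts of the bar involution. -/
structure IsBar (bar : U →+* U) (barV : ThetaMod →+ ThetaMod) : Prop where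
  coeff : ∀ c : K, bar (algebraMap K U c) = algebraMap K U (sigma c)
  gen : ∀ a : ℤ, bar (gen a) = gen a
  smul : ∀ (u : U) (v : ThetaMod), barV (u • v) = bar u • barV v
  vac : barV vac = vac

namespace IsBar
variable {bar : U →+* U} {barV : ThetaMod →+ ThetaMod} (H : IsBar bar barV)
include H

theorem map_smul (c : K) (u : U) : bar (c • u) = sigma c • bar u := by
  rw [Algebra.smul_def, map_mul, H.coeff, ← Algebra.smul_def]

theorem map_smul' (c : K) (v : ThetaMod) : barV (c • v) = sigma c • barV v := by
  rw [← algebraMap_smul U c v, H.smul, H.coeff, algebraMap_smul]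

end IsBar

theorem isBar_of {bar : U →+* U} {barV : Vt →+ Vt}
    (hbarq : bar (algebraMap K U q) = algebraMap K U q⁻¹)
    (hbarf : ∀ i : ℤ, Odd i → bar (fgen i) = fgen i)
    (hbarV : ∀ u : U, barV (Submodule.Quotient.mk u) = Submodule.Quotient.mk (bar u)) :
    IsBar bar barV where
  coeff c := by
    have : bar.comp (algebraMap K U) = (algebraMap K U).comp sigma :=
      ringHom_ext_q (by simpa [sigma_q] using hbarq)
    exact RingHom.congr_fun this c
  gen a := by
    rw [← fgen_odd]
    exact hbarf _ ⟨a, rfl⟩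
  smul u v := by
    obtain ⟨w, rfl⟩ : ∃ w : U, v = (Submodule.Quotient.mk w : Vt) :=
      ⟨_, (Submodule.Quotient.mk_surjective Jideal v).choose_spec.symm⟩
    have e : ∀ a b : U, a • (show ThetaMod from (Submodule.Quotient.mk b : Vt)) =
        (Submodule.Quotient.mk (a * b) : Vt) := fun _ _ => rfl
    exact (congrArg barV (e u w)).trans ((hbarV _).trans (((congrArg _ (map_mul bar u w)).trans
      (e _ _).symm).trans (congrArg (fun v : ThetaMod => bar u • v) (hbarV w).symm)))
  vac := by
    change barV (Submodule.Quotient.mk 1) = Submodule.Quotient.mk 1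
    rw [hbarV, map_one]

/-- The exponents at positions `≥ t`. -/
def suffix (n : ℕ → ℤ) (t : ℕ) : ℕ → ℤ := fun s => if s < t then 0 else n s

theorem mon_suffix {B : Type*} [Ring B] [Algebra K B] {C : ℕ → ℤ → K} {X : ℕ → B} {n : ℕ → ℤ}
    {L t : ℕ} (ht : t < L) : mon C X (suffix n t) L =
      dpow (C t) (X t) (n t) * mon C X (suffix n (t + 1)) L := by
  obtain ⟨l, rfl⟩ : ∃ l, L = t + 1 + l := ⟨L - (t + 1), by omega⟩
  rw [mon_add (n := suffix n t), mon_add (n := suffix n (t + 1)), mon, mon,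
    mon_congr (n := suffix n t) (L := t) (m := 0) (fun s hs => by simp [suffix, hs]),
    mon_congr (n := suffix n (t + 1)) (L := t) (m := 0)
      (fun s hs => by simp [suffix, show s < t + 1 by omega]), mon_zero, one_mul, one_mul]
  rw [show suffix n (t + 1) t = 0 by simp [suffix], dpow_zero, one_mul,
    show suffix n t t = n t by simp [suffix]]
  congr 1
  refine mon_congr fun s _ => ?_
  rw [suffix, suffix, if_neg (by omega), if_neg (by omega)]

theorem sigma_colC (p t : ℕ) (n : ℤ) : sigma (colC p t n) = colC p t n := by
  unfold colC
  split_ifs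
  · exact sigma_qnum _
  · exact sigma_qnum _

theorem map_dpow {bar : U →+* U} (h : ∀ (c : K) (u : U), bar (c • u) = sigma c • bar u)
    {C : ℤ → K} (hC : ∀ n, sigma (C n) = C n) (x : U) (n : ℤ) :
    bar (dpow C x n) = dpow C (bar x) n := by
  by_cases hn : n < 0
  · rw [dpow_of_neg hn, dpow_of_neg hn, map_zero]
  · lift n to ℕ using by omega
    simp only [dpow_natCast, h, map_inv₀, map_prod, hC, map_pow]

namespace IsBar
variable {bar : U →+* U} {barV : ThetaMod →+ ThetaMod} (H : IsBar bar barV) {p : ℕ}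
include H

theorem colX_zero : bar (colX p 0) = colX p 0 := by
  rw [_root_.colX_zero, H.gen]

theorem colX_succ {t : ℕ} (ht : t < 2 * p + 1) : bar (colX p (t + 1)) =
    colF p t * bar (colX p t) - q⁻¹ • (bar (colX p t) * colF p t) := by
  have e : colX p (t + 1) = colF p t * colX p t - q • (colX p t * colF p t) := by
    rw [(column p).skew t ht, add_sub_cancel_left]
  rw [e, map_sub, H.map_smul, map_mul, map_mul, sigma_q, colF, H.gen]

theorem colX_smul_mon {t : ℕ} (ht : t < 2 * p + 2) (n : ℕ → ℤ) {w : ThetaMod}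
    (hw : w ∈ pbwSpan ⊤ p) : bar (colX p t) • mon (colC p) (colX p) n (2 * p + 2) • w ∈
      expSpan p fun n' => n' t ≤ n t + 1 ∧ ∀ s, t < s → n' s = n s := by
  induction t generalizing n w with
  | zero =>
    rw [H.colX_zero]
    refine colX_smul_mem (P := fun n' => n' = n) ht ?_
      (mem_expSpan (P := fun n' => n' = n) rfl hw)
    rintro _ rfl
    exact ⟨by simp [add_comm], fun s hs => by simp [show s ≠ 0 by omega]⟩
  | succ t ih =>
    rw [H.colX_succ (by omega), sub_smul, smul_assoc, mul_smul, mul_smul]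
    refine AddSubgroup.sub_mem _ ?_ (coeff_smul_mem_expSpan _ ?_)
    · refine smul_mem_expSpan (fun n' hn' w' hw' => ?_) (ih (by omega) n hw)
      refine expSpan_mono ?_ (colF_smul_mem' (by omega) n' hw')
      rintro n'' ⟨h1, h2⟩
      rw [hn'.2 _ (by omega)] at h1
      exact ⟨h1, fun s hs => by rw [h2 s hs, hn'.2 s (by omega)]⟩
    · refine smul_mem_expSpan (fun n' hn' w' hw' => ?_) (colF_smul_mem' (by omega) n hw)
      refine expSpan_mono ?_ (ih (by omega) n' hw')
      rintro n'' ⟨h1, h2⟩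
      exact ⟨by rw [h2 _ (by omega)]; exact hn'.1, fun s hs => by rw [h2 s (by omega), hn'.2 s hs]⟩

theorem colX_smul_mem {P P' : (ℕ → ℤ) → Prop} {t : ℕ} (ht : t < 2 * p + 2)
    (h : ∀ n n', P n → n' t ≤ n t + 1 → (∀ s, t < s → n' s = n s) → P' n') {v : ThetaMod}
    (hv : v ∈ expSpan p P) : bar (colX p t) • v ∈ expSpan p P' :=
  smul_mem_expSpan (fun n hn _ hw => expSpan_mono (fun n' hn' => h n n' hn hn'.1 hn'.2)
    (H.colX_smul_mon ht n hw)) hv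

theorem sub_colX_smul_mon {t : ℕ} (ht : t < 2 * p + 2) (n : ℕ → ℤ) (hn : ∀ s < t, n s = 0)
    {w : ThetaMod} (hw : w ∈ pbwSpan ⊤ p) :
    (bar (colX p t) - colX p t) • mon (colC p) (colX p) n (2 * p + 2) • w ∈
      expSpan p fun n' => ∀ s, t ≤ s → n' s = n s := by
  induction t generalizing n w with
  | zero =>
    rw [H.colX_zero, sub_self, zero_smul]
    exact AddSubgroup.zero_mem _
  | succ t ih =>
    set v := mon (colC p) (colX p) n (2 * p + 2) • w
    have e : (bar (colX p (t + 1)) - colX p (t + 1)) • v =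
        colF p t • (bar (colX p t) - colX p t) • v + q • colX p t • colF p t • v -
          q⁻¹ • bar (colX p t) • colF p t • v := by
      have e1 : colX p (t + 1) = colF p t * colX p t - q • (colX p t * colF p t) := by
        rw [(column p).skew t (by omega), add_sub_cancel_left]
      rw [H.colX_succ (by omega), e1]
      simp only [sub_smul, smul_assoc, mul_smul, smul_sub]
      abel
    have hF : colF p t • v ∈ expSpan p fun n' => ∀ s, t < s → n' s = n s :=
      colF_smul_mem_of_nonpos (by omega) (hn t (by omega)).le hw
    rw [e]
    refine AddSubgroup.sub_mem _ (AddSubgroup.add_mem _ ?_ (coeff_smul_mem_expSpan _ ?_))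
      (coeff_smul_mem_expSpan _ ?_)
    · refine smul_mem_expSpan (fun n' hn' w' hw' => ?_)
        (ih (by omega) n (fun s hs => hn s (by omega)) hw)
      refine expSpan_mono ?_ (colF_smul_mem_of_nonpos (by omega)
        (by rw [hn' t le_rfl, hn t (by omega)]) hw')
      intro n'' h s hs
      rw [h s (by omega), hn' s (by omega)]
    · refine _root_.colX_smul_mem (by omega) ?_ hF
      intro n' h s hs
      rw [Pi.add_apply, h s (by omega), Pi.single_eq_of_ne (by omega), zero_add]
    · refine H.colX_smul_mem (by omega) ?_ hF
      intro n' n'' h _ h' s hs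
      rw [h' s (by omega), h s (by omega)]

theorem sub_pow_colX_smul_mon {t : ℕ} (ht : t < 2 * p + 2) (n : ℕ → ℤ) (hn : ∀ s ≤ t, n s = 0)
    {w : ThetaMod} (hw : w ∈ pbwSpan ⊤ p) (a : ℕ) :
    (bar (colX p t) ^ a - colX p t ^ a) • mon (colC p) (colX p) n (2 * p + 2) • w ∈
      expSpan p fun n' => n' t < a ∧ ∀ s, t < s → n' s = n s := by
  have hpow : ∀ a : ℕ, colX p t ^ a • mon (colC p) (colX p) n (2 * p + 2) • w ∈
      expSpan p fun n' => n' t = a ∧ (∀ s < t, n' s = 0) ∧ ∀ s, t < s → n' s = n s := by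
    intro a
    induction a with
    | zero =>
      rw [pow_zero, one_smul]
      exact mem_expSpan ⟨by simp [hn], fun s hs => hn s hs.le, fun _ _ => rfl⟩ hw
    | succ a ih =>
      rw [pow_succ', mul_smul]
      refine _root_.colX_smul_mem ht ?_ ih
      rintro n' ⟨h1, h2, h3⟩
      refine ⟨by simp [h1, add_comm], fun s hs => ?_, fun s hs => ?_⟩
      · rw [Pi.add_apply, h2 s hs, Pi.single_eq_of_ne (by omega), zero_add]
      · rw [Pi.add_apply, h3 s hs, Pi.single_eq_of_ne (by omega), zero_add]
  induction a with
  | zero =>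
    rw [pow_zero, pow_zero, sub_self, zero_smul]
    exact AddSubgroup.zero_mem _
  | succ a ih =>
    set v := mon (colC p) (colX p) n (2 * p + 2) • w
    have e : (bar (colX p t) ^ (a + 1) - colX p t ^ (a + 1)) • v =
        bar (colX p t) • (bar (colX p t) ^ a - colX p t ^ a) • v +
          (bar (colX p t) - colX p t) • colX p t ^ a • v := by
      rw [pow_succ', pow_succ']
      simp only [sub_smul, mul_smul, smul_sub]
      abel
    rw [e]
    refine AddSubgroup.add_mem _ ?_ ?_
    · refine H.colX_smul_mem ht ?_ ih
      intro n' n'' h h1 h2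
      exact ⟨by push_cast; linarith [h.1], fun s hs => by rw [h2 s hs, h.2 s hs]⟩
    · refine smul_mem_expSpan (fun n' hn' w' hw' => ?_) (hpow a)
      refine expSpan_mono ?_ (H.sub_colX_smul_mon ht n' hn'.2.1 hw')
      intro n'' h
      refine ⟨by rw [h t le_rfl, hn'.1]; push_cast; omega, fun s hs => ?_⟩
      rw [h s hs.le, hn'.2.2 s hs]

theorem sub_dpow_colX_smul_mon {t : ℕ} (ht : t < 2 * p + 2) (n : ℕ → ℤ) (hn : ∀ s ≤ t, n s = 0)
    {w : ThetaMod} (hw : w ∈ pbwSpan ⊤ p) (a : ℤ) :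
    (dpow (colC p t) (bar (colX p t)) a - dpow (colC p t) (colX p t) a) •
      mon (colC p) (colX p) n (2 * p + 2) • w ∈
      expSpan p fun n' => n' t < a ∧ ∀ s, t < s → n' s = n s := by
  by_cases ha : a < 0
  · rw [dpow_of_neg ha, dpow_of_neg ha, sub_self, zero_smul]
    exact AddSubgroup.zero_mem _
  · lift a to ℕ using by omega
    rw [dpow_natCast, dpow_natCast, sub_smul, smul_assoc, smul_assoc, ← smul_sub, ← sub_smul]
    exact coeff_smul_mem_expSpan _ (H.sub_pow_colX_smul_mon ht n hn hw a)

theorem sub_mon_suffix_smul (n : ℕ → ℤ) {w : ThetaMod} (hw : w ∈ pbwSpan ⊤ p) {t l : ℕ}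
    (ht : t + l = 2 * p + 2) :
    (bar (mon (colC p) (colX p) (suffix n t) (2 * p + 2)) -
      mon (colC p) (colX p) (suffix n t) (2 * p + 2)) • w ∈
      expSpan p fun n' => ∃ t0, t ≤ t0 ∧ t0 < 2 * p + 2 ∧ n' t0 < n t0 ∧
        ∀ s, t0 < s → n' s = n s := by
  induction l generalizing t with
  | zero =>
    rw [mon_congr (m := 0) (fun s hs => by simp [suffix, show s < t by omega]), mon_zero, map_one,
      sub_self, zero_smul]
    exact AddSubgroup.zero_mem _
  | succ l ih =>
    have ih := ih (t := t + 1) (by omega)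
    rw [mon_suffix (by omega)]
    rw [map_mul, map_dpow H.map_smul (sigma_colC p t)]
    set v := mon (colC p) (colX p) (suffix n (t + 1)) (2 * p + 2) with hv
    set D := dpow (colC p t) (colX p t) (n t)
    set D' := dpow (colC p t) (bar (colX p t)) (n t) with hD'
    have e : (D' * bar v - D * v) • w = D' • (bar v - v) • w + (D' - D) • v • w := by
      simp only [sub_smul, mul_smul, smul_sub]
      abel
    rw [e]
    refine AddSubgroup.add_mem _ ?_ ?_
    · rw [hD']
      by_cases ha : n t < 0
      · rw [dpow_of_neg ha, zero_smul]
        exact AddSubgroup.zero_mem _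
      · generalize n t = a at ha
        lift a to ℕ using by omega
        rw [dpow_natCast, smul_assoc]
        refine coeff_smul_mem_expSpan _ ?_
        have : bar (colX p t) ^ a • (bar v - v) • w ∈ expSpan p fun n' => ∃ t0, t + 1 ≤ t0 ∧
            t0 < 2 * p + 2 ∧ n' t0 < n t0 ∧ ∀ s, t0 < s → n' s = n s := by
          clear ha
          induction a with
          | zero => rwa [pow_zero, one_smul]
          | succ a ih' =>
            rw [pow_succ', mul_smul]
            refine H.colX_smul_mem (by omega) ?_ ih'
            rintro n' n'' ⟨t0, h1, h2, h3, h4⟩ _ h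
            exact ⟨t0, h1, h2, by rwa [h t0 (by omega)], fun s hs => by
              rw [h s (by omega), h4 s hs]⟩
        refine expSpan_mono ?_ this
        rintro n' ⟨t0, h1, h⟩
        exact ⟨t0, by omega, h⟩
    · refine expSpan_mono ?_ (H.sub_dpow_colX_smul_mon (t := t) (by omega) (suffix n (t + 1))
        (fun s hs => by simp [suffix, show s < t + 1 by omega]) hw (n t))
      rintro n' ⟨h1, h2⟩
      exact ⟨t, le_rfl, by omega, h1, fun s hs => by
        rw [h2 s hs]; simp [suffix, show ¬ s < t + 1 by omega]⟩

theorem sub_mon_smul (n : ℕ → ℤ) {w : ThetaMod} (hw : w ∈ pbwSpan ⊤ p) :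
    (bar (mon (colC p) (colX p) n (2 * p + 2)) - mon (colC p) (colX p) n (2 * p + 2)) • w ∈
      expSpan p fun n' => ∃ t0, t0 < 2 * p + 2 ∧ n' t0 < n t0 ∧ ∀ s, t0 < s → n' s = n s := by
  have := H.sub_mon_suffix_smul n hw (t := 0) (l := 2 * p + 2) (by omega)
  rw [show suffix n 0 = n from funext fun s => by simp [suffix]] at this
  refine expSpan_mono ?_ this
  rintro n' ⟨t0, _, h⟩
  exact ⟨t0, h⟩

end IsBar

/-- The span of the PBW vectors with exponents below `n` in the crystal order. -/
def lowSpan (n : ℕ → ℕ → ℤ) (N : ℕ) : AddSubgroup ThetaMod :=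
  rspan ⊤ {v | ∃ n' : ℕ → ℕ → ℤ, v = colProd n' N • vac ∧ ∃ p < N, ∃ t0, t0 < 2 * p + 2 ∧
    n' p t0 < n p t0 ∧ (∀ s, t0 < s → n' p s = n p s) ∧ ∀ p', p < p' → p' < N → n' p' = n p'}

theorem coeff_smul_mem_pbwSpan (c : K) {N : ℕ} {v : ThetaMod} (hv : v ∈ pbwSpan ⊤ N) :
    c • v ∈ pbwSpan ⊤ N := smul_mem_rspan (Subring.mem_top c) hv

theorem lowSpan_le (n : ℕ → ℕ → ℤ) (N : ℕ) : lowSpan n N ≤ pbwSpan ⊤ N := by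
  refine rspan_le_rspan le_rfl ?_
  rintro _ ⟨n', rfl, _⟩
  exact subset_rspan ⟨n', rfl⟩

theorem colProd_mem_pbwSpan (n : ℕ → ℕ → ℤ) (N : ℕ) : colProd n N • vac ∈ pbwSpan ⊤ N :=
  subset_rspan ⟨n, rfl⟩

/-- The bar involution is unitriangular on PBW vectors. -/
theorem IsBar.sub_colProd_mem {bar : U →+* U} {barV : ThetaMod →+ ThetaMod} (H : IsBar bar barV)
    (n : ℕ → ℕ → ℤ) (N : ℕ) :
    (bar (colProd n N) - colProd n N) • _root_.vac ∈ lowSpan n N := by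
  induction N with
  | zero =>
    rw [colProd, map_one, sub_self, zero_smul]
    exact AddSubgroup.zero_mem _
  | succ N ih =>
    rw [colProd, map_mul]
    set M := mon (colC N) (colX N) (n N) (2 * N + 2) with hM
    have hupd : ∀ (n' : ℕ → ℕ → ℤ) (a : ℕ → ℤ), colProd (Function.update n' N a) (N + 1) • _root_.vac =
        mon (colC N) (colX N) a (2 * N + 2) • colProd n' N • _root_.vac := by
      intro n' a
      rw [colProd, Function.update_self, mul_smul, colProd_congr (n := n')]
      intro p hp t _
      rw [Function.update_of_ne (by omega)]
    have hexp : ∀ w ∈ pbwSpan ⊤ N, (bar M - M) • w ∈ lowSpan n (N + 1) := by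
      intro w hw
      refine rspan_induction ?_ (AddSubgroup.zero_mem _) (fun _ _ => AddSubgroup.add_mem _)
        (fun c _ _ hv => smul_mem_rspan (Subring.mem_top c) hv) (H.sub_mon_smul (n N) hw)
      rintro _ ⟨a, ⟨t0, h1, h2, h3⟩, w', hw', rfl⟩
      refine smul_mem_rspan_of_forall (B := U) ?_ hw'
      rintro _ ⟨n', rfl⟩
      change mon (colC N) (colX N) a (2 * N + 2) • colProd n' N • _root_.vac ∈ _
      rw [← hupd]
      refine subset_rspan ⟨_, rfl, N, by omega, t0, h1, ?_, ?_, ?_⟩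
      · rwa [Function.update_self]
      · rwa [Function.update_self]
      · intro p' h h'
        omega
    have hlow : ∀ v ∈ lowSpan n N, M • v ∈ lowSpan n (N + 1) := by
      intro v hv
      refine smul_mem_rspan_of_forall (B := U) ?_ hv
      rintro _ ⟨n', rfl, p, hp, t0, h1, h2, h3, h4⟩
      rw [hM, ← hupd]
      refine subset_rspan ⟨_, rfl, p, by omega, t0, h1, ?_, ?_, ?_⟩
      · rwa [Function.update_of_ne (by omega)]
      · rwa [Function.update_of_ne (by omega)]
      · intro p' h h'
        rcases eq_or_ne p' N with rfl | h''
        · rw [Function.update_self]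
        · rw [Function.update_of_ne h'', h4 p' h (by omega)]
    have hb : bar (colProd n N) • _root_.vac ∈ pbwSpan ⊤ N := by
      have := AddSubgroup.add_mem _ (lowSpan_le _ _ ih) (colProd_mem_pbwSpan n N)
      rwa [sub_smul, sub_add_cancel] at this
    have e : (bar M * bar (colProd n N) - M * colProd n N) • _root_.vac =
        (bar M - M) • bar (colProd n N) • _root_.vac + M • (bar (colProd n N) - colProd n N) • _root_.vac := by
      simp only [sub_smul, mul_smul, smul_sub]
      abel
    rw [e]
    exact AddSubgroup.add_mem _ (hexp _ hb) (hlow _ ih)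

/-- The Cartan matrix of type `A_∞`. -/
def cartan (i j : ℤ) : ℤ := if i = j then 2 else if i = j + 1 ∨ j = i + 1 then -1 else 0

theorem cartan_theta (i j : ℤ) : cartan (-1 - i) (-1 - j) = cartan i j := by
  unfold cartan; split_ifs <;> first | rfl | omega

/-- The pairing of the letter `i` with the letters `a, …, a + n - 1`. -/
def wt (i a : ℤ) (n : ℕ) : ℤ := ∑ s ∈ Finset.range n, cartan i (a + s)

theorem wt_succ (i a : ℤ) (n : ℕ) : wt i a (n + 1) = wt i a n + cartan i (a + n) :=
  Finset.sum_range_succ _ _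

theorem wt_end (a : ℤ) (n : ℕ) : wt (a + n + 1) a (n + 1) = -1 := by
  rw [wt, Finset.sum_eq_single n]
  · simp [cartan]
  · intro s hs hn
    have := Finset.mem_range.1 hs
    unfold cartan
    rw [if_neg (by omega), if_neg (by omega)]
  · simp

section Generic

variable {k B M : Type*} [Field k] [Ring B] [Algebra k B] [AddCommGroup M] [Module k M]
  [Module B M] [IsScalarTower k B M] {q : k} {g : ℤ → B} {E T : ℤ → M →ₗ[k] M}

/-- Operators `E_i`, `T_i` satisfying the boson relations. -/
structure ThetaOps (q : k) (g : ℤ → B) (E T : ℤ → M →ₗ[k] M) : Prop where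
  E_gen : ∀ i j v, E i (g j • v) = q ^ (-cartan i j) • g j • E i v +
    ((if i = j then 1 else 0 : k) • v + (if -1 - i = j then 1 else 0 : k) • T i v)
  T_gen : ∀ i j v, T i (g j • v) = q ^ (-(cartan i j + cartan (-1 - i) j)) • g j • T i v

/-- The segments, indexed by their number of letters. -/
def zeg (q : k) (g : ℤ → B) (a : ℤ) : ℕ → B
  | 0 => (1 - q ^ 2)⁻¹ • 1
  | n + 1 => segOf q g a n

theorem smul_comm_field (b : B) (c : k) (v : M) : b • c • v = c • b • v := by
  rw [← algebraMap_smul B c v, ← algebraMap_smul B c (b • v), ← mul_smul, ← mul_smul,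
    Algebra.commutes]

namespace ThetaOps

variable (H : ThetaOps q g E T) (hq : q ≠ 0)
include H hq

theorem T_segOf (i a : ℤ) (n : ℕ) (v : M) : T i (segOf q g a n • v) =
    q ^ (-(wt i a (n + 1) + wt (-1 - i) a (n + 1))) • segOf q g a n • T i v := by
  have pull : ∀ (b : B) (c : k) (v : M), b • c • v = c • b • v := smul_comm_field
  induction n generalizing v with
  | zero => simpa [wt, segOf] using H.T_gen i a v
  | succ n ih =>
    rw [segOf_succ, sub_smul, sub_smul, smul_assoc, smul_assoc, mul_smul, mul_smul, mul_smul,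
      mul_smul, map_sub (T i), (T i).map_smul q, ih, H.T_gen, H.T_gen, ih,
      wt_succ i a (n + 1), wt_succ (-1 - i) a (n + 1),
      show (a + n + 1 : ℤ) = a + (n + 1 : ℕ) by push_cast; ring]
    rw [show ∀ x y z w : ℤ, -(x + y + (z + w)) = -(y + w) + -(x + z) by intros; ring,
      zpow_add₀ hq]
    simp only [pull]
    generalize segOf q g a n • g (a + (n + 1 : ℕ)) • T i v = x
    generalize g (a + (n + 1 : ℕ)) • segOf q g a n • T i v = y
    module

theorem E_segOf (S : SerreFamily q g) (hq1 : 1 - q ^ 2 ≠ 0) (i a : ℤ)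
    (n : ℕ) (v : M) : E i (segOf q g a n • v) =
      q ^ (-wt i a (n + 1)) • segOf q g a n • E i v +
      ((if i = a then 1 - q ^ 2 else 0 : k) • zeg q g (a + 1) n • v +
        (if -1 - i = a + n then (1 - q ^ 2) * q ^ (-wt i a n) else 0 : k) •
          zeg q g a n • T i v) := by
  have pull : ∀ (b : B) (c : k) (v : M), b • c • v = c • b • v := smul_comm_field
  induction n generalizing v with
  | zero =>
    have := H.E_gen i a v
    rw [segOf, this]
    simp [wt, zeg, ite_smul, smul_smul, hq1]
  | succ n ih =>
    set α : k := if i = a then 1 - q ^ 2 else 0 with hα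
    set β : k := if -1 - i = a + n then (1 - q ^ 2) * q ^ (-wt i a n) else 0 with hβ
    set b : ℤ := a + n + 1 with hb
    have hb' : a + (n + 1 : ℕ) = b := by rw [hb]; push_cast; ring
    set γ : k := if i = b then 1 else 0 with hγ
    set δ : k := if -1 - i = b then 1 else 0 with hδ
    rw [hb', wt_succ i a (n + 1), hb', segOf_succ]
    set Z := segOf q g a n
    have e1 : E i (Z • g b • v) = q ^ (-wt i a (n + 1)) •
        (q ^ (-cartan i b) • Z • g b • E i v + (γ • Z • v + δ • Z • T i v)) +
        (α • zeg q g (a + 1) n • g b • v + β •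
          q ^ (-(cartan i b + cartan (-1 - i) b)) • zeg q g a n • g b • T i v) := by
      rw [ih, H.E_gen, H.T_gen]
      simp only [smul_add, pull]
      rfl
    have e2 : E i (g b • Z • v) = q ^ (-cartan i b) • (q ^ (-wt i a (n + 1)) • g b • Z • E i v +
        (α • g b • zeg q g (a + 1) n • v + β • g b • zeg q g a n • T i v)) +
        (γ • Z • v + δ • q ^ (-(wt i a (n + 1) + wt (-1 - i) a (n + 1))) • Z • T i v) := by
      rw [H.E_gen, ih, H.T_segOf hq]
      simp only [smul_add, pull]
      rfl
    have fα : α • zeg q g (a + 1) n • g b • v - (q * q ^ (-cartan i b)) • α • g b • zeg q g (a + 1) n • v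
        = α • zeg q g (a + 1) (n + 1) • v := by
      by_cases h : i = a
      · cases n with
        | zero =>
          have hc : cartan i b = -1 := by
            unfold cartan; rw [if_neg (by omega), if_pos (by omega)]
          have hb0 : b = a + 1 := by rw [hb]; simp
          rw [hc, hα, if_pos h, zeg, zeg, segOf, smul_assoc, smul_assoc, one_smul, one_smul,
            hb0, pull]
          simp only [smul_smul, ← sub_smul]
          congr 1
          rw [neg_neg, zpow_one]
          field_simp
        | succ n =>
          have hc : cartan i b = 0 := by
            unfold cartan; rw [if_neg (by omega), if_neg (by push_cast at hb; omega)]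
          rw [hc, neg_zero, zpow_zero, mul_one, zeg, zeg, segOf_succ,
            show a + 1 + (n : ℤ) + 1 = b by rw [hb]; push_cast; ring, sub_smul, smul_assoc,
            mul_smul, mul_smul, smul_sub, smul_comm q]
      · rw [hα, if_neg h]; simp
    have fβ : β • q ^ (-(cartan i b + cartan (-1 - i) b)) • zeg q g a n • g b • T i v -
        (q * q ^ (-cartan i b)) • β • g b • zeg q g a n • T i v = 0 := by
      by_cases h : -1 - i = a + n
      · have hc : cartan (-1 - i) b = -1 := by
          unfold cartan; rw [if_neg (by omega), if_pos (by omega)]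
        have hcomm : zeg q g a n • g b • T i v = g b • zeg q g a n • T i v := by
          cases n with
          | zero => rw [zeg, smul_assoc, smul_assoc, one_smul, one_smul, smul_comm_field]
          | succ n =>
            rw [zeg, ← mul_smul, ← mul_smul,
              (S.commute_far_segOf (Or.inr (by push_cast at hb; omega))).eq]
        rw [hcomm, hc]
        simp only [smul_smul, ← sub_smul]
        rw [show -(cartan i b + -1) = 1 + -cartan i b by ring, zpow_add₀ hq, zpow_one]
        rw [show β * (q * q ^ (-cartan i b)) - q * q ^ (-cartan i b) * β = 0 by ring, zero_smul]
      · rw [hβ, if_neg h]; simp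
    have fγ : γ * (q ^ (-wt i a (n + 1)) - q) = 0 := by
      by_cases h : i = b
      · rw [h, hb, wt_end]; simp
      · rw [hγ, if_neg h, zero_mul]
    have fδ : δ * (q ^ (-wt i a (n + 1)) - q * q ^ (-(wt i a (n + 1) + wt (-1 - i) a (n + 1)))) =
        if -1 - i = b then (1 - q ^ 2) * q ^ (-wt i a (n + 1)) else 0 := by
      by_cases h : -1 - i = b
      · rw [hδ, if_pos h, if_pos h, h, hb, wt_end, neg_add, neg_neg, zpow_add₀ hq, zpow_one]
        ring
      · rw [hδ, if_neg h, if_neg h, zero_mul]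
    have fe : q ^ (-(wt i a (n + 1) + cartan i b)) =
        q ^ (-wt i a (n + 1)) * q ^ (-cartan i b) := by rw [neg_add, zpow_add₀ hq]
    rw [fe, ← fδ, ← fα, sub_smul, sub_smul, smul_assoc, smul_assoc, mul_smul, mul_smul,
      map_sub (E i), (E i).map_smul q, e1, e2]
    rw [← hb, show (Z * g b) • E i v = Z • g b • E i v from mul_smul _ _ _,
      show (g b * Z) • E i v = g b • Z • E i v from mul_smul _ _ _]
    change _ = _ + (_ + _ • Z • T i v)
    generalize zeg q g (a + 1) n • g b • v = x1 at *
    generalize g b • zeg q g (a + 1) n • v = x2 at *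
    generalize zeg q g a n • g b • T i v = x3 at *
    generalize g b • zeg q g a n • T i v = x4 at *
    generalize Z • g b • E i v = x5
    generalize g b • Z • E i v = x6
    generalize Z • v = x7
    generalize Z • T i v = x8
    linear_combination (norm := module) fβ + congrArg (· • x7) fγ

end ThetaOps

end Generic

section Generic

set_option linter.unusedSectionVars false

variable {k B M : Type*} [Field k] [Ring B] [Algebra k B] [AddCommGroup M] [Module k M]
  [Module B M] [IsScalarTower k B M] {q : k} {g : ℤ → B} {E T : ℤ → M →ₗ[k] M}

/-- Left multiplication by `x` commutes with `D` up to a power of `q`. -/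
def Neutral (q : k) (D : M →ₗ[k] M) (x : B) : Prop :=
  ∃ c : ℤ, ∀ v, D (x • v) = q ^ c • x • D v

namespace Neutral

variable {D : M →ₗ[k] M} {x y : B}

theorem one : Neutral q D (1 : B) := ⟨0, fun v => by simp⟩

theorem mul (hq : q ≠ 0) (hx : Neutral q D x) (hy : Neutral q D y) : Neutral q D (x * y) := by
  obtain ⟨c, hc⟩ := hx
  obtain ⟨d, hd⟩ := hy
  refine ⟨c + d, fun v => ?_⟩
  rw [mul_smul, hc, hd, smul_comm_field, mul_smul, zpow_add₀ hq, scalar_smul_smul]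

theorem smul (a : k) (hx : Neutral q D x) : Neutral q D (a • x) := by
  obtain ⟨c, hc⟩ := hx
  refine ⟨c, fun v => ?_⟩
  rw [smul_assoc, D.map_smul a, hc, smul_assoc, smul_comm]

theorem pow (hq : q ≠ 0) (hx : Neutral q D x) (n : ℕ) : Neutral q D (x ^ n) := by
  induction n with
  | zero => rw [pow_zero]; exact one
  | succ n ih => rw [pow_succ]; exact ih.mul hq hx

theorem dpow (hq : q ≠ 0) (hx : Neutral q D x) (C : ℤ → k) (n : ℤ) : Neutral q D (dpow C x n) := by
  unfold _root_.dpow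
  split_ifs
  · exact ⟨0, fun v => by simp⟩
  · exact (hx.pow hq _).smul _

theorem comp (hq : q ≠ 0) {D' : M →ₗ[k] M} (hx : Neutral q D x) (hx' : Neutral q D' x) :
    Neutral q (D ∘ₗ D') x := by
  obtain ⟨c, hc⟩ := hx
  obtain ⟨d, hd⟩ := hx'
  refine ⟨c + d, fun v => ?_⟩
  rw [LinearMap.comp_apply, hd, D.map_smul (q ^ d), hc, LinearMap.comp_apply, scalar_smul_smul,
    add_comm c, zpow_add₀ hq]

end Neutral

/-- The composition `D_p ∘ D_{p-1} ∘ ⋯ ∘ D_{p-s}`. -/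
def strip (D : ℤ → M →ₗ[k] M) (p : ℕ) : ℕ → M →ₗ[k] M
  | 0 => D p
  | s + 1 => strip D p s ∘ₗ D (p - (s + 1 : ℕ))

theorem Neutral.strip (hq : q ≠ 0) {D : ℤ → M →ₗ[k] M} {p s : ℕ} {x : B}
    (hx : ∀ r ≤ s, Neutral q (D (p - r)) x) : Neutral q (strip D p s) x := by
  induction s with
  | zero => simpa [_root_.strip] using hx 0 le_rfl
  | succ s ih => exact (ih fun r hr => hx r (by omega)).comp hq (hx (s + 1) le_rfl)

/-- A subspace on which the operators for the letters `p` and `-1-p` vanish. -/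
structure Vacua (E T : ℤ → M →ₗ[k] M) (p : ℕ) (W : Submodule k M) : Prop where
  E_mem : ∀ i, ∀ w ∈ W, E i w ∈ W
  T_mem : ∀ i, ∀ w ∈ W, T i w ∈ W
  E_top : ∀ w ∈ W, E p w = 0
  E_bot : ∀ w ∈ W, E (-1 - p) w = 0

theorem strip_smul_eq_zero {p : ℕ} {W : Submodule k M} (hW : Vacua E T p W) {s : ℕ} {x : B}
    (hx : ∀ r ≤ s, Neutral q (E (p - r)) x) {w : M} (hw : w ∈ W) : strip E p s (x • w) = 0 := by
  induction s generalizing w with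
  | zero =>
    obtain ⟨c, hc⟩ := hx 0 le_rfl
    have := hc w
    rw [Nat.cast_zero, sub_zero] at this
    rw [strip, this, hW.E_top w hw, smul_zero, smul_zero]
  | succ s ih =>
    obtain ⟨c, hc⟩ := hx (s + 1) le_rfl
    rw [strip, LinearMap.comp_apply, hc, map_smul, ih (fun r hr => hx r (by omega))
      (hW.E_mem _ _ hw), smul_zero]

namespace ThetaOps

variable (H : ThetaOps q g E T) (hq : q ≠ 0)
include H hq

variable (S : SerreFamily q g) (hq1 : 1 - q ^ 2 ≠ 0)
include S hq1

theorem neutral_segOf {i a : ℤ} {n : ℕ} (h1 : i ≠ a) (h2 : -1 - i ≠ a + n) :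
    Neutral q (E i) (segOf q g a n) :=
  ⟨_, fun v => by rw [H.E_segOf hq S hq1, if_neg h1, if_neg h2, zero_smul, zero_smul, add_zero,
    add_zero]⟩

variable {p : ℕ} {W : Submodule k M} (hW : Vacua E T p W)

theorem neutral_column {r t : ℕ} (h : r < t) (ht : t ≤ 2 * p + 1) :
    Neutral q (E (p - r)) (segOf q g ((p : ℤ) - t) t) :=
  H.neutral_segOf hq S hq1 (by omega) (by omega)

include hW in
theorem strip_segOf {s : ℕ} (hs : s ≤ 2 * p) {x : B} (hx : ∀ r ≤ s, Neutral q (E (p - r)) x)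
    {w : M} (hw : w ∈ W) :
    strip E p s (segOf q g ((p : ℤ) - s) s • x • w) = (1 - q ^ 2) ^ s • x • w := by
  induction s generalizing w with
  | zero =>
    rw [strip, H.E_segOf hq S hq1, if_pos (by simp), if_neg (by push_cast; omega), zeg, smul_assoc,
      one_smul, zero_smul, add_zero, scalar_smul_smul, mul_inv_cancel₀ hq1, one_smul, pow_zero,
      one_smul]
    have := strip_smul_eq_zero hW (s := 0) hx hw
    rw [strip] at this
    rw [this, smul_zero, smul_zero, zero_add]
  | succ s ih =>
    obtain ⟨c, hc⟩ := hx (s + 1) le_rfl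
    have h0 : strip E p s (segOf q g ((p : ℤ) - (s + 1 : ℕ)) (s + 1) • x •
        E (p - (s + 1 : ℕ)) w) = 0 := by
      rw [← mul_smul]
      exact strip_smul_eq_zero hW (fun r hr => (H.neutral_column hq S hq1 (by omega)
        (by omega)).mul hq (hx r (by omega))) (hW.E_mem _ _ hw)
    rw [strip, LinearMap.comp_apply, H.E_segOf hq S hq1, if_pos rfl, if_neg (by push_cast; omega),
      zeg, show (p : ℤ) - (s + 1 : ℕ) + 1 = p - s by push_cast; ring, zero_smul, add_zero, map_add,
      map_smul, hc, smul_comm_field, map_smul, h0, smul_zero, smul_zero, zero_add, map_smul,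
      ih (by omega) (fun r hr => hx r (by omega)) hw, scalar_smul_smul, ← pow_succ' (1 - q ^ 2)]

include hW in
theorem strip_segOf_bot {s : ℕ} (hs : s ≤ 2 * p) : ∃ c : ℤ, ∀ w ∈ W,
    strip E p s (segOf q g (-1 - p : ℤ) s • w) = ((1 - q ^ 2) ^ s * q ^ c) • strip T p s w := by
  induction s with
  | zero =>
    refine ⟨-wt p (-1 - p) 0, fun w hw => ?_⟩
    rw [strip, H.E_segOf hq S hq1, if_neg (by omega), if_pos (by simp), hW.E_top w hw, zero_smul k,
      zero_add, smul_zero, smul_zero, zero_add, zeg, smul_assoc, one_smul, scalar_smul_smul,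
      pow_zero, one_mul, strip, zero_add]
    congr 1
    field_simp
  | succ s ih =>
    obtain ⟨c, hc⟩ := ih (by omega)
    refine ⟨-wt (p - (s + 1 : ℕ)) (-1 - p) (s + 1) + c, fun w hw => ?_⟩
    have h0 : strip E p s (segOf q g (-1 - p : ℤ) (s + 1) • E (p - (s + 1 : ℕ)) w) = 0 :=
      strip_smul_eq_zero hW (fun r hr => H.neutral_segOf hq S hq1 (by omega)
        (by push_cast; omega)) (hW.E_mem _ _ hw)
    rw [strip, LinearMap.comp_apply, H.E_segOf hq S hq1, if_neg (by push_cast; omega),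
      if_pos (by push_cast; ring), zero_smul, zero_add, map_add, map_smul, h0, smul_zero, zero_add,
      map_smul, zeg, hc _ (hW.T_mem _ _ hw), scalar_smul_smul, strip, LinearMap.comp_apply,
      zpow_add₀ hq]
    congr 1
    ring

end ThetaOps

/-- A set of nonzero scalars closed under addition, multiplication and containing the powers
of `q`. -/
structure PosCone (q : k) (P : Set k) : Prop where
  zpow_mem : ∀ n : ℤ, q ^ n ∈ P
  add_mem : ∀ a ∈ P, ∀ b ∈ P, a + b ∈ P
  mul_mem : ∀ a ∈ P, ∀ b ∈ P, a * b ∈ P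
  ne_zero : ∀ a ∈ P, a ≠ 0

theorem semi_pow_smul {x y : B} {c : k} (h : y * x = c • (x * y)) (n : ℕ) (v : M) :
    y • x ^ n • v = c ^ n • x ^ n • y • v := by
  rw [← mul_smul, semi_pow h, smul_assoc, mul_smul]

theorem derivation_pow (hq : q ≠ 0) {P : Set k} (hP : PosCone q P) {D R : M →ₗ[k] M}
    {x x' y : B} {a κ : k} {e b c d : ℤ}
    (h : ∀ v, D (x • v) = q ^ e • x • D v + a • (x' • v + κ • y • R v))
    (hx : x' * x = q ^ b • (x * x')) (hy : y * x = q ^ c • (x * y))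
    (hR : ∀ v, R (x • v) = q ^ d • x • R v) (n : ℕ) :
    ∃ e' : ℤ, ∃ α ∈ P, ∃ β ∈ P, ∀ v, D (x ^ (n + 1) • v) = q ^ e' • x ^ (n + 1) • D v +
      a • x ^ n • (α • x' • v + (β * κ) • y • R v) := by
  have pull : ∀ (b : B) (c : k) (v : M), b • c • v = c • b • v := smul_comm_field
  induction n with
  | zero =>
    refine ⟨e, 1, by simpa using hP.zpow_mem 0, 1, by simpa using hP.zpow_mem 0, fun v => ?_⟩
    simpa using h v
  | succ n ih =>
    obtain ⟨e', α, hα, β, hβ, ih⟩ := ih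
    have hRn : ∀ m v, R (x ^ m • v) = (q ^ d) ^ m • x ^ m • R v := by
      intro m
      induction m with
      | zero => intro v; simp
      | succ m ihm =>
        intro v
        rw [pow_succ' x, mul_smul, hR, ihm, pull, scalar_smul_smul, ← mul_smul (α := B) x, pow_succ' (q ^ d)]
    refine ⟨e + e', q ^ e * α + q ^ (b * (n + 1 : ℕ)), hP.add_mem _ (hP.mul_mem _
      (hP.zpow_mem _) _ hα) _ (hP.zpow_mem _), q ^ e * β + q ^ ((c + d) * (n + 1 : ℕ)),
      hP.add_mem _ (hP.mul_mem _ (hP.zpow_mem _) _ hβ) _ (hP.zpow_mem _), fun v => ?_⟩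
    rw [pow_succ' x (n + 1), mul_smul, h, ih, hRn, pull y, semi_pow_smul hx, semi_pow_smul hy]
    simp only [smul_add, pull, mul_smul (α := B) x, pow_succ' x n]
    rw [zpow_add₀ hq, zpow_mul, zpow_mul, zpow_natCast, zpow_natCast, zpow_add₀ hq, mul_pow]
    generalize x • x • x ^ n • D v = x1
    generalize x • x ^ n • x' • v = x2
    generalize x • x ^ n • y • R v = x3
    module

namespace ThetaOps

variable (H : ThetaOps q g E T) (hq : q ≠ 0) (S : SerreFamily q g) (hq1 : 1 - q ^ 2 ≠ 0)
  (hq2 : 1 + q ^ 2 ≠ 0) {P : Set k} (hP : PosCone q P) {p : ℕ} {W : Submodule k M}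
  (hW : Vacua E T p W)
include H hq S hq1 hq2 hP hW

theorem strip_pow {t : ℕ} (ht : t ≤ 2 * p) (n : ℕ) : ∃ c : k, c ≠ 0 ∧ ∀ x : B,
    (∀ r ≤ t, Neutral q (E (p - r)) x) → ∀ w ∈ W,
    strip E p t (segOf q g ((p : ℤ) - t) t ^ (n + 1) • x • w) =
      c • segOf q g ((p : ℤ) - t) t ^ n • x • w := by
  have hcomm : ∃ b : ℤ, zeg q g ((p : ℤ) - t + 1) t * segOf q g ((p : ℤ) - t) t =
      q ^ b • (segOf q g ((p : ℤ) - t) t * zeg q g ((p : ℤ) - t + 1) t) := by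
    cases t with
    | zero => exact ⟨0, by simp [zeg]⟩
    | succ t =>
      refine ⟨1, ?_⟩
      rw [zeg, S.segOf_same_right hq hq2 (a := (p : ℤ) - (t + 1 : ℕ)) (lt_add_one _)
        (by push_cast; ring), zpow_one, smul_smul, mul_inv_cancel₀ hq, one_smul]
  obtain ⟨b, hb⟩ := hcomm
  have h := H.E_segOf hq S hq1 (p - t) (p - t) t
  rw [if_pos rfl, if_neg (by omega)] at h
  obtain ⟨e', α, hα, _, -, key⟩ := derivation_pow (q := q) hq hP (D := E (p - t)) (R := (0 : M →ₗ[k] M))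
    (y := (0 : B)) (κ := 0) (a := 1 - q ^ 2) (c := 0) (d := 0)
    (fun v => by rw [h, zero_smul k, zero_smul B, smul_zero, add_zero, add_zero]) hb (by simp) (fun v => by simp) n
  simp only [mul_zero, zero_smul, add_zero] at key
  cases t with
  | zero =>
    refine ⟨α, hP.ne_zero _ hα, fun x hx w hw => ?_⟩
    have h0 := strip_smul_eq_zero hW (s := 0) hx hw
    rw [strip] at h0 ⊢
    simp only [Nat.cast_zero, sub_zero] at key ⊢
    rw [key, h0, smul_zero, smul_zero, zero_add, zeg, smul_assoc, one_smul, smul_comm_field,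
      smul_comm_field _ (1 - q ^ 2)⁻¹, scalar_smul_smul, scalar_smul_smul]
    congr 1
    field_simp
  | succ t =>
    set X := segOf q g ((p : ℤ) - (t + 1 : ℕ)) (t + 1)
    have hX : ∀ r ≤ t, Neutral q (E (p - r)) X := fun r hr =>
      H.neutral_column hq S hq1 (by omega) (by omega)
    obtain ⟨f, hf⟩ := Neutral.strip hq fun r hr => (hX r hr).pow hq n
    refine ⟨(1 - q ^ 2) * (q ^ f * (α * (1 - q ^ 2) ^ t)), mul_ne_zero hq1 (mul_ne_zero
      (zpow_ne_zero _ hq) (mul_ne_zero (hP.ne_zero _ hα) (pow_ne_zero _ hq1))),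
      fun x hx w hw => ?_⟩
    obtain ⟨c, hc⟩ := hx (t + 1) le_rfl
    have h0 : strip E p t (X ^ (n + 1) • x • E (p - (t + 1 : ℕ)) w) = 0 := by
      rw [← mul_smul]
      exact strip_smul_eq_zero hW (fun r hr => ((hX r hr).pow hq _).mul hq (hx r (by omega)))
        (hW.E_mem _ _ hw)
    rw [strip, LinearMap.comp_apply, key, hc, smul_comm_field, map_add, map_smul, map_smul, h0,
      smul_zero, smul_zero, zero_add, map_smul, hf, map_smul, zeg,
      show (p : ℤ) - (t + 1 : ℕ) + 1 = p - t by push_cast; ring,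
      H.strip_segOf hq S hq1 hW (by omega) (fun r hr => hx r (by omega)) hw]
    simp only [smul_comm_field (X ^ n), scalar_smul_smul]

theorem strip_pow_last (n : ℕ) : ∃ c : k, c ≠ 0 ∧ ∃ α ∈ P, ∃ β ∈ P, ∀ w ∈ W,
    strip E p (2 * p + 1) (segOf q g ((p : ℤ) - (2 * p + 1 : ℕ)) (2 * p + 1) ^ (n + 1) • w) =
      c • segOf q g ((p : ℤ) - (2 * p + 1 : ℕ)) (2 * p + 1) ^ n •
        (α • w + β • strip T p (2 * p) (T (-1 - p) w)) := by
  have hp : (p : ℤ) - (2 * p + 1 : ℕ) = -1 - p := by push_cast; ring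
  rw [hp]
  have h := H.E_segOf hq S hq1 (-1 - p) (-1 - p) (2 * p + 1)
  rw [if_pos rfl, if_pos (by push_cast; ring), zeg, zeg] at h
  obtain ⟨e', α, hα, β, hβ, key⟩ := derivation_pow (q := q) hq hP (D := E (-1 - p)) (R := T (-1 - p))
    (x := segOf q g (-1 - p : ℤ) (2 * p + 1)) (x' := segOf q g (-1 - p + 1 : ℤ) (2 * p))
    (y := segOf q g (-1 - p : ℤ) (2 * p)) (κ := q ^ (-wt (-1 - p) (-1 - p) (2 * p + 1)))
    (a := 1 - q ^ 2) (b := 1) (c := -1)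
    (fun v => by rw [h, mul_smul, smul_add])
    (by
      rw [S.segOf_same_right hq hq2 (a := (-1 - p : ℤ)) (lt_add_one _) (by push_cast; ring),
        zpow_one, smul_smul, mul_inv_cancel₀ hq, one_smul])
    (by
      rw [S.segOf_same_left hq hq2 (l := 2 * p) (n := 2 * p + 1) (lt_add_one _), smul_smul, zpow_neg_one,
        inv_mul_cancel₀ hq, one_smul])
    (H.T_segOf hq _ _ _) n
  set X := segOf q g (-1 - p : ℤ) (2 * p + 1)
  have hX : ∀ r ≤ 2 * p, Neutral q (E (p - r)) X := fun r hr =>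
    H.neutral_segOf hq S hq1 (by omega) (by push_cast; omega)
  obtain ⟨f, hf⟩ := Neutral.strip hq fun r hr => (hX r hr).pow hq n
  obtain ⟨j, hj⟩ := H.strip_segOf_bot hq S hq1 hW (s := 2 * p) le_rfl
  refine ⟨(1 - q ^ 2) * q ^ f * (1 - q ^ 2) ^ (2 * p), mul_ne_zero (mul_ne_zero hq1
    (zpow_ne_zero _ hq)) (pow_ne_zero _ hq1), α, hα, β *
    q ^ (-wt (-1 - p) (-1 - p) (2 * p + 1)) * q ^ j, hP.mul_mem _ (hP.mul_mem _ hβ _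
    (hP.zpow_mem _)) _ (hP.zpow_mem _), fun w hw => ?_⟩
  have h1 := H.strip_segOf hq S hq1 hW (s := 2 * p) le_rfl (x := 1) (fun _ _ => Neutral.one) hw
  rw [one_smul, show (p : ℤ) - (2 * p : ℕ) = -1 - p + 1 by push_cast; ring] at h1
  rw [strip, LinearMap.comp_apply, hp, key, hW.E_bot w hw, smul_zero, smul_zero, zero_add,
    map_smul, hf, map_add, (strip E p (2 * p)).map_smul α, (strip E p (2 * p)).map_smul (_ * _), h1, hj _ (hW.T_mem _ _ hw)]
  simp only [smul_comm_field (X ^ n), scalar_smul_smul, smul_add]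
  congr 2
  all_goals ring

end ThetaOps

end Generic

section Generic

variable {k B M : Type*} [Field k] [Ring B] [Algebra k B] [AddCommGroup M] [Module k M]
  [Module B M] [IsScalarTower k B M] {q : k} {g : ℤ → B} {E T : ℤ → M →ₗ[k] M}

namespace ThetaOps

variable (H : ThetaOps q g E T) (hq : q ≠ 0)
include H hq

theorem neutral_far {a b : ℤ} (h : 1 < |a - b|) (i : ℤ) :
    Neutral q (E i) (g a * g b - g b * g a) := by
  have pull : ∀ (b : B) (c : k) (v : M), b • c • v = c • b • v := smul_comm_field
  have hab : cartan a b = 0 ∧ cartan b a = 0 := by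
    unfold cartan
    rcases lt_abs.1 h with h | h <;> constructor <;> rw [if_neg (by omega), if_neg (by omega)]
  refine ⟨-cartan i a + -cartan i b, fun v => ?_⟩
  rw [sub_smul, sub_smul, mul_smul, mul_smul, mul_smul, mul_smul, map_sub (E i), H.E_gen i a,
    H.E_gen i b, H.E_gen i b, H.E_gen i a, H.T_gen, H.T_gen, zpow_add₀ hq]
  simp only [smul_add, pull, smul_sub]
  have c1 : (if i = b then 1 else 0 : k) * (q ^ (-cartan i a) - 1) = 0 := by
    split_ifs with hi
    · rw [hi, hab.2]; simp
    · simp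
  have c2 : (if i = a then 1 else 0 : k) * (q ^ (-cartan i b) - 1) = 0 := by
    split_ifs with hi
    · rw [hi, hab.1]; simp
    · simp
  have c3 : (if -1 - i = b then 1 else 0 : k) *
      (q ^ (-cartan i a) - q ^ (-(cartan i a + cartan (-1 - i) a))) = 0 := by
    split_ifs with hi
    · rw [hi, hab.2]; simp
    · simp
  have c4 : (if -1 - i = a then 1 else 0 : k) *
      (q ^ (-cartan i b) - q ^ (-(cartan i b + cartan (-1 - i) b))) = 0 := by
    split_ifs with hi
    · rw [hi, hab.1]; simp
    · simp
  generalize g a • g b • E i v = x1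
  generalize g b • g a • E i v = x2
  generalize g a • v = x3
  generalize g b • v = x4
  generalize g a • T i v = x5
  generalize g b • T i v = x6
  linear_combination (norm := module) congrArg (· • x3) c1 - congrArg (· • x4) c2 +
    congrArg (· • x5) c3 - congrArg (· • x6) c4

theorem neutral_serre {a b : ℤ} (h : |a - b| = 1) (i : ℤ) :
    Neutral q (E i) (g a * g a * g b + g b * (g a * g a) - (q + q⁻¹) • (g a * g b * g a)) := by
  have pull : ∀ (b : B) (c : k) (v : M), b • c • v = c • b • v := smul_comm_field
  have hab : cartan a b = -1 ∧ cartan b a = -1 := by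
    unfold cartan
    rcases eq_or_eq_neg_of_abs_eq h with h | h <;> constructor <;>
      rw [if_neg (by omega), if_pos (by omega)]
  have haa : cartan a a = 2 := if_pos rfl
  refine ⟨-cartan i a + -cartan i a + -cartan i b, fun v => ?_⟩
  have eT : ∀ j, q ^ (-(cartan i j + cartan (-1 - i) j)) =
      q ^ (-cartan i j) * q ^ (-cartan (-1 - i) j) := fun j => by rw [neg_add, zpow_add₀ hq]
  set ua := q ^ (-cartan i a) with hua
  set ub := q ^ (-cartan i b) with hub
  set va := q ^ (-cartan (-1 - i) a) with hva
  set vb := q ^ (-cartan (-1 - i) b) with hvb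
  set α : k := if i = a then 1 else 0 with hα
  set β : k := if i = b then 1 else 0 with hβ
  set α' : k := if -1 - i = a then 1 else 0 with hα'
  set β' : k := if -1 - i = b then 1 else 0 with hβ'
  have sq : q ^ (-2 : ℤ) = q⁻¹ * q⁻¹ := by rw [zpow_neg, ← mul_inv]; norm_cast; rw [pow_two]
  have d1 : α * (1 + ua - (q + q⁻¹) * (ua * ub)) = 0 := by
    by_cases hi : i = a
    · rw [hua, hub, hi, hab.1, haa, sq, neg_neg, zpow_one]; field_simp; ring
    · rw [hα, if_neg hi, zero_mul]
  have d2 : α * (ub + ua * ub - (q + q⁻¹)) = 0 := by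
    by_cases hi : i = a
    · rw [hua, hub, hi, hab.1, haa, sq, neg_neg, zpow_one]; field_simp; ring
    · rw [hα, if_neg hi, zero_mul]
  have d3 : β * (1 + ua * ua - (q + q⁻¹) * ua) = 0 := by
    by_cases hi : i = b
    · rw [hua, hi, hab.2, neg_neg, zpow_one]; field_simp; ring
    · rw [hβ, if_neg hi, zero_mul]
  have d4 : α' * (ua * (ub * vb) + ua * va * (ub * vb) - (q + q⁻¹) * (ua * ub)) = 0 := by
    by_cases hi : -1 - i = a
    · rw [hva, hvb, hi, hab.1, haa, sq, neg_neg, zpow_one]; field_simp; ring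
    · rw [hα', if_neg hi, zero_mul]
  have d5 : α' * (ub * (ua * va) + ua * ub - (q + q⁻¹) * (ua * va * (ub * vb))) = 0 := by
    by_cases hi : -1 - i = a
    · rw [hva, hvb, hi, hab.1, haa, sq, neg_neg, zpow_one]; field_simp; ring
    · rw [hα', if_neg hi, zero_mul]
  have d6 : β' * (ua * va * (ua * va) + ua * ua - (q + q⁻¹) * (ua * (ua * va))) = 0 := by
    by_cases hi : -1 - i = b
    · rw [hva, hi, hab.2, neg_neg, zpow_one]; field_simp; ring
    · rw [hβ', if_neg hi, zero_mul]
  have e1 : E i (g a • g a • g b • v) = (ua * ua * ub) • g a • g a • g b • E i v +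
      ((ua * ua * β) • g a • g a • v + (ua * ua * β') • g a • g a • T i v +
        (α * (1 + ua)) • g a • g b • v +
        (α' * (ua * (ub * vb) + ua * va * (ub * vb))) • g a • g b • T i v) := by
    rw [H.E_gen i a, H.E_gen i a, H.E_gen i b, H.T_gen, H.T_gen, H.T_gen, eT, eT]
    simp only [smul_add, pull]
    generalize g a • g a • g b • E i v = x1
    generalize g a • g a • v = x2
    generalize g a • g a • T i v = x3
    generalize g a • g b • v = x4
    generalize g a • g b • T i v = x5
    module
  have e2 : E i (g b • g a • g a • v) = (ua * ua * ub) • g b • g a • g a • E i v +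
      (β • g a • g a • v + (β' * (ua * va * (ua * va))) • g a • g a • T i v +
        (α * (ub + ua * ub)) • g b • g a • v +
        (α' * (ub * (ua * va) + ua * ub)) • g b • g a • T i v) := by
    rw [H.E_gen i b, H.E_gen i a, H.E_gen i a, H.T_gen, H.T_gen, H.T_gen, eT]
    simp only [smul_add, pull]
    generalize g b • g a • g a • E i v = x1
    generalize g a • g a • v = x2
    generalize g a • g a • T i v = x3
    generalize g b • g a • v = x4
    generalize g b • g a • T i v = x5
    module
  have e3 : E i (g a • g b • g a • v) = (ua * ua * ub) • g a • g b • g a • E i v +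
      ((ua * β) • g a • g a • v + (β' * (ua * (ua * va))) • g a • g a • T i v +
        α • g b • g a • v + (α' * (ua * va * (ub * vb))) • g b • g a • T i v +
        (α * (ua * ub)) • g a • g b • v + (α' * (ua * ub)) • g a • g b • T i v) := by
    rw [H.E_gen i a, H.E_gen i b, H.E_gen i a, H.T_gen, H.T_gen, H.T_gen, eT, eT]
    simp only [smul_add, pull]
    generalize g a • g b • g a • E i v = x1
    generalize g a • g a • v = x2
    generalize g a • g a • T i v = x3
    generalize g b • g a • v = x4
    generalize g b • g a • T i v = x5
    generalize g a • g b • v = x6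
    generalize g a • g b • T i v = x7
    module
  generalize q + q⁻¹ = c at *
  rw [sub_smul, add_smul, sub_smul, add_smul, smul_assoc, smul_assoc, map_sub (E i), map_add (E i),
    (E i).map_smul c]
  simp only [mul_smul (α := B)]
  rw [e1, e2, e3, zpow_add₀ hq, zpow_add₀ hq]
  generalize g a • g a • g b • E i v = y1
  generalize g b • g a • g a • E i v = y2
  generalize g a • g b • g a • E i v = y3
  generalize g a • g a • v = x2
  generalize g a • g a • T i v = x3
  generalize g b • g a • v = x4
  generalize g b • g a • T i v = x5
  generalize g a • g b • v = x6
  generalize g a • g b • T i v = x7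
  linear_combination (norm := module) congrArg (· • x6) d1 + congrArg (· • x4) d2 +
    congrArg (· • x2) d3 + congrArg (· • x7) d4 + congrArg (· • x5) d5 + congrArg (· • x3) d6

end ThetaOps

end Generic

section WordModel

variable {k : Type*} [Field k] (q : k)

/-- The weight by which the operator `T_i` scales the value at a word. -/
def tau (i : ℤ) (w : List ℤ) : k := q ^ (-(w.map fun s => cartan i s + cartan (-1 - i) s).sum)

/-- The value at a word of the symmetric quantum shuffle product of the letter `j` with a function. -/
def shufVal (j : ℤ) : List ℤ → (List ℤ → k) → k
  | [], _ => 0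
  | i :: w, f => q ^ (-cartan i j) * shufVal j w (fun v => f (i :: v)) +
      ((if i = j then 1 else 0) * f w + (if -1 - i = j then 1 else 0) * (tau q i w * f w))

/-- Left multiplication by the letter `j` in the symmetric quantum shuffle module. -/
def shuf (j : ℤ) : (List ℤ → k) →ₗ[k] (List ℤ → k) where
  toFun f w := shufVal q j w f
  map_add' f g := by
    funext w
    rw [Pi.add_apply]
    induction w generalizing f g with
    | nil => simp [shufVal]
    | cons i w ih =>
      have := ih (fun v => f (i :: v)) (fun v => g (i :: v))
      simp only [shufVal, Pi.add_apply]
      rw [show (fun v => f (i :: v) + g (i :: v)) = (fun v => f (i :: v)) + fun v => g (i :: v)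
        from rfl, this]
      ring
  map_smul' c f := by
    funext w
    rw [Pi.smul_apply]
    induction w generalizing f with
    | nil => simp [shufVal]
    | cons i w ih =>
      have := ih (fun v => f (i :: v))
      simp only [shufVal, Pi.smul_apply, smul_eq_mul, RingHom.id_apply] at this ⊢
      rw [show (fun v => c * f (i :: v)) = c • fun v => f (i :: v) from rfl, this]
      ring

/-- Removing the first letter. -/
def wordE (i : ℤ) : (List ℤ → k) →ₗ[k] (List ℤ → k) where
  toFun f w := f (i :: w)
  map_add' _ _ := rfl
  map_smul' _ _ := rfl

/-- The diagonal operator `T_i`. -/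
def wordT (i : ℤ) : (List ℤ → k) →ₗ[k] (List ℤ → k) where
  toFun f w := tau q i w * f w
  map_add' f g := by funext w; exact mul_add _ _ _
  map_smul' c f := by funext w; exact mul_left_comm _ _ _

variable {q}

theorem tau_cons (hq : q ≠ 0) (i s : ℤ) (w : List ℤ) :
    tau q i (s :: w) = q ^ (-(cartan i s + cartan (-1 - i) s)) * tau q i w := by
  rw [tau, tau, List.map_cons, List.sum_cons, neg_add, zpow_add₀ hq]

theorem wordT_shuf (hq : q ≠ 0) (i j : ℤ) (w : List ℤ) (f : List ℤ → k) :
    tau q i w * shufVal q j w f =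
      q ^ (-(cartan i j + cartan (-1 - i) j)) * shufVal q j w (wordT q i f) := by
  induction w generalizing f with
  | nil => simp [shufVal]
  | cons s w ih =>
    have h1 : shufVal q j w (fun v => wordT q i f (s :: v)) =
        q ^ (-(cartan i s + cartan (-1 - i) s)) *
          shufVal q j w (wordT q i fun v => f (s :: v)) := by
      rw [show (fun v => wordT q i f (s :: v)) = q ^ (-(cartan i s + cartan (-1 - i) s)) •
        wordT q i fun v => f (s :: v) by
          funext v
          change tau q i (s :: v) * f (s :: v) = _ * (tau q i v * f (s :: v))
          rw [tau_cons hq, mul_assoc]]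
      exact congrFun ((shuf q j).map_smul _ _) w
    have h2 : (if s = j then 1 else 0 : k) * (q ^ (-(cartan i s + cartan (-1 - i) s)) -
        q ^ (-(cartan i j + cartan (-1 - i) j))) = 0 := by
      split_ifs with h
      · rw [h, sub_self, mul_zero]
      · rw [zero_mul]
    have h3 : (if -1 - s = j then 1 else 0 : k) * (q ^ (-(cartan i s + cartan (-1 - i) s)) -
        q ^ (-(cartan i j + cartan (-1 - i) j))) = 0 := by
      split_ifs with h
      · rw [← h, ← cartan_theta i s, ← cartan_theta (-1 - i) s, sub_sub_cancel,
          add_comm (cartan (-1 - i) _), sub_self, mul_zero]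
      · rw [zero_mul]
    rw [shufVal, shufVal, h1, tau_cons hq]
    change _ = _ * (_ + (_ * (tau q i w * f w) + _ * (_ * (tau q i w * f w))))
    linear_combination q ^ (-(cartan i s + cartan (-1 - i) s)) * q ^ (-cartan s j) *
      ih (fun v => f (s :: v)) + tau q i w * f w * h2 + tau q s w * tau q i w * f w * h3

theorem thetaOps_shuf (hq : q ≠ 0) :
    ThetaOps (B := Module.End k (List ℤ → k)) q (shuf q) wordE (wordT q) where
  E_gen _ _ _ := rfl
  T_gen i j f := funext fun w => wordT_shuf hq i j w f

theorem eq_zero_of_neutral {x : Module.End k (List ℤ → k)}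
    (hx : ∀ i, Neutral q (wordE (k := k) i) x) (h0 : ∀ f, x f [] = 0) : x = 0 := by
  ext f w
  change x f w = 0
  induction w generalizing f with
  | nil => exact h0 f
  | cons i w ih =>
    obtain ⟨c, hc⟩ := hx i
    have := congrFun (hc f) w
    change x f (i :: w) = q ^ c * x (wordE i f) w at this
    rw [this, ih, mul_zero]

theorem serreFamily_shuf (hq : q ≠ 0) :
    SerreFamily (B := Module.End k (List ℤ → k)) q (shuf q) where
  far a b h := sub_eq_zero.1 <| eq_zero_of_neutral ((thetaOps_shuf hq).neutral_far hq h) fun f => by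
    change (0 : k) - 0 = 0
    exact sub_self 0
  serre a b h := sub_eq_zero.1 <| eq_zero_of_neutral ((thetaOps_shuf hq).neutral_serre hq h)
    fun f => by
      change (0 : k) + 0 - (q + q⁻¹) * 0 = 0
      ring

end WordModel

/-- The representation of `U` on functions on words. -/
def wordRep : U →ₐ[K] Module.End K (List ℤ → K) :=
  RingQuot.liftAlgHom K ⟨FreeAlgebra.lift K (shuf q), fun x y h => by
    have S := serreFamily_shuf nonRoot_q.ne_zero
    cases h with
    | far a b h => simpa using S.far a b h
    | serre a b h => simpa using S.serre a b h⟩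

theorem wordRep_gen (j : ℤ) : wordRep (gen j) = shuf q j := by
  simp [wordRep, gen]

/-- Functions on words, as a module over `U`. -/
def WordFun : Type := List ℤ → K

instance : AddCommGroup WordFun := inferInstanceAs (AddCommGroup (List ℤ → K))
instance : Module K WordFun := inferInstanceAs (Module K (List ℤ → K))
instance : Module U WordFun :=
  Module.compHom (List ℤ → K) (wordRep : U →+* Module.End K (List ℤ → K))
instance : IsScalarTower K U WordFun where
  smul_assoc c u f := by
    change wordRep (c • u) f = c • wordRep u f
    rw [map_smul]; rfl

theorem gen_smul_wordFun (j : ℤ) (f : WordFun) : gen j • f = (shuf q j f : List ℤ → K) :=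
  congrArg (fun x : Module.End K (List ℤ → K) => x f) (wordRep_gen j)

/-- The operators `wordE i` on `WordFun`. -/
def opE (i : ℤ) : WordFun →ₗ[K] WordFun := wordE (k := K) i

/-- The operators `wordT q i` on `WordFun`. -/
def opT (i : ℤ) : WordFun →ₗ[K] WordFun := wordT q i

theorem thetaOps_gen : ThetaOps q gen opE opT where
  E_gen i j v := by
    rw [gen_smul_wordFun, gen_smul_wordFun]
    exact (thetaOps_shuf nonRoot_q.ne_zero).E_gen i j v
  T_gen i j v := by
    rw [gen_smul_wordFun, gen_smul_wordFun]
    exact (thetaOps_shuf nonRoot_q.ne_zero).T_gen i j v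

/-- The indicator function of the empty word. -/
def emptyWord : List ℤ → K := fun w => if w = [] then 1 else 0

/-- The vacuum in the module of functions on words. -/
def wordVac : WordFun := emptyWord

theorem shufVal_emptyWord (j : ℤ) (w : List ℤ) :
    shufVal q j w emptyWord = shufVal q (-1 - j) w emptyWord := by
  cases w with
  | nil => rfl
  | cons i w =>
    have h0 : ∀ j, shufVal q j w (fun v => emptyWord (i :: v)) = 0 := fun j =>
      (congrArg (shufVal q j w) (funext fun v => if_neg (List.cons_ne_nil i v))).trans
        (congrFun (map_zero (shuf q j)) w)
    rw [shufVal, shufVal, h0, h0]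
    cases w with
    | nil =>
      have : tau q i [] = 1 := by simp [tau]
      rw [this]
      by_cases h1 : i = j <;> by_cases h2 : -1 - i = j
      · rw [if_pos h1, if_pos h2, if_pos (by omega), if_pos (by omega), mul_zero, mul_zero]
      · rw [if_pos h1, if_neg h2, if_neg (by omega), if_pos (by omega)]; ring
      · rw [if_neg h1, if_pos h2, if_pos (by omega), if_neg (by omega)]; ring
      · rw [if_neg h1, if_neg h2, if_neg (by omega), if_neg (by omega), mul_zero, mul_zero]
    | cons s w =>
      have : emptyWord (s :: w) = 0 := if_neg (List.cons_ne_nil s w)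
      rw [this]; ring

/-- The homomorphism to functions on words sending the vacuum to `wordVac`. -/
def toWord : ThetaMod →ₗ[U] WordFun :=
  Submodule.liftQ Jideal (LinearMap.toSpanSingleton U WordFun wordVac) <| by
    refine Submodule.span_le.2 ?_
    rintro _ ⟨i, ⟨a, rfl⟩, rfl⟩
    change (fgen (2 * a + 1) - fgen (-(2 * a + 1))) • wordVac = 0
    rw [show -(2 * a + 1) = 2 * (-1 - a) + 1 by ring, fgen_odd, fgen_odd, sub_smul,
      gen_smul_wordFun, gen_smul_wordFun]
    refine sub_eq_zero.2 ?_
    exact funext fun w => shufVal_emptyWord a w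

theorem toWord_smul_vac (u : U) : toWord (u • vac) = u • wordVac := by
  rw [map_smul]
  congr 1
  exact one_smul U wordVac

/-- Functions supported on words in the letters `-p, …, p - 1`. -/
def wordBox (p : ℕ) : Submodule K WordFun where
  carrier := {f | ∀ w : List ℤ, (∃ i ∈ w, ¬(-p ≤ i ∧ i < p)) → (f : List ℤ → K) w = 0}
  zero_mem' _ _ := rfl
  add_mem' {f g} hf hg w hw := by
    change (f : List ℤ → K) w + (g : List ℤ → K) w = 0
    rw [hf w hw, hg w hw, add_zero]
  smul_mem' c f hf w hw := by
    change c * (f : List ℤ → K) w = 0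
    rw [hf w hw, mul_zero]

theorem wordVac_mem (p : ℕ) : wordVac ∈ wordBox p := by
  rintro w ⟨i, hi, -⟩
  exact if_neg (List.ne_nil_of_mem hi)

theorem vacua_wordBox (p : ℕ) : Vacua opE opT p (wordBox p) where
  E_mem i f hf w := fun ⟨s, hs, h⟩ => hf (i :: w) ⟨s, List.mem_cons_of_mem _ hs, h⟩
  T_mem i f hf w hw := by
    change tau q i w * _ = 0
    rw [hf w hw, mul_zero]
  E_top f hf := funext fun w => hf (p :: w) ⟨p, List.mem_cons_self, by omega⟩
  E_bot f hf := funext fun w => hf ((-1 - p) :: w) ⟨-1 - p, List.mem_cons_self, by omega⟩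

theorem shufVal_eq_zero {p : ℕ} {j : ℤ} (h1 : -p ≤ j) (h2 : j < p) {f : List ℤ → K}
    (hf : ∀ w : List ℤ, (∃ i ∈ w, ¬(-p ≤ i ∧ i < p)) → f w = 0) {w : List ℤ}
    (hw : ∃ i ∈ w, ¬(-(p : ℤ) ≤ i ∧ i < p)) : shufVal q j w f = 0 := by
  induction w generalizing f with
  | nil => rfl
  | cons s w ih =>
    rw [shufVal]
    by_cases hs : -p ≤ s ∧ s < p
    · have hw' : ∃ i ∈ w, ¬(-(p : ℤ) ≤ i ∧ i < p) := by
        obtain ⟨i, hi, h⟩ := hw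
        rcases List.mem_cons.1 hi with rfl | hi
        · exact absurd hs h
        · exact ⟨i, hi, h⟩
      rw [ih (fun v ⟨i, hi, h⟩ => hf (s :: v) ⟨i, List.mem_cons_of_mem _ hi, h⟩) hw', hf w hw']
      ring
    · have : shufVal q j w (fun v => f (s :: v)) = 0 :=
        (congrArg (shufVal q j w) (funext fun v => hf (s :: v) ⟨s, List.mem_cons_self, hs⟩)).trans
          (congrFun (map_zero (shuf q j)) w)
      rw [this, if_neg (by omega), if_neg (by omega)]
      ring

theorem gen_smul_mem_wordBox {p : ℕ} {j : ℤ} (h1 : -p ≤ j) (h2 : j < p) {f : WordFun}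
    (hf : f ∈ wordBox p) : gen j • f ∈ wordBox p := by
  rw [gen_smul_wordFun]
  exact fun w hw => shufVal_eq_zero h1 h2 hf hw

/-- Scalars of the form `q ^ (-n) * f(q)` for a polynomial `f` with `f(1) > 0`. -/
def posScalars : Set K :=
  {x | ∃ (f : Polynomial ℚ) (n : ℕ), 0 < f.eval 1 ∧ q ^ n * x = algebraMap (Polynomial ℚ) K f}

theorem algebraMap_X_pow (n : ℕ) : algebraMap (Polynomial ℚ) K (Polynomial.X ^ n) = q ^ n := by
  rw [map_pow, RatFunc.algebraMap_X, q]

theorem posCone_posScalars : PosCone q posScalars where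
  zpow_mem n := by
    have hq := nonRoot_q.ne_zero
    refine ⟨Polynomial.X ^ n.toNat, (-n).toNat, by simp, ?_⟩
    rw [algebraMap_X_pow, ← zpow_natCast, ← zpow_natCast, ← zpow_add₀ hq]
    congr 1
    omega
  add_mem := by
    rintro a ⟨f, n, hf, hfa⟩ b ⟨g, m, hg, hgb⟩
    refine ⟨Polynomial.X ^ m * f + Polynomial.X ^ n * g, n + m, by simpa using add_pos hf hg, ?_⟩
    rw [map_add, map_mul, map_mul, algebraMap_X_pow, algebraMap_X_pow, ← hfa, ← hgb]
    ring
  mul_mem := by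
    rintro a ⟨f, n, hf, hfa⟩ b ⟨g, m, hg, hgb⟩
    refine ⟨f * g, n + m, by simpa using mul_pos hf hg, ?_⟩
    rw [map_mul, ← hfa, ← hgb]
    ring
  ne_zero := by
    rintro a ⟨f, n, hf, hfa⟩ rfl
    rw [mul_zero, eq_comm, map_eq_zero_iff _ (RatFunc.algebraMap_injective ℚ)] at hfa
    simp [hfa] at hf

theorem one_sub_q_sq : 1 - q ^ 2 ≠ 0 := by
  intro h
  have h2 := nonRoot_q.qnum_ne_zero (n := 2) (by norm_num)
  have hq := nonRoot_q.ne_zero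
  have : q ^ (2 : ℤ) = 1 := by
    rw [show (2 : ℤ) = (2 : ℕ) from rfl, zpow_natCast]; exact (sub_eq_zero.1 h).symm
  refine h2 ?_
  rw [qnum, zpow_neg, this]
  simp

theorem strip_wordT (p s : ℕ) (w : List ℤ) : ∃ e : ℤ, ∀ f : WordFun,
    (strip opT p s f : List ℤ → K) w = q ^ e * (f : List ℤ → K) w := by
  induction s with
  | zero => exact ⟨_, fun f => rfl⟩
  | succ s ih =>
    obtain ⟨e, he⟩ := ih
    obtain ⟨e', he'⟩ : ∃ e' : ℤ, tau q (p - (s + 1 : ℕ)) w = q ^ e' := ⟨_, rfl⟩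
    refine ⟨e + e', fun f => ?_⟩
    rw [strip, LinearMap.comp_apply, he, zpow_add₀ nonRoot_q.ne_zero, mul_assoc, ← he']
    rfl

theorem eq_zero_of_strip {p s : ℕ} {i : ℤ} {α β : K} (hα : α ∈ posScalars) (hβ : β ∈ posScalars)
    {f : WordFun} (h : α • f + β • strip opT p s (opT i f) = 0) : f = 0 := by
  funext w
  obtain ⟨e, he⟩ := strip_wordT p s w
  obtain ⟨e', he'⟩ : ∃ e' : ℤ, tau q i w = q ^ e' := ⟨_, rfl⟩
  have := congrFun h w
  change α * (f : List ℤ → K) w + β * (strip opT p s (opT i f) : List ℤ → K) w = 0 at this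
  rw [he] at this
  change α * (f : List ℤ → K) w + β * (q ^ e * (tau q i w * (f : List ℤ → K) w)) = 0 at this
  rw [he', ← mul_assoc, ← mul_assoc, ← add_mul] at this
  have P := posCone_posScalars
  exact (mul_eq_zero.1 this).resolve_left (P.ne_zero _ (P.add_mem _ hα _ (P.mul_mem _
    (P.mul_mem _ hβ _ (P.zpow_mem _)) _ (P.zpow_mem _))))

theorem Vacua.strip_T_mem {M : Type*} [AddCommGroup M] [Module K M] {E T : ℤ → M →ₗ[K] M} {p : ℕ}
    {W : Submodule K M} (hW : Vacua E T p W) (s : ℕ) {w : M} (hw : w ∈ W) :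
    strip T p s w ∈ W := by
  induction s generalizing w with
  | zero => exact hW.T_mem _ _ hw
  | succ s ih => exact ih (hW.T_mem _ _ hw)

theorem Neutral.mon {M : Type*} [AddCommGroup M] [Module K M] [Module U M] [IsScalarTower K U M]
    {D : M →ₗ[K] M} {C : ℕ → ℤ → K} {X : ℕ → U} {n : ℕ → ℤ} {L : ℕ}
    (h : ∀ s < L, Neutral q D (_root_.dpow (C s) (X s) (n s))) : Neutral q D (_root_.mon C X n L) := by
  induction L with
  | zero => exact Neutral.one
  | succ L ih => exact (ih fun s hs => h s (by omega)).mul nonRoot_q.ne_zero (h L (by omega))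

theorem neutral_mon_suffix {p r t : ℕ} (h : r ≤ t) (n : ℕ → ℤ) :
    Neutral q (opE (p - r))
      (mon (colC p) (colX p) (suffix n (t + 1)) (2 * p + 2)) := by
  refine Neutral.mon fun s hs => ?_
  by_cases hst : s < t + 1
  · rw [suffix, if_pos hst, dpow_zero]
    exact Neutral.one
  · exact (thetaOps_gen.neutral_column nonRoot_q.ne_zero serreFamily_gen one_sub_q_sq
      (by omega) (by omega)).dpow nonRoot_q.ne_zero _ _

theorem exists_strip {p t : ℕ} (ht : t < 2 * p + 2) (a : ℕ) : ∃ R : WordFun →ₗ[K] WordFun,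
    (∀ w ∈ wordBox p, R w ∈ wordBox p) ∧ (∀ w, R w = 0 → w = 0) ∧
    ∀ n : ℕ → ℤ, n t = a + 1 → ∀ w ∈ wordBox p,
      strip opE p t
        (mon (colC p) (colX p) (suffix n t) (2 * p + 2) • w) =
      mon (colC p) (colX p) (suffix (Function.update n t a) t) (2 * p + 2) • R w := by
  have hq := nonRoot_q.ne_zero
  have hW := vacua_wordBox p
  have hC : ∀ n, 0 < n → colC p t n ≠ 0 := by
    unfold colC; split_ifs
    · exact qInts_qnumTwo.ne
    · exact qInts_qnum.ne
  set d : ℕ → K := fun a => (∏ ν ∈ Finset.range a, colC p t (ν + 1))⁻¹ with hd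
  have hd0 : ∀ a, d a ≠ 0 := fun a => inv_ne_zero (Finset.prod_ne_zero_iff.2 fun ν _ =>
    hC _ (by omega))
  have hupd : ∀ n : ℕ → ℤ, mon (colC p) (colX p) (suffix (Function.update n t a) t) (2 * p + 2) =
      dpow (colC p t) (colX p t) a * mon (colC p) (colX p) (suffix n (t + 1)) (2 * p + 2) := by
    intro n
    rw [mon_suffix ht, Function.update_self]
    congr 2
    funext s
    unfold suffix
    split_ifs
    · rfl
    · rw [Function.update_of_ne (by omega)]
  by_cases ht' : t ≤ 2 * p
  · obtain ⟨c, hc, key⟩ := thetaOps_gen.strip_pow hq serreFamily_gen one_sub_q_sq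
      nonRoot_q.one_add_sq posCone_posScalars hW ht' a
    have hne : d (a + 1) * c * (d a)⁻¹ ≠ 0 := mul_ne_zero (mul_ne_zero (hd0 _) hc)
      (inv_ne_zero (hd0 _))
    refine ⟨(d (a + 1) * c * (d a)⁻¹) • LinearMap.id, fun w hw => Submodule.smul_mem _ _ hw,
      fun w hw => (smul_eq_zero.1 hw).resolve_left hne, fun n hn w hw => ?_⟩
    rw [mon_suffix ht, hn, hupd, mul_smul, mul_smul, show (a : ℤ) + 1 = (a + 1 : ℕ) by simp,
      dpow_natCast, dpow_natCast, smul_assoc, smul_assoc]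
    change strip opE p t (d (a + 1) • colX p t ^ (a + 1) •
        mon (colC p) (colX p) (suffix n (t + 1)) (2 * p + 2) • w) =
      d a • colX p t ^ a • mon (colC p) (colX p) (suffix n (t + 1)) (2 * p + 2) •
        (d (a + 1) * c * (d a)⁻¹) • w
    rw [map_smul, colX, key _ (fun r hr => neutral_mon_suffix hr n) w hw,
      smul_comm_field _ (d (a + 1) * c * (d a)⁻¹), smul_comm_field _ (d (a + 1) * c * (d a)⁻¹),
      scalar_smul_smul, scalar_smul_smul]
    congr 1
    rw [mul_comm (d a), mul_assoc, inv_mul_cancel₀ (hd0 a), mul_one]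
  · obtain rfl : t = 2 * p + 1 := by omega
    obtain ⟨c, hc, α, hα, β, hβ, key⟩ := thetaOps_gen.strip_pow_last hq serreFamily_gen
      one_sub_q_sq nonRoot_q.one_add_sq posCone_posScalars hW a
    have hne : d (a + 1) * c * (d a)⁻¹ ≠ 0 := mul_ne_zero (mul_ne_zero (hd0 _) hc)
      (inv_ne_zero (hd0 _))
    have h1 : ∀ n : ℕ → ℤ,
        mon (colC p) (colX p) (suffix n (2 * p + 1 + 1)) (2 * p + 2) = 1 := by
      intro n
      rw [mon_congr (L := 2 * p + 2) (n := suffix n (2 * p + 1 + 1)) (m := 0)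
        fun s hs => if_pos (by omega)]
      exact mon_zero
    refine ⟨(d (a + 1) * c * (d a)⁻¹) • (α • LinearMap.id + β •
      strip opT p (2 * p) ∘ₗ opT (-1 - p)), fun w hw =>
      Submodule.smul_mem _ _ (Submodule.add_mem _ (Submodule.smul_mem _ _ hw)
        (Submodule.smul_mem _ _ (hW.strip_T_mem _ (hW.T_mem _ _ hw)))),
      fun w hw => eq_zero_of_strip hα hβ ((smul_eq_zero.1 hw).resolve_left hne),
      fun n hn w hw => ?_⟩
    rw [mon_suffix ht, hn, hupd, h1, mul_one, mul_one, show (a : ℤ) + 1 = (a + 1 : ℕ) by simp,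
      dpow_natCast, dpow_natCast, smul_assoc, smul_assoc]
    change strip opE p (2 * p + 1) (d (a + 1) • colX p (2 * p + 1) ^ (a + 1) • w) = d a •
      colX p (2 * p + 1) ^ a • (d (a + 1) * c * (d a)⁻¹) •
        (α • w + β • strip opT p (2 * p) (opT (-1 - p) w))
    rw [map_smul, colX, key w hw,
      smul_comm_field _ (d (a + 1) * c * (d a)⁻¹), scalar_smul_smul, scalar_smul_smul]
    congr 1
    rw [mul_comm (d a), mul_assoc, inv_mul_cancel₀ (hd0 a), mul_one]

/-- The elements of the algebra preserving `wordBox p`. -/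
def boxStab (p : ℕ) : Subalgebra K U where
  carrier := {u | ∀ f ∈ wordBox p, u • f ∈ wordBox p}
  mul_mem' {u v} hu hv f hf := by
    rw [mul_smul]
    exact hu _ (hv _ hf)
  add_mem' {u v} hu hv f hf := by
    rw [add_smul]
    exact Submodule.add_mem _ (hu _ hf) (hv _ hf)
  algebraMap_mem' c f hf := by
    rw [algebraMap_smul]
    exact Submodule.smul_mem _ _ hf

theorem gen_mem_boxStab {p : ℕ} {j : ℤ} (h1 : -p ≤ j) (h2 : j < p) : gen j ∈ boxStab p :=
  fun _ hf => gen_smul_mem_wordBox h1 h2 hf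

theorem segOf_mem_boxStab {p : ℕ} {a : ℤ} {n : ℕ} (h1 : -p ≤ a) (h2 : a + n < p) :
    segOf q gen a n ∈ boxStab p := by
  induction n with
  | zero => exact gen_mem_boxStab h1 (by simpa using h2)
  | succ n ih =>
    have hg : gen (a + n + 1) ∈ boxStab p :=
      gen_mem_boxStab (by omega) (by push_cast at h2; omega)
    have hs := ih (by push_cast at h2; omega)
    exact Subalgebra.sub_mem _ (Subalgebra.mul_mem _ hs hg)
      (Subalgebra.smul_mem _ (Subalgebra.mul_mem _ hg hs) _)

theorem mon_mem_of_forall {A : Subalgebra K U} {C : ℕ → ℤ → K} {X : ℕ → U} {n : ℕ → ℤ} {L : ℕ}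
    (h : ∀ s < L, X s ∈ A) : mon C X n L ∈ A := by
  induction L with
  | zero => exact Subalgebra.one_mem _
  | succ L ih =>
    refine Subalgebra.mul_mem _ (ih fun s hs => h s (by omega)) ?_
    unfold dpow
    split_ifs
    · exact Subalgebra.zero_mem _
    · exact Subalgebra.smul_mem _ (Subalgebra.pow_mem _ (h L (by omega)) _) _

theorem colProd_smul_mem_wordBox (n : ℕ → ℕ → ℤ) (p : ℕ) :
    colProd n p • wordVac ∈ wordBox p := by
  suffices h : ∀ N ≤ p, colProd n N ∈ boxStab p from h p le_rfl _ (wordVac_mem p)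
  intro N hN
  induction N with
  | zero => exact Subalgebra.one_mem _
  | succ N ih =>
    refine Subalgebra.mul_mem _ (mon_mem_of_forall fun s hs => ?_) (ih (by omega))
    exact segOf_mem_boxStab (by omega) (by omega)

/-- The monomials in one column are linearly independent over `wordBox p`. -/
theorem eq_zero_of_sum_mon_suffix {p : ℕ} {ι : Type*} (d : ℕ) : ∀ (t : ℕ), t + d = 2 * p + 2 →
    ∀ (S : Finset ι) (n : ι → ℕ → ℤ) (w : ι → WordFun),
    (∀ i ∈ S, ∀ s, t ≤ s → s < 2 * p + 2 → 0 ≤ n i s) →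
    (∀ i ∈ S, ∀ j ∈ S, (∀ s, t ≤ s → s < 2 * p + 2 → n i s = n j s) → i = j) →
    (∀ i ∈ S, w i ∈ wordBox p) →
    ∑ i ∈ S, mon (colC p) (colX p) (suffix (n i) t) (2 * p + 2) • w i = 0 →
    ∀ i ∈ S, w i = 0 := by
  induction d with
  | zero =>
    intro t ht S n w hn hinj hw hsum i hi
    have hS : S = {i} := Finset.eq_singleton_iff_unique_mem.2
      ⟨hi, fun j hj => hinj j hj i hi fun s h1 h2 => by omega⟩
    rw [hS, Finset.sum_singleton, mon_congr (L := 2 * p + 2) (n := suffix (n i) t) (m := 0)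
      fun s hs => if_pos (by omega), mon_zero, one_smul] at hsum
    exact hsum
  | succ d ihd =>
    intro t ht S n w hn hinj hw hsum
    have htL : t < 2 * p + 2 := by omega
    obtain ⟨b, hb⟩ : ∃ b : ℕ, ∀ i ∈ S, n i t < b := by
      refine ⟨S.sup (fun i => (n i t).toNat + 1), fun i hi => ?_⟩
      have := Finset.le_sup (f := fun i => (n i t).toNat + 1) hi
      beta_reduce at this
      omega
    induction b generalizing S n w with
    | zero =>
      intro i hi
      have := hb i hi
      have := hn i hi t le_rfl htL
      omega
    | succ b ihb =>
      choose R hR1 hR2 hR3 using exists_strip htL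
      have hpos : ∀ i ∈ S, n i t ≠ 0 → w i = 0 := by
        intro i hi hit
        refine hR2 _ _ (ihb (S.filter fun i => n i t ≠ 0)
          (fun i => Function.update (n i) t ((n i t).toNat - 1 : ℕ))
          (fun i => R ((n i t).toNat - 1) (w i)) ?_ ?_ ?_ ?_ ?_ i
          (Finset.mem_filter.2 ⟨hi, hit⟩))
        · intro i hi s hs1 hs2
          by_cases hst : s = t
          · subst hst; rw [Function.update_self]; omega
          · rw [Function.update_of_ne hst]
            exact hn i (Finset.mem_filter.1 hi).1 s hs1 hs2
        · intro i hi j hj h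
          refine hinj i (Finset.mem_filter.1 hi).1 j (Finset.mem_filter.1 hj).1 fun s hs1 hs2 => ?_
          have h' := h s hs1 hs2
          by_cases hst : s = t
          · subst hst
            rw [Function.update_self, Function.update_self] at h'
            have := hn i (Finset.mem_filter.1 hi).1 s le_rfl htL
            have := hn j (Finset.mem_filter.1 hj).1 s le_rfl htL
            have := (Finset.mem_filter.1 hi).2
            have := (Finset.mem_filter.1 hj).2
            omega
          · rwa [Function.update_of_ne hst, Function.update_of_ne hst] at h'
        · exact fun i hi => hR1 _ _ (hw i (Finset.mem_filter.1 hi).1)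
        · have hs := congrArg (strip opE p t) hsum
          rw [map_zero, map_sum] at hs
          rw [Finset.sum_filter]
          refine (Finset.sum_congr rfl fun i hi => ?_).trans hs
          have hit := hn i hi t le_rfl htL
          split_ifs with h
          · exact (hR3 _ (n i) (by omega) _ (hw i hi)).symm
          · push Not at h
            rw [mon_suffix htL, h, dpow_zero, one_mul]
            exact (strip_smul_eq_zero (vacua_wordBox p) (fun r hr => neutral_mon_suffix hr _)
              (hw i hi)).symm
        · intro i hi
          obtain ⟨hi, hit⟩ := Finset.mem_filter.1 hi
          have := hn i hi t le_rfl htL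
          have := hb i hi
          rw [Function.update_self]
          omega
      have hzero := ihd (t + 1) (by omega) (S.filter fun i => n i t = 0) n w
        (fun i hi s hs1 hs2 => hn i (Finset.mem_filter.1 hi).1 s (by omega) hs2)
        (fun i hi j hj h => hinj i (Finset.mem_filter.1 hi).1 j (Finset.mem_filter.1 hj).1
          fun s hs1 hs2 => by
            by_cases hst : s = t
            · rw [hst, (Finset.mem_filter.1 hi).2, (Finset.mem_filter.1 hj).2]
            · exact h s (by omega) hs2)
        (fun i hi => hw i (Finset.mem_filter.1 hi).1) <| by
          rw [Finset.sum_filter]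
          refine (Finset.sum_congr rfl fun i hi => ?_).trans hsum
          split_ifs with h
          · rw [mon_suffix htL, h, dpow_zero, one_mul]
          · rw [hpos i hi h, smul_zero]
      intro i hi
      by_cases h : n i t = 0
      · exact hzero i (Finset.mem_filter.2 ⟨hi, h⟩)
      · exact hpos i hi h

theorem suffix_zero (n : ℕ → ℤ) : suffix n 0 = n :=
  funext fun _ => if_neg (Nat.not_lt_zero _)

/-- The PBW vectors are linearly independent in the module of functions on words. -/
theorem eq_zero_of_sum_colProd {ι : Type*} {N : ℕ} : ∀ (S : Finset ι) (n : ι → ℕ → ℕ → ℤ)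
    (c : ι → K), (∀ i ∈ S, ∀ p < N, ∀ t < 2 * p + 2, 0 ≤ n i p t) →
    (∀ i ∈ S, ∀ j ∈ S, (∀ p < N, ∀ t < 2 * p + 2, n i p t = n j p t) → i = j) →
    ∑ i ∈ S, c i • colProd (n i) N • wordVac = 0 → ∀ i ∈ S, c i = 0 := by
  induction N with
  | zero =>
    intro S n c hn hinj hsum i hi
    have hS : S = {i} := Finset.eq_singleton_iff_unique_mem.2
      ⟨hi, fun j hj => hinj j hj i hi fun p hp => by omega⟩
    rw [hS, Finset.sum_singleton, colProd, one_smul] at hsum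
    have := congrFun hsum ([] : List ℤ)
    change c i * (if ([] : List ℤ) = [] then 1 else 0) = 0 at this
    rwa [if_pos rfl, mul_one] at this
  | succ N ih =>
    intro S n c hn hinj hsum i hi
    set key : ι → ℕ → ℤ := fun i s => if s < 2 * N + 2 then n i N s else 0 with hkey
    have hk : ∀ i, ∀ s < 2 * N + 2, key i s = n i N s := fun i s hs => if_pos hs
    set w : (ℕ → ℤ) → WordFun := fun κ =>
      ∑ i ∈ S.filter (fun i => key i = κ), c i • colProd (n i) N • wordVac with hw
    have hw0 : ∀ κ ∈ S.image key, w κ = 0 := by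
      refine eq_zero_of_sum_mon_suffix (p := N) (2 * N + 2) 0 (Nat.zero_add _) (S.image key) id w ?_ ?_ ?_ ?_
      · intro κ hκ s _ hs
        obtain ⟨j, hj, rfl⟩ := Finset.mem_image.1 hκ
        rw [id, hk j s hs]
        exact hn j hj N (by omega) s hs
      · intro κ hκ κ' hκ' h
        obtain ⟨j, hj, rfl⟩ := Finset.mem_image.1 hκ
        obtain ⟨j', hj', rfl⟩ := Finset.mem_image.1 hκ'
        funext s
        by_cases hs : s < 2 * N + 2
        · exact h s (Nat.zero_le _) hs
        · simp only [hkey, if_neg hs]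
      · exact fun κ _ => Submodule.sum_mem _ fun j _ =>
          Submodule.smul_mem _ _ (colProd_smul_mem_wordBox _ _)
      · rw [← hsum, ← Finset.sum_fiberwise_of_maps_to (t := S.image key)
          (fun j hj => Finset.mem_image_of_mem key hj)]
        refine Finset.sum_congr rfl fun κ _ => ?_
        rw [suffix_zero, hw, Finset.smul_sum]
        refine Finset.sum_congr rfl fun j hj => ?_
        rw [smul_comm_field, colProd, mul_smul, id, ← (Finset.mem_filter.1 hj).2]
        rw [mon_congr (hk j)]
    refine ih (S.filter fun j => key j = key i) n c
      (fun j hj p hp => hn j (Finset.mem_filter.1 hj).1 p (Nat.lt_succ_of_lt hp)) ?_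
      (hw0 (key i) (Finset.mem_image_of_mem key hi)) i (Finset.mem_filter.2 ⟨hi, rfl⟩)
    intro j hj j' hj' h
    refine hinj j (Finset.mem_filter.1 hj).1 j' (Finset.mem_filter.1 hj').1 fun p hp t ht => ?_
    rcases Nat.lt_succ_iff_lt_or_eq.1 hp with h' | rfl
    · exact h p h' t ht
    · rw [← hk j t ht, ← hk j' t ht, (Finset.mem_filter.1 hj).2, (Finset.mem_filter.1 hj').2]

/-- The set `M_θ` of θ-restricted multisegments. -/
abbrev ThetaMS : Type := {m : MS // IsTheta m}

/-- The pairs supporting θ-restricted multisegments. -/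
def pairOf (x : ℕ ×ₗ ℕ) : ℤ × ℤ :=
  (2 * (((ofLex x).1 : ℤ) - (ofLex x).2) + 1, 2 * (ofLex x).1 + 1)

theorem pairOf_toLex (p t : ℕ) : pairOf (toLex (p, t)) = (2 * ((p : ℤ) - t) + 1, 2 * (p : ℤ) + 1) := rfl

theorem pairOf_injective : Function.Injective pairOf := by
  intro x y h
  obtain ⟨p, t⟩ := x
  obtain ⟨p', t'⟩ := y
  have h1 := congrArg Prod.fst h
  have h2 := congrArg Prod.snd h
  change 2 * ((p : ℤ) - t) + 1 = 2 * ((p' : ℤ) - t') + 1 at h1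
  change 2 * (p : ℤ) + 1 = 2 * p' + 1 at h2
  obtain rfl : p = p' := by omega
  obtain rfl : t = t' := by omega
  rfl

theorem IsTheta.exists_pair {m : MS} (hm : IsTheta m) {i j : ℤ} (h : m (i, j) ≠ 0) :
    ∃ p t : ℕ, t < 2 * p + 2 ∧ i = 2 * ((p : ℤ) - t) + 1 ∧ j = 2 * p + 1 := by
  obtain ⟨⟨a, ha⟩, ⟨b, hb⟩, h1, h2, -⟩ := hm i j h
  exact ⟨b.toNat, (b - a).toNat, by omega, by omega, by omega⟩

theorem IsTheta.nonneg {m : MS} (hm : IsTheta m) (x : ℤ × ℤ) : 0 ≤ m x := by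
  by_contra h
  have := (hm x.1 x.2 (by simpa using (by omega : m x ≠ 0))).2.2.2.2
  exact h this.le

theorem IsTheta.eq_of_forall {m n : MS} (hm : IsTheta m) (hn : IsTheta n) {i j : ℤ}
    (h : ∀ p t : ℕ, t < 2 * p + 2 → i = 2 * ((p : ℤ) - t) + 1 → j = 2 * p + 1 →
      n (i, j) = m (i, j)) : n (i, j) = m (i, j) := by
  by_cases h1 : m (i, j) = 0
  · by_cases h2 : n (i, j) = 0
    · rw [h1, h2]
    · obtain ⟨p, t, ht, hi, hj⟩ := hn.exists_pair h2
      exact h p t ht hi hj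
  · obtain ⟨p, t, ht, hi, hj⟩ := hm.exists_pair h1
    exact h p t ht hi hj

theorem CryLt.trans {l m n : MS} (h1 : CryLt n m) (h2 : CryLt m l) : CryLt n l := by
  obtain ⟨i0, j0, h0, hlt, heq, hgt⟩ := h1
  obtain ⟨i1, j1, h0', hlt', heq', hgt'⟩ := h2
  rcases lt_trichotomy j0 j1 with h | h | h
  · exact ⟨i1, j1, h0', by rwa [hgt _ _ h h0'], fun i hi => by
      rw [hgt _ _ h (by omega), heq' i hi], fun i j hj hij => by
      rw [hgt _ _ (by omega) hij, hgt' _ _ hj hij]⟩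
  · subst h
    rcases lt_trichotomy i0 i1 with h | h | h
    · exact ⟨i0, j0, h0, by rwa [← heq' _ h], fun i hi => by
        rw [heq i hi, heq' i (by omega)], fun i j hj hij => by
        rw [hgt _ _ hj hij, hgt' _ _ hj hij]⟩
    · subst h
      exact ⟨i0, j0, h0, hlt.trans hlt', fun i hi => by
        rw [heq i hi, heq' i hi], fun i j hj hij => by
        rw [hgt _ _ hj hij, hgt' _ _ hj hij]⟩
    · exact ⟨i1, j0, h0', by rwa [heq _ h], fun i hi => by
        rw [heq i (by omega), heq' i hi], fun i j hj hij => by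
        rw [hgt _ _ hj hij, hgt' _ _ hj hij]⟩
  · exact ⟨i0, j0, h0, by rwa [← hgt' _ _ h h0], fun i hi => by
      rw [heq i hi, hgt' _ _ h (by omega)], fun i j hj hij => by
      rw [hgt _ _ hj hij, hgt' _ _ (by omega) hij]⟩

/-- The multiplicities of a multisegment, indexed lexicographically. -/
def multiplicities (m : MS) : ℕ ×ₗ ℕ →₀ ℕ :=
  (m.comapDomain pairOf pairOf_injective.injOn).mapRange Int.toNat rfl

theorem multiplicities_apply (m : MS) (x : ℕ ×ₗ ℕ) : multiplicities m x = (m (pairOf x)).toNat := by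
  simp [multiplicities]

theorem cryLt_wellFounded : WellFounded fun n m : ThetaMS => CryLt n.1 m.1 := by
  have hwf : WellFounded (Finsupp.Lex (fun x y : ℕ ×ₗ ℕ => y < x)
      (fun a b : ℕ => a < b)) :=
    Finsupp.Lex.wellFounded' (fun n => Nat.not_lt_zero n) wellFounded_lt
      (wellFounded_lt (α := ℕ ×ₗ ℕ))
  refine Subrelation.wf ?_ (InvImage.wf (fun m : ThetaMS => multiplicities m.1) hwf)
  rintro ⟨n, hn⟩ ⟨m, hm⟩ ⟨i0, j0, h0, hlt, heq, hgt⟩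
  change n (i0, j0) < m (i0, j0) at hlt
  have hn0 := hn.nonneg (i0, j0)
  obtain ⟨p, t, ht, hi, hj⟩ := hm.exists_pair (i := i0) (j := j0) (by omega)
  refine ⟨toLex (p, t), fun x hx => ?_, ?_⟩
  · change multiplicities n x = multiplicities m x
    rw [multiplicities_apply, multiplicities_apply]
    obtain ⟨p', t'⟩ := x
    congr 1
    rcases Prod.Lex.toLex_lt_toLex.1 hx with h | ⟨h, h'⟩
    · exact hgt _ _ (by change p < p' at h; change j0 < 2 * (p' : ℤ) + 1; omega)
        (by change 2 * ((p' : ℤ) - t') + 1 ≤ 2 * (p' : ℤ) + 1; omega)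
    · have h1 : p = p' := h
      have h2 : t < t' := h'
      subst h1
      have := heq (2 * ((p : ℤ) - t') + 1) (by omega)
      rw [hj] at this
      exact this
  · change multiplicities n _ < multiplicities m _
    rw [multiplicities_apply, multiplicities_apply, pairOf_toLex, ← hi, ← hj]
    omega

/-- The coefficientwise lower span consists of smaller PBW vectors. -/
theorem lowSpan_cols_le {m : MS} (hm : IsTheta m) {N : ℕ} (hN : bound m ≤ 2 * N) :
    lowSpan (cols m) N ≤ rspan ⊤ (pbwVec '' {n | IsTheta n ∧ CryLt n m}) := by
  refine rspan_le_rspan le_rfl ?_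
  rintro _ ⟨n', rfl, p, hp, t0, ht0, hlt, heq, hgt⟩
  by_cases hneg : ∃ p < N, ∃ t < 2 * p + 2, n' p t < 0
  · obtain ⟨p', hp', t', ht', h⟩ := hneg
    rw [colProd_of_neg hp' ht' h, zero_smul]
    exact AddSubgroup.zero_mem _
  push Not at hneg
  obtain ⟨n, hn, hnb, hcols⟩ := exists_multisegment n' N hneg
  refine subset_rspan ⟨n, ⟨hn, 2 * ((p : ℤ) - t0) + 1, 2 * p + 1, by omega, ?_, ?_, ?_⟩, ?_⟩
  · have := hcols p hp t0 ht0
    rw [← this] at hlt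
    exact hlt
  · intro i hi
    refine hm.eq_of_forall hn ?_
    intro p' t' ht' hi' hj'
    obtain rfl : p = p' := by omega
    have := hcols p hp t' ht'
    rw [heq t' (by omega)] at this
    rw [hi']
    exact this
  · intro i j hj hij
    refine hm.eq_of_forall hn ?_
    intro p' t' ht' hi' hj'
    by_cases hp' : p' < N
    · have := hcols p' hp' t' ht'
      rw [hgt p' (by omega) hp'] at this
      rw [hi', hj']
      exact this
    · rw [eq_zero_of_bound_lt (by omega), eq_zero_of_bound_lt (by omega)]
  · rw [pbwVec, Ptheta_eq_colProd hn hnb, colProd_congr hcols]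

theorem pbwVec_linearIndependent : LinearIndependent K fun m : ThetaMS => pbwVec m.1 := by
  rw [linearIndependent_iff']
  intro S c hsum
  set N := S.sup fun m => bound m.1 with hN
  have hb : ∀ m ∈ S, bound m.1 ≤ 2 * N := fun m hm => by
    have := Finset.le_sup (f := fun m : ThetaMS => bound m.1) hm
    change bound m.1 ≤ N at this
    omega
  refine eq_zero_of_sum_colProd (N := N) S (fun m => cols m.1) c
    (fun m _ p _ t _ => m.2.nonneg _) ?_ ?_
  · intro m hm n hn h
    refine Subtype.ext (Finsupp.ext fun ⟨i, j⟩ => n.2.eq_of_forall m.2 ?_)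
    intro p t ht hi hj
    by_cases hp : p < N
    · rw [hi, hj]
      exact h p hp t ht
    · have h1 := hb m hm
      have h2 := hb n hn
      rw [eq_zero_of_bound_lt (by omega), eq_zero_of_bound_lt (by omega)]
  · have := congrArg toWord hsum
    rw [map_zero, map_sum] at this
    refine (Finset.sum_congr rfl fun m hm => ?_).trans this
    rw [pbwVec, ← algebraMap_smul U (c m) (Ptheta m.1 • vac), map_smul, toWord_smul_vac,
      algebraMap_smul, Ptheta_eq_colProd m.2 (hb m hm)]

theorem exists_mem_pbwSpan (v : ThetaMod) : ∃ N, v ∈ pbwSpan ⊤ N := by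
  obtain ⟨u, rfl⟩ : ∃ u : U, v = u • vac :=
    ⟨_, (Submodule.Quotient.mk_surjective Jideal v).choose_spec.symm.trans (smul_phi _).symm⟩
  obtain ⟨x, rfl⟩ := RingQuot.mkAlgHom_surjective K URel u
  suffices h : ∀ N, ∀ v ∈ pbwSpan ⊤ N, ∃ N', RingQuot.mkAlgHom K URel x • v ∈ pbwSpan ⊤ N' from
    h 0 vac vac_mem_pbwSpan
  induction x using FreeAlgebra.induction with
  | grade0 c =>
    intro N v hv
    rw [AlgHom.commutes, algebraMap_smul]
    exact ⟨N, coeff_smul_mem_pbwSpan c hv⟩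
  | grade1 a =>
    intro N v hv
    refine ⟨max N (a.natAbs + 1), ?_⟩
    exact gen_smul_mem_pbwSpan (by omega) (by omega) (pbwSpan_mono (le_max_left _ _) hv)
  | mul x y hx hy =>
    intro N v hv
    obtain ⟨N', h⟩ := hy N v hv
    obtain ⟨N'', h'⟩ := hx N' _ h
    exact ⟨N'', by rwa [map_mul, mul_smul]⟩
  | add x y hx hy =>
    intro N v hv
    obtain ⟨N', h⟩ := hx N v hv
    obtain ⟨N'', h'⟩ := hy N v hv
    refine ⟨max N' N'', ?_⟩
    rw [map_add, add_smul]
    exact AddSubgroup.add_mem _ (pbwSpan_mono (le_max_left _ _) h)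
      (pbwSpan_mono (le_max_right _ _) h')

theorem rspan_le_span {M : Type*} [AddCommGroup M] [Module K M] {R : Subring K} {S : Set M} {v : M}
    (hv : v ∈ rspan R S) : v ∈ Submodule.span K S :=
  rspan_induction (p := fun v => v ∈ Submodule.span K S) (fun _ h => Submodule.subset_span h)
    (Submodule.zero_mem _) (fun _ _ => Submodule.add_mem _)
    (fun c _ _ => Submodule.smul_mem _ c) hv

/-- The PBW basis of `Ṽ_θ(0)`. -/
def pbwBasis : Module.Basis ThetaMS K ThetaMod :=
  Module.Basis.mk pbwVec_linearIndependent fun v _ => by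
    refine Submodule.span_mono ?_ (rspan_le_span (mem_rspan_pbwVec_iff.2 (exists_mem_pbwSpan v)))
    rintro _ ⟨m, hm, rfl⟩
    exact ⟨⟨m, hm⟩, rfl⟩

theorem pbwBasis_apply (m : ThetaMS) : pbwBasis m = pbwVec m.1 := by
  simp [pbwBasis]

/-- The additive group `qℚ[q]`. -/
def qPoly : AddSubgroup K where
  carrier := {x | ∃ p : Polynomial ℚ, x = q * Polynomial.aeval q p}
  zero_mem' := ⟨0, by simp⟩
  add_mem' := by
    rintro _ _ ⟨f, rfl⟩ ⟨g, rfl⟩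
    exact ⟨f + g, by rw [map_add, mul_add]⟩
  neg_mem' := by
    rintro _ ⟨f, rfl⟩
    exact ⟨-f, by rw [map_neg, mul_neg]⟩

theorem algebraMap_polynomial (f : Polynomial ℚ) :
    algebraMap (Polynomial ℚ) K f = Polynomial.aeval q f := by
  rw [algebraMap_eq_eval₂, Polynomial.aeval_def]

theorem mem_qPoly_iff {x : K} :
    x ∈ qPoly ↔ ∃ p : Polynomial ℚ, x = algebraMap (Polynomial ℚ) K (Polynomial.X * p) := by
  refine exists_congr fun p => ?_
  rw [map_mul, RatFunc.algebraMap_X, algebraMap_polynomial]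
  rfl

theorem mul_mem_qPoly {x y : K} (hx : x ∈ qPoly) (hy : y ∈ qPoly) : x * y ∈ qPoly := by
  rw [mem_qPoly_iff] at *
  obtain ⟨f, rfl⟩ := hx
  obtain ⟨g, rfl⟩ := hy
  exact ⟨f * (Polynomial.X * g), by rw [← map_mul, mul_assoc]⟩

theorem rat_mul_mem_qPoly (r : ℚ) {x : K} (hx : x ∈ qPoly) : algebraMap ℚ K r * x ∈ qPoly := by
  rw [mem_qPoly_iff] at *
  obtain ⟨f, rfl⟩ := hx
  refine ⟨Polynomial.C r * f, ?_⟩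
  rw [mul_left_comm, map_mul _ (Polynomial.C r), algebraMap_polynomial (Polynomial.C r),
    Polynomial.aeval_C]

theorem zpow_mem_qPoly {n : ℤ} (hn : 0 < n) : q ^ n ∈ qPoly := by
  rw [mem_qPoly_iff]
  refine ⟨Polynomial.X ^ (n.toNat - 1), ?_⟩
  rw [← pow_succ', algebraMap_X_pow, ← zpow_natCast]
  congr 1
  omega

theorem qPoly_le_Lring {x : K} (hx : x ∈ qPoly) : x ∈ Lring := by
  obtain ⟨p, rfl⟩ := hx
  exact Lring.mul_mem q_mem_Lring ⟨_, levalHom_polynomial p⟩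

/-- Antisymmetrizations of Laurent polynomials are antisymmetrizations of elements of `qℚ[q]`. -/
theorem exists_qPoly_sub_sigma {a : K} (ha : a ∈ Lring) :
    ∃ p ∈ qPoly, a - sigma a = p - sigma p := by
  obtain ⟨x, rfl⟩ := ha
  induction x using LaurentPolynomial.induction_on' with
  | add x y hx hy =>
    obtain ⟨p, hp, h⟩ := hx
    obtain ⟨p', hp', h'⟩ := hy
    refine ⟨p + p', qPoly.add_mem hp hp', ?_⟩
    rw [map_add, map_add, map_add, add_sub_add_comm, h, h', add_sub_add_comm]
  | C_mul_T n r =>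
    rw [map_mul, levalHom_C, levalHom_T]
    rcases lt_trichotomy n 0 with hn | rfl | hn
    · refine ⟨-(algebraMap ℚ K r * q ^ (-n)),
        qPoly.neg_mem (rat_mul_mem_qPoly r (zpow_mem_qPoly (by omega))), ?_⟩
      rw [map_neg, map_mul, map_mul, sigma_rat, map_zpow₀, map_zpow₀, sigma_q, inv_zpow', inv_zpow',
        neg_neg]
      ring
    · exact ⟨0, qPoly.zero_mem, by simp⟩
    · exact ⟨_, rat_mul_mem_qPoly r (zpow_mem_qPoly hn), rfl⟩

theorem eq_zero_of_sigma_eq {x : K} (hx : x ∈ qPoly) (h : sigma x = x) : x = 0 := by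
  obtain ⟨f, rfl⟩ := mem_qPoly_iff.1 hx
  have hq := nonRoot_q.ne_zero
  set g := Polynomial.X * f with hg
  rw [sigma_polynomial] at h
  have key : algebraMap (Polynomial ℚ) K g.reverse =
      algebraMap (Polynomial ℚ) K (Polynomial.X ^ g.natDegree * g) := by
    rw [map_mul, algebraMap_X_pow, ← h, algebraMap_eq_eval₂]
    let _ : Invertible q⁻¹ := ⟨q, mul_inv_cancel₀ hq, inv_mul_cancel₀ hq⟩
    have := Polynomial.eval₂_reverse_mul_pow (algebraMap ℚ K) q⁻¹ g
    rw [← this]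
    change _ = q ^ g.natDegree * (Polynomial.eval₂ (algebraMap ℚ K) q g.reverse * (q⁻¹) ^ _)
    rw [mul_left_comm, ← mul_pow, mul_inv_cancel₀ hq, one_pow, mul_one]
  have key' := RatFunc.algebraMap_injective ℚ key
  by_contra hne
  have hg0 : g ≠ 0 := fun h0 => hne (by rw [h0, map_zero])
  have hf0 : f ≠ 0 := fun h0 => hg0 (by rw [hg, h0, mul_zero])
  have h1 := Polynomial.natDegree_X_mul hf0
  rw [← hg] at h1
  have h2 := congrArg Polynomial.natDegree key'
  rw [Polynomial.natDegree_X_pow_mul _ hg0] at h2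
  have h3 := Polynomial.reverse_natDegree_le g
  omega

/-- The local ring `A_0`. -/
def azeroRing : Subring K where
  carrier := Azero
  zero_mem' := by change Polynomial.eval 0 (RatFunc.denom 0) ≠ 0; simp
  one_mem' := by change Polynomial.eval 0 (RatFunc.denom 1) ≠ 0; simp
  neg_mem' := by
    intro x hx
    have := RatFunc.denom_mul_dvd (-1 : K) x
    change Polynomial.eval 0 (RatFunc.denom (-x)) ≠ 0
    rw [neg_one_mul] at this
    have h1 : RatFunc.denom (-1 : K) = 1 := by
      have := RatFunc.denom_algebraMap (-1 : Polynomial ℚ)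
      rwa [map_neg, map_one] at this
    rw [h1, one_mul] at this
    intro h0
    exact hx (Polynomial.eval_eq_zero_of_dvd_of_eval_eq_zero this h0)
  add_mem' := by
    intro x y hx hy h0
    have := Polynomial.eval_eq_zero_of_dvd_of_eval_eq_zero (RatFunc.denom_add_dvd x y) h0
    rw [Polynomial.eval_mul] at this
    exact (mul_ne_zero hx hy) this
  mul_mem' := by
    intro x y hx hy h0
    have := Polynomial.eval_eq_zero_of_dvd_of_eval_eq_zero (RatFunc.denom_mul_dvd x y) h0
    rw [Polynomial.eval_mul] at this
    exact (mul_ne_zero hx hy) this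

theorem polynomial_mem_azeroRing (f : Polynomial ℚ) :
    algebraMap (Polynomial ℚ) K f ∈ azeroRing := by
  change Polynomial.eval 0 (RatFunc.denom _) ≠ 0
  rw [RatFunc.denom_algebraMap]
  simp

theorem exists_azero_of_mem_qPoly {x : K} (hx : x ∈ qPoly) : ∃ y ∈ azeroRing, x = q * y := by
  obtain ⟨f, rfl⟩ := hx
  exact ⟨_, algebraMap_polynomial f ▸ polynomial_mem_azeroRing f, rfl⟩

theorem qPoly_le_azeroRing {x : K} (hx : x ∈ qPoly) : x ∈ azeroRing := by
  obtain ⟨f, rfl⟩ := mem_qPoly_iff.1 hx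
  exact polynomial_mem_azeroRing _

theorem mem_qPoly_of_mem {x y : K} (hx : x ∈ Lring) (hy : y ∈ azeroRing) (h : x = q * y) :
    x ∈ qPoly := by
  obtain ⟨f, n, hf⟩ := (mem_Lring_iff x).1 hx
  have hq := nonRoot_q.ne_zero
  have hd : algebraMap (Polynomial ℚ) K y.denom ≠ 0 :=
    RatFunc.algebraMap_ne_zero y.denom_ne_zero
  have hy' := (div_eq_iff hd).1 (RatFunc.num_div_denom y)
  have e : algebraMap (Polynomial ℚ) K (f * y.denom) =
      algebraMap (Polynomial ℚ) K (Polynomial.X ^ (n + 1) * y.num) := by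
    rw [map_mul, map_mul, algebraMap_X_pow, hy', pow_succ,
      ← mul_assoc, mul_assoc (q ^ n), ← h, hf, algebraMap_polynomial f, ← mul_assoc, zpow_neg,
      zpow_natCast, mul_inv_cancel₀ (pow_ne_zero _ hq), one_mul]
  have e' := RatFunc.algebraMap_injective ℚ e
  have hcop : IsCoprime (Polynomial.X ^ (n + 1)) y.denom := by
    refine IsCoprime.pow_left ((Polynomial.prime_X.coprime_iff_not_dvd).2 fun hX => hy ?_)
    rwa [← Polynomial.coeff_zero_eq_eval_zero, ← Polynomial.X_dvd_iff]
  obtain ⟨g, rfl⟩ := hcop.dvd_of_dvd_mul_right (Dvd.intro _ e'.symm)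
  refine ⟨g, ?_⟩
  rw [hf, map_mul, map_pow, Polynomial.aeval_X, pow_succ, ← mul_assoc, ← mul_assoc, zpow_neg,
    zpow_natCast, inv_mul_cancel₀ (pow_ne_zero _ hq), one_mul]

section Triangular

variable {ι V : Type*} [AddCommGroup V] [Module K V] {b : Module.Basis ι K V} {r : ι → ι → Prop}

/-- The elements below `m` with coefficients in `qℚ[q]`. -/
def lowerPart (b : Module.Basis ι K V) (r : ι → ι → Prop) (m : ι) : AddSubgroup V where
  carrier := {v | ∀ n, b.repr v n ∈ qPoly ∧ (b.repr v n ≠ 0 → r n m)}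
  zero_mem' n := by simp [qPoly.zero_mem]
  add_mem' {v w} hv hw n := by
    rw [map_add, Finsupp.add_apply]
    refine ⟨qPoly.add_mem (hv n).1 (hw n).1, fun h => ?_⟩
    by_cases h0 : b.repr v n = 0
    · exact (hw n).2 fun h1 => h (by rw [h0, h1, add_zero])
    · exact (hv n).2 h0
  neg_mem' {v} hv n := by
    rw [map_neg, Finsupp.neg_apply]
    exact ⟨qPoly.neg_mem (hv n).1, fun h => (hv n).2 (neg_ne_zero.1 h)⟩

theorem mem_of_repr_smul_mem {H : AddSubgroup V} {v : V}
    (h : ∀ n, b.repr v n ≠ 0 → b.repr v n • b n ∈ H) : v ∈ H := by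
  rw [← b.linearCombination_repr v, Finsupp.linearCombination_apply]
  exact AddSubgroup.sum_mem _ fun n hn => h n (Finsupp.mem_support_iff.1 hn)

theorem smul_mem_lowerPart (htr : ∀ {l m n}, r n m → r m l → r n l) {a : K} (ha : a ∈ qPoly)
    {m n : ι} (h : r n m) {g : V} (hg : g - b n ∈ lowerPart b r n) :
    a • g ∈ lowerPart b r m := by
  have e : a • g = a • b n + a • (g - b n) := by rw [← smul_add, add_sub_cancel]
  rw [e]
  refine AddSubgroup.add_mem _ (fun k => ?_) fun k => ?_
  · rw [map_smul, b.repr_self, Finsupp.smul_apply, Finsupp.single_apply, smul_eq_mul]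
    split_ifs with hk
    · subst hk
      exact ⟨by rwa [mul_one], fun _ => h⟩
    · simp [qPoly.zero_mem]
  · rw [map_smul, Finsupp.smul_apply, smul_eq_mul]
    exact ⟨mul_mem_qPoly ha (hg k).1, fun hk => htr ((hg k).2 (right_ne_zero_of_mul hk)) h⟩

theorem exists_maximal_of_wellFounded (hwf : WellFounded r)
    (htr : ∀ {l m n}, r n m → r m l → r n l) {S : Finset ι} (hS : S.Nonempty) :
    ∃ m ∈ S, ∀ n ∈ S, ¬r m n := by
  induction hS using Finset.Nonempty.cons_induction with
  | singleton a => exact ⟨a, Finset.mem_singleton_self a, fun n hn h => by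
      rw [Finset.mem_singleton.1 hn] at h
      exact hwf.irrefl.irrefl _ h⟩
  | cons a S ha hS ih =>
    obtain ⟨m, hm, hmax⟩ := ih
    by_cases h : r m a
    · refine ⟨a, Finset.mem_cons_self _ _, fun n hn han => ?_⟩
      rcases Finset.mem_cons.1 hn with rfl | hn
      · exact hwf.irrefl.irrefl _ han
      · exact hmax n hn (htr h han)
    · refine ⟨m, Finset.mem_cons_of_mem hm, fun n hn hmn => ?_⟩
      rcases Finset.mem_cons.1 hn with rfl | hn
      · exact h hmn
      · exact hmax n hn hmn

theorem repr_sum_of_maximal {h : ι → V}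
    (hh : ∀ n k, b.repr (h n - b n) k ≠ 0 → r k n) {S : Finset ι} (d : ι → K) {m : ι} (hm : m ∈ S)
    (hmax : ∀ n ∈ S, ¬r m n) : b.repr (∑ n ∈ S, d n • h n) m = d m := by
  have hr : ∀ n ∈ S, b.repr (h n) m = if n = m then 1 else 0 := by
    intro n hn
    have h1 : b.repr (h n - b n) m = 0 := by
      by_contra hc
      exact hmax n hn (hh n m hc)
    rw [map_sub, Finsupp.sub_apply, sub_eq_zero] at h1
    rw [h1, b.repr_self, Finsupp.single_apply]
  rw [map_sum, Finsupp.finsetSum_apply]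
  rw [Finset.sum_congr rfl fun n hn => by
    rw [map_smul, Finsupp.smul_apply, hr n hn, smul_eq_mul, mul_ite, mul_one, mul_zero]]
  rw [Finset.sum_ite_eq', if_pos hm]

section Bar

variable {barV : V →+ V} (hsmul : ∀ (c : K) (v : V), barV (c • v) = sigma c • barV v)
include hsmul

/-- The Kazhdan–Lusztig construction of a bar-invariant basis. -/
theorem exists_canonical (hwf : WellFounded r) (htr : ∀ {l m n}, r n m → r m l → r n l)
    (hinv : ∀ v, barV (barV v) = v) (hint : ∀ m n, b.repr (barV (b m)) n ∈ Lring)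
    (hlow : ∀ m n, b.repr (barV (b m) - b m) n ≠ 0 → r n m) (m : ι) :
    ∃ g, barV g = g ∧ g - b m ∈ lowerPart b r m := by
  induction m using hwf.induction with
  | _ m ih =>
  let Z : AddSubgroup V :=
    { carrier := {v | ∃ p ∈ lowerPart b r m, v - barV v = p - barV p}
      zero_mem' := ⟨0, AddSubgroup.zero_mem _, rfl⟩
      add_mem' := by
        rintro v w ⟨p, hp, h⟩ ⟨p', hp', h'⟩
        exact ⟨p + p', AddSubgroup.add_mem _ hp hp', by
          rw [map_add, map_add, add_sub_add_comm, h, h', add_sub_add_comm]⟩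
      neg_mem' := by
        rintro v ⟨p, hp, h⟩
        exact ⟨-p, AddSubgroup.neg_mem _ hp, by
          rw [map_neg, map_neg, neg_sub_neg, neg_sub_neg, ← neg_sub, h, neg_sub]⟩ }
  have hZ : ∀ n, r n m → ∀ a ∈ Lring, a • b n ∈ Z := by
    intro n
    induction n using hwf.induction with
    | _ n ihn =>
    intro hn a ha
    obtain ⟨g, hg, hgb⟩ := ih n hn
    have e : a • b n = a • g - a • (g - b n) := by rw [← smul_sub, sub_sub_cancel]
    rw [e]
    refine AddSubgroup.sub_mem _ ?_ (mem_of_repr_smul_mem (b := b) fun k hk => ?_)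
    · obtain ⟨p, hp, hap⟩ := exists_qPoly_sub_sigma ha
      refine ⟨p • g, smul_mem_lowerPart (b := b) (r := r) htr hp hn hgb, ?_⟩
      rw [hsmul, hsmul, hg, ← sub_smul, ← sub_smul, hap]
    · rw [map_smul, Finsupp.smul_apply, smul_eq_mul] at hk ⊢
      have hkn := (hgb k).2 (right_ne_zero_of_mul hk)
      exact ihn k hkn (htr hkn hn) _ (Lring.mul_mem ha (qPoly_le_Lring (hgb k).1))
  have hmem : barV (b m) - b m ∈ Z := by
    refine mem_of_repr_smul_mem (b := b) fun n hn => hZ n (hlow m n hn) _ ?_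
    rw [map_sub, Finsupp.sub_apply, b.repr_self, Finsupp.single_apply]
    refine Lring.sub_mem (hint m n) ?_
    split_ifs
    exacts [Lring.one_mem, Lring.zero_mem]
  obtain ⟨p, hp, h⟩ := hmem
  rw [map_sub, hinv, ← neg_sub (barV (b m)), sub_neg_eq_add, ← two_smul K] at h
  have h2 : (2 : K) ≠ 0 := two_ne_zero
  have h' : barV (b m) - b m = (2 : K)⁻¹ • p - (2 : K)⁻¹ • barV p := by
    rw [← smul_sub, ← h, smul_smul, inv_mul_cancel₀ h2, one_smul]
  refine ⟨b m + (2 : K)⁻¹ • p, ?_, ?_⟩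
  · rw [map_add, hsmul, map_inv₀, map_ofNat, ← sub_eq_zero, add_sub_add_comm, h']
    abel
  · rw [add_sub_cancel_left]
    intro n
    rw [map_smul, Finsupp.smul_apply, smul_eq_mul]
    have h3 : (2 : K)⁻¹ = algebraMap ℚ K 2⁻¹ := by rw [map_inv₀, map_ofNat]
    exact ⟨h3 ▸ rat_mul_mem_qPoly _ (hp n).1, fun hn => (hp n).2 (right_ne_zero_of_mul hn)⟩

theorem eq_zero_of_bar_eq (hwf : WellFounded r) (htr : ∀ {l m n}, r n m → r m l → r n l)
    (hlow : ∀ m n, b.repr (barV (b m) - b m) n ≠ 0 → r n m) {v : V} (hv : barV v = v)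
    (hq : ∀ n, b.repr v n ∈ qPoly) : v = 0 := by
  by_contra hne
  have hS : (b.repr v).support.Nonempty := by
    rw [Finsupp.support_nonempty_iff]
    exact fun h => hne (b.repr.map_eq_zero_iff.1 h)
  obtain ⟨m, hm, hmax⟩ := exists_maximal_of_wellFounded hwf htr hS
  have e : v = ∑ n ∈ (b.repr v).support, sigma (b.repr v n) • barV (b n) := by
    conv_lhs => rw [← hv, ← b.linearCombination_repr v, Finsupp.linearCombination_apply,
      Finsupp.sum, map_sum]
    exact Finset.sum_congr rfl fun n _ => hsmul _ _
  have h1 := congrArg (fun v => b.repr v m) e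
  beta_reduce at h1
  rw [repr_sum_of_maximal hlow _ hm hmax] at h1
  exact Finsupp.mem_support_iff.1 hm (eq_zero_of_sigma_eq (hq m) h1.symm)

end Bar

variable {g : ι → V} (hg : ∀ m, g m - b m ∈ lowerPart b r m)
include hg

theorem linearIndependent_of_lowerPart (hwf : WellFounded r)
    (htr : ∀ {l m n}, r n m → r m l → r n l) : LinearIndependent K g := by
  rw [linearIndependent_iff]
  intro c hc
  by_contra hne
  obtain ⟨m, hm, hmax⟩ := exists_maximal_of_wellFounded hwf htr (Finsupp.support_nonempty_iff.2 hne)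
  have := repr_sum_of_maximal (b := b) (h := g) (fun n k => (hg n k).2) c hm hmax
  rw [Finsupp.linearCombination_apply, Finsupp.sum] at hc
  rw [hc, map_zero, Finsupp.zero_apply] at this
  exact Finsupp.mem_support_iff.1 hm this.symm

/-- The coefficient conditions with respect to unitriangular bases agree. -/
theorem repr_mem_iff (hwf : WellFounded r) {R : Subring K} (hR : ∀ x ∈ qPoly, x ∈ R) {v : V} :
    (∀ n, b.repr v n ∈ R) ↔
      ∃ c : ι →₀ K, (∀ m, c m ∈ R) ∧ v = c.sum fun m a => a • g m := by
  let C : AddSubgroup (ι →₀ K) :=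
    { carrier := {c | ∀ m, c m ∈ R}
      zero_mem' := fun _ => R.zero_mem
      add_mem' := fun h h' m => R.add_mem (h m) (h' m)
      neg_mem' := fun h m => R.neg_mem (h m) }
  constructor
  · intro hv
    have hH : ∀ n, ∀ a ∈ R, a • b n ∈ C.map (Finsupp.linearCombination K g).toAddMonoidHom := by
      intro n
      induction n using hwf.induction with
      | _ n ih =>
      intro a ha
      have e : a • b n = a • g n - a • (g n - b n) := by rw [← smul_sub, sub_sub_cancel]
      rw [e]
      refine AddSubgroup.sub_mem _ ⟨Finsupp.single n a, fun m => ?_, ?_⟩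
        (mem_of_repr_smul_mem (b := b) fun k hk => ?_)
      · rw [Finsupp.single_apply]
        split_ifs
        exacts [ha, R.zero_mem]
      · exact Finsupp.linearCombination_single K a n
      · rw [map_smul, Finsupp.smul_apply, smul_eq_mul] at hk ⊢
        exact ih k ((hg n k).2 (right_ne_zero_of_mul hk)) _ (R.mul_mem ha (hR _ (hg n k).1))
    obtain ⟨c, hc, h⟩ : v ∈ C.map (Finsupp.linearCombination K g).toAddMonoidHom :=
      mem_of_repr_smul_mem (b := b) fun n _ => hH n _ (hv n)
    exact ⟨c, hc, h.symm⟩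
  · rintro ⟨c, hc, rfl⟩ n
    rw [Finsupp.sum, map_sum, Finsupp.finsetSum_apply]
    refine R.sum_mem fun m _ => ?_
    rw [map_smul, Finsupp.smul_apply, smul_eq_mul]
    refine R.mul_mem (hc m) ?_
    rw [← sub_add_cancel (g m) (b m), map_add, Finsupp.add_apply, b.repr_self,
      Finsupp.single_apply]
    refine R.add_mem (hR _ (hg m n).1) ?_
    split_ifs
    exacts [R.one_mem, R.zero_mem]

end Triangular

theorem sigma_mem_Lring {x : K} (hx : x ∈ Lring) : sigma x ∈ Lring := by
  obtain ⟨y, rfl⟩ := hx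
  induction y using LaurentPolynomial.induction_on' with
  | add x y hx hy =>
    rw [map_add, map_add]
    exact Lring.add_mem hx hy
  | C_mul_T n r =>
    rw [map_mul, levalHom_C, levalHom_T, map_mul, sigma_rat, map_zpow₀, sigma_q, inv_zpow']
    exact Lring.mul_mem ⟨_, levalHom_C r⟩ (zpow_mem_Lring _)

theorem sigma_qfact (n : ℕ) : sigma (qfact n) = qfact n := by
  rw [qfact, map_prod]
  exact Finset.prod_congr rfl fun _ _ => sigma_qnum _

namespace IsBar
variable {bar : U →+* U} {barV : ThetaMod →+ ThetaMod} (H : IsBar bar barV)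
include H

theorem bar_bar (u : U) : bar (bar u) = u := by
  obtain ⟨x, rfl⟩ := RingQuot.mkAlgHom_surjective K URel u
  induction x using FreeAlgebra.induction with
  | grade0 c => rw [AlgHom.commutes, H.coeff, H.coeff, sigma_sigma]
  | grade1 a => exact (congrArg bar (H.gen a)).trans (H.gen a)
  | mul x y hx hy => rw [map_mul, map_mul, map_mul, hx, hy]
  | add x y hx hy => rw [map_add, map_add, map_add, hx, hy]

theorem barV_barV (v : ThetaMod) : barV (barV v) = v := by
  obtain ⟨u, rfl⟩ : ∃ u : U, v = u • _root_.vac :=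
    ⟨_, (Submodule.Quotient.mk_surjective Jideal v).choose_spec.symm.trans (smul_phi _).symm⟩
  rw [H.smul, H.vac, H.smul, H.vac, H.bar_bar]

theorem bar_mem_UA {u : U} (hu : u ∈ UA) : bar u ∈ UA := by
  suffices h : UA ≤ UA.comap bar from h hu
  refine Subring.closure_le.2 ?_
  rintro _ (⟨c, hc, rfl⟩ | ⟨i, n, ⟨a, rfl⟩, rfl⟩)
  · refine Subring.subset_closure (Or.inl ⟨sigma c, ?_, H.coeff c⟩)
    exact (mem_Lring_iff _).1 (sigma_mem_Lring ((mem_Lring_iff _).2 hc))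
  · refine Subring.subset_closure (Or.inr ⟨2 * a + 1, n, ⟨a, rfl⟩, ?_⟩)
    rw [H.map_smul, map_inv₀, sigma_qfact, map_pow, fgen_odd, H.gen]

theorem barV_mem_VA {v : ThetaMod} (hv : (show Vt from v) ∈ VA) : (show Vt from barV v) ∈ VA := by
  obtain ⟨u, hu, h⟩ := hv
  refine ⟨bar u, H.bar_mem_UA hu, ?_⟩
  have h' : v = u • _root_.vac := h
  rw [h', H.smul, H.vac]
  rfl

end IsBar

theorem repr_pbwVec (m : ThetaMS) : pbwBasis.repr (pbwVec m.1) = Finsupp.single m 1 := by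
  rw [← pbwBasis_apply, pbwBasis.repr_self]

theorem mem_rspan_iff_repr {R : Subring K} {v : ThetaMod} :
    v ∈ rspan R (pbwVec '' {m | IsTheta m}) ↔ ∀ n, pbwBasis.repr v n ∈ R := by
  constructor
  · intro hv
    refine rspan_induction (p := fun v => ∀ n, pbwBasis.repr v n ∈ R) ?_ ?_ ?_ ?_ hv
    · rintro _ ⟨m, hm, rfl⟩ n
      rw [repr_pbwVec ⟨m, hm⟩, Finsupp.single_apply]
      split_ifs
      exacts [R.one_mem, R.zero_mem]
    · intro n
      rw [map_zero]
      exact R.zero_mem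
    · intro v w hv hw n
      rw [map_add]
      exact R.add_mem (hv n) (hw n)
    · intro c hc v hv n
      rw [map_smul]
      exact R.mul_mem hc (hv n)
  · intro h
    refine mem_of_repr_smul_mem (b := pbwBasis) fun n _ => smul_mem_rspan (h n) (subset_rspan ?_)
    exact ⟨n.1, n.2, (pbwBasis_apply n).symm⟩

theorem mem_VA_iff_repr {v : ThetaMod} :
    (show Vt from v) ∈ VA ↔ ∀ n, pbwBasis.repr v n ∈ Lring := by
  rw [mem_VA_iff, ← mem_rspan_pbwVec_iff, mem_rspan_iff_repr]

theorem IsBar.repr_barV_mem {bar : U →+* U} {barV : ThetaMod →+ ThetaMod} (H : IsBar bar barV)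
    (m n : ThetaMS) : pbwBasis.repr (barV (pbwBasis m)) n ∈ Lring := by
  refine mem_VA_iff_repr.1 (H.barV_mem_VA (mem_VA_iff_repr.2 fun k => ?_)) n
  rw [pbwBasis.repr_self, Finsupp.single_apply]
  split_ifs
  exacts [Lring.one_mem, Lring.zero_mem]

theorem IsBar.cryLt_of_repr_ne_zero {bar : U →+* U} {barV : ThetaMod →+ ThetaMod}
    (H : IsBar bar barV) (m n : ThetaMS)
    (h : pbwBasis.repr (barV (pbwBasis m) - pbwBasis m) n ≠ 0) : CryLt n.1 m.1 := by
  have hN : bound m.1 ≤ 2 * bound m.1 := by omega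
  have hmem := lowSpan_cols_le m.2 hN (H.sub_colProd_mem (cols m.1) (bound m.1))
  rw [← Ptheta_eq_colProd m.2 hN] at hmem
  have e : barV (pbwBasis m) - pbwBasis m = (bar (Ptheta m.1) - Ptheta m.1) • _root_.vac := by
    rw [pbwBasis_apply, pbwVec, H.smul, H.vac, sub_smul]
  rw [← e] at hmem
  revert h
  refine rspan_induction (p := fun v => pbwBasis.repr v n ≠ 0 → CryLt n.1 m.1) ?_ ?_ ?_ ?_ hmem
  · rintro _ ⟨k, ⟨hk, hlt⟩, rfl⟩ hne
    rw [repr_pbwVec ⟨k, hk⟩, Finsupp.single_apply] at hne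
    have := (ite_ne_right_iff.1 hne).1
    rwa [← this]
  · intro hne
    exact absurd (by rw [map_zero]; rfl) hne
  · intro v w hv hw hne
    by_cases h0 : pbwBasis.repr v n = 0
    · exact hw fun h1 => hne (by rw [map_add, Finsupp.add_apply, h0, h1, add_zero])
    · exact hv h0
  · intro c _ v hv hne
    rw [_root_.map_smul, Finsupp.smul_apply, smul_eq_mul] at hne
    exact hv (right_ne_zero_of_mul hne)

/-- Finite expansions over `M_θ` may be written as finite expansions over all multisegments. -/
theorem exists_supported_iff {V : Type*} [AddCommGroup V] [Module K V] {S : Set K}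
    (h0 : (0 : K) ∈ S) {F : MS → V} {v : V} {p : MS → Prop} (hp : ∀ m, p m → IsTheta m) :
    (∃ c : MS →₀ K, (∀ m ∈ c.support, p m) ∧ (∀ m, c m ∈ S) ∧ v = c.sum fun m a => a • F m) ↔
      ∃ c : ThetaMS →₀ K, (∀ m ∈ c.support, p m.1) ∧ (∀ m, c m ∈ S) ∧
        v = c.sum fun m a => a • F m.1 := by
  constructor
  · rintro ⟨c, hc, hS, rfl⟩
    refine ⟨c.subtypeDomain IsTheta, fun m hm => ?_, fun m => hS m.1, ?_⟩
    · exact hc m.1 (by simpa using hm)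
    · rw [Finsupp.sum_subtypeDomain_index (h := fun m a => a • F m) fun m hm => hp m (hc m hm)]
  · rintro ⟨c, hc, hS, rfl⟩
    refine ⟨c.embDomain (Function.Embedding.subtype _), fun m hm => ?_, fun m => ?_, ?_⟩
    · rw [Finsupp.support_embDomain, Finset.mem_map] at hm
      obtain ⟨n, hn, rfl⟩ := hm
      exact hc n hn
    · by_cases hm : IsTheta m
      · exact (Finsupp.embDomain_apply_self (Function.Embedding.subtype _) c ⟨m, hm⟩).symm ▸ hS _
      · rw [Finsupp.embDomain_of_notMem_range]
        · exact h0
        · rintro ⟨n, rfl⟩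
          exact hm n.2
    · rw [Finsupp.sum_embDomain]
      rfl

theorem expansion_iff {V : Type*} [AddCommGroup V] [Module K V] (R : Subring K) {F : MS → V}
    {v : V} :
    (∃ c : MS →₀ K, (∀ m ∈ c.support, IsTheta m) ∧ (∀ m, c m ∈ R) ∧
        v = c.sum fun m a => a • F m) ↔
      ∃ c : ThetaMS →₀ K, (∀ m, c m ∈ R) ∧ v = c.sum fun m a => a • F m.1 :=
  (exists_supported_iff R.zero_mem fun _ h => h).trans
    (exists_congr fun _ => and_iff_right fun m _ => m.2)

theorem mem_Llat_iff_repr {v : ThetaMod} :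
    (show Vt from v) ∈ Llat ↔ ∀ n, pbwBasis.repr v n ∈ azeroRing := by
  have h : (show Vt from v) ∈ Llat ↔ ∃ c : MS →₀ K, (∀ m ∈ c.support, IsTheta m) ∧
      (∀ m, c m ∈ azeroRing) ∧ v = c.sum fun m a => a • pbwVec m := Iff.rfl
  rw [h, expansion_iff]
  constructor
  · rintro ⟨c, hc, rfl⟩ n
    have e : (c.sum fun m a => a • pbwVec m.1) = pbwBasis.repr.symm c := by
      rw [pbwBasis.repr_symm_apply, Finsupp.linearCombination_apply]
      exact Finsupp.sum_congr fun m _ => by rw [pbwBasis_apply]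
    rw [e, LinearEquiv.apply_symm_apply]
    exact hc n
  · intro hv
    refine ⟨pbwBasis.repr v, hv, ?_⟩
    conv_lhs => rw [← pbwBasis.linearCombination_repr v, Finsupp.linearCombination_apply]
    exact Finsupp.sum_congr fun m _ => by rw [pbwBasis_apply]

theorem mem_qLlat_iff_repr {v : ThetaMod} :
    (show Vt from v) ∈ qLlat ↔ ∀ n, ∃ y ∈ azeroRing, pbwBasis.repr v n = q * y := by
  constructor
  · rintro ⟨w, hw, h⟩ n
    have h' : v = q • (show ThetaMod from w) := h.symm
    exact ⟨_, mem_Llat_iff_repr.1 hw n, by rw [h', map_smul]; rfl⟩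
  · intro hv
    have hq := nonRoot_q.ne_zero
    refine ⟨q⁻¹ • v, mem_Llat_iff_repr.2 fun n => ?_, smul_inv_smul₀ (α := K) hq v⟩
    obtain ⟨y, hy, h⟩ := hv n
    rw [map_smul, Finsupp.smul_apply, smul_eq_mul, h, inv_mul_cancel_left₀ hq]
    exact hy

theorem existsUnique_expansion {V : Type*} [AddCommGroup V] [Module K V] {F : MS → V}
    (hF : LinearIndependent K fun m : ThetaMS => F m.1) {v : V}
    (hv : ∃ c : MS →₀ K, (∀ m ∈ c.support, IsTheta m) ∧ v = c.sum fun m a => a • F m) :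
    ∃! c : MS →₀ K, (∀ m ∈ c.support, IsTheta m) ∧ v = c.sum fun m a => a • F m := by
  obtain ⟨c, hc, h⟩ := hv
  refine ⟨c, ⟨hc, h⟩, fun d ⟨hd, h'⟩ => ?_⟩
  rw [h, ← Finsupp.sum_subtypeDomain_index (h := fun m a => a • F m) hc,
    ← Finsupp.sum_subtypeDomain_index (h := fun m a => a • F m) hd] at h'
  have e : c.subtypeDomain IsTheta = d.subtypeDomain IsTheta := hF h'
  ext m
  by_cases hm : IsTheta m
  · exact (DFunLike.congr_fun e ⟨m, hm⟩).symm
  · rw [Finsupp.notMem_support_iff.1 fun h0 => hm (hc m h0),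
      Finsupp.notMem_support_iff.1 fun h0 => hm (hd m h0)]

/-- The lower global basis of `ThetaMod`. -/
theorem IsBar.exists_globalBasis {bar : U →+* U} {barV : ThetaMod →+ ThetaMod}
    (H : IsBar bar barV) : ∃ G : MS → ThetaMod,
      (∀ m : MS, IsTheta m →
        ((show Vt from G m) ∈ VA ∧ (show Vt from G m) ∈ Llat ∧ barV (G m) = G m ∧
          (show Vt from G m - pbwVec m) ∈ qLlat) ∧
        (∀ g : ThetaMod, (show Vt from g) ∈ VA → (show Vt from g) ∈ Llat → barV g = g →
          (show Vt from g - pbwVec m) ∈ qLlat → g = G m) ∧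
        (∃ c : MS →₀ K, (∀ n ∈ c.support, IsTheta n ∧ CryLt n m) ∧ (∀ n, c n ∈ qPoly) ∧
          G m = pbwVec m + c.sum fun n a => a • pbwVec n)) ∧
      (∀ v : ThetaMod, (show Vt from v) ∈ VA ↔ ∃ c : MS →₀ K, (∀ m ∈ c.support, IsTheta m) ∧
          (∀ m, c m ∈ Lring) ∧ v = c.sum fun m a => a • G m) ∧
      (∀ v : ThetaMod, (show Vt from v) ∈ Llat ↔ ∃ c : MS →₀ K, (∀ m ∈ c.support, IsTheta m) ∧
          (∀ m, c m ∈ azeroRing) ∧ v = c.sum fun m a => a • G m) ∧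
      (∀ v : ThetaMod, ∃! c : MS →₀ K, (∀ m ∈ c.support, IsTheta m) ∧
          v = c.sum fun m a => a • G m) := by
  have hwf := cryLt_wellFounded
  have htr : ∀ {l m n : ThetaMS}, CryLt n.1 m.1 → CryLt m.1 l.1 → CryLt n.1 l.1 := CryLt.trans
  choose G hbar hG using exists_canonical (b := pbwBasis) (r := fun n m => CryLt n.1 m.1)
    H.map_smul' hwf htr H.barV_barV H.repr_barV_mem H.cryLt_of_repr_ne_zero
  let G' : MS → ThetaMod := fun m => if h : IsTheta m then G ⟨m, h⟩ else 0
  have hG' : ∀ m : ThetaMS, G' m.1 = G m := fun m => dif_pos m.2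
  have hGb : ∀ m : ThetaMS, ∀ n, pbwBasis.repr (G m) n - (if m = n then 1 else 0) ∈ qPoly := by
    intro m n
    have := (hG m n).1
    rwa [map_sub, Finsupp.sub_apply, pbwBasis.repr_self, Finsupp.single_apply] at this
  have hrepr : ∀ {R : Subring K}, (∀ x ∈ qPoly, x ∈ R) → ∀ m n, pbwBasis.repr (G m) n ∈ R := by
    intro R hR m n
    rw [← sub_add_cancel (pbwBasis.repr (G m) n) (if m = n then 1 else 0)]
    refine R.add_mem (hR _ (hGb m n)) ?_
    split_ifs
    exacts [R.one_mem, R.zero_mem]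
  have hexp : ∀ {R : Subring K}, (∀ x ∈ qPoly, x ∈ R) → ∀ v,
      (∀ n, pbwBasis.repr v n ∈ R) ↔ ∃ c : MS →₀ K, (∀ m ∈ c.support, IsTheta m) ∧
        (∀ m, c m ∈ R) ∧ v = c.sum fun m a => a • G' m := by
    intro R hR v
    rw [repr_mem_iff hG hwf hR, expansion_iff]
    simp only [hG']
  refine ⟨G', fun m hm => ?_, fun v => ?_, fun v => ?_, fun v => ?_⟩
  · have e : G' m = G ⟨m, hm⟩ := hG' ⟨m, hm⟩
    have hb : pbwVec m = pbwBasis ⟨m, hm⟩ := (pbwBasis_apply ⟨m, hm⟩).symm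
    rw [e]
    refine ⟨⟨mem_VA_iff_repr.2 (hrepr (fun _ => qPoly_le_Lring) _),
      mem_Llat_iff_repr.2 (hrepr (fun _ => qPoly_le_azeroRing) _), hbar _,
      mem_qLlat_iff_repr.2 fun n => ?_⟩, fun g hgA hgL hgb hgq => ?_, ?_⟩
    · rw [hb]
      exact exists_azero_of_mem_qPoly (hG ⟨m, hm⟩ n).1
    · rw [← sub_eq_zero]
      refine eq_zero_of_bar_eq (b := pbwBasis) H.map_smul' hwf htr H.cryLt_of_repr_ne_zero
        (by rw [map_sub, hgb, hbar]) fun n => ?_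
      obtain ⟨y, hy, h⟩ := mem_qLlat_iff_repr.1 hgq n
      obtain ⟨z, hz, h'⟩ := exists_azero_of_mem_qPoly (hG ⟨m, hm⟩ n).1
      refine mem_qPoly_of_mem (y := y - z) ?_ (azeroRing.sub_mem hy hz) ?_
      · rw [map_sub]
        exact Lring.sub_mem (mem_VA_iff_repr.1 hgA n) (hrepr (fun _ => qPoly_le_Lring) _ n)
      · rw [mul_sub, ← h, ← h', ← hb, ← Finsupp.sub_apply, ← map_sub, sub_sub_sub_cancel_right]
    · have hx : ∃ c : MS →₀ K, (∀ n ∈ c.support, IsTheta n ∧ CryLt n m) ∧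
          (∀ n, c n ∈ (qPoly : Set K)) ∧
          G ⟨m, hm⟩ - pbwVec m = c.sum fun n a => a • pbwVec n := by
        rw [exists_supported_iff (S := (qPoly : Set K)) qPoly.zero_mem fun _ h => h.1]
        refine ⟨pbwBasis.repr (G ⟨m, hm⟩ - pbwVec m), fun n hn => ⟨n.2, ?_⟩, fun n => ?_, ?_⟩
        · rw [hb] at hn
          exact (hG ⟨m, hm⟩ n).2 (Finsupp.mem_support_iff.1 hn)
        · rw [hb]
          exact (hG ⟨m, hm⟩ n).1
        · conv_lhs => rw [← pbwBasis.linearCombination_repr (G ⟨m, hm⟩ - pbwVec m),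
            Finsupp.linearCombination_apply]
          exact Finsupp.sum_congr fun n _ => by rw [pbwBasis_apply]
      obtain ⟨c, hc, hcq, h⟩ := hx
      exact ⟨c, hc, hcq, by rw [← h, add_sub_cancel]⟩
  · rw [mem_VA_iff_repr, hexp fun _ => qPoly_le_Lring]
  · rw [mem_Llat_iff_repr, hexp fun _ => qPoly_le_azeroRing]
  · refine existsUnique_expansion ?_ ?_
    · simp only [hG']
      exact linearIndependent_of_lowerPart hG hwf htr
    · obtain ⟨c, hc, -, h⟩ := (hexp (R := ⊤) (fun x _ => Subring.mem_top x) v).1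
        fun n => Subring.mem_top _
      exact ⟨c, hc, h⟩

/-- Theorem 5.5 of Enomoto–Kashiwara: existence and properties of the lower global
basis `{G_θ^low(m)}_{m ∈ M_θ}` of `Ṽ_θ(0) ≅ V_θ(0)`.  Here `bar`/`barV` denote the bar
involution (the unique ℚ-algebra automorphism of `U_q^-(gl_∞)` with `q ↦ q⁻¹`,
`f_i ↦ f_i`, and the induced involution of `Ṽ_θ(0)`). -/
theorem global_basis_exists (bar : U →+* U)
    (hbarq : bar (algebraMap K U q) = algebraMap K U q⁻¹)
    (hbarrat : ∀ r : ℚ, bar (algebraMap ℚ U r) = algebraMap ℚ U r)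
    (hbarf : ∀ i : ℤ, Odd i → bar (fgen i) = fgen i)
    (barV : Vt →+ Vt)
    (hbarV : ∀ u : U, barV (Submodule.Quotient.mk u) = Submodule.Quotient.mk (bar u)) :
    ∃ G : MS → Vt,
      (∀ m : MS, IsTheta m →
        (G m ∈ VA ∧ G m ∈ Llat ∧ barV (G m) = G m ∧ G m - Ptheta m • phi ∈ qLlat) ∧
        (∀ g : Vt, g ∈ VA → g ∈ Llat → barV g = g → g - Ptheta m • phi ∈ qLlat →
          g = G m) ∧
        (∃ c : MS →₀ K, (∀ n ∈ c.support, IsTheta n ∧ CryLt n m) ∧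
          (∀ n, ∃ p : Polynomial ℚ, c n = q * Polynomial.aeval q p) ∧
          G m = Ptheta m • phi + c.sum fun n a => a • (Ptheta n • phi))) ∧
      (∀ v : Vt, v ∈ VA ↔ ∃ c : MS →₀ K, (∀ m ∈ c.support, IsTheta m) ∧
          (∀ m, c m ∈ Aring) ∧ v = c.sum fun m a => a • G m) ∧
      (∀ v : Vt, v ∈ Llat ↔ ∃ c : MS →₀ K, (∀ m ∈ c.support, IsTheta m) ∧
          (∀ m, c m ∈ Azero) ∧ v = c.sum fun m a => a • G m) ∧
      (∀ v : Vt, ∃! c : MS →₀ K, (∀ m ∈ c.support, IsTheta m) ∧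
          v = c.sum fun m a => a • G m) := by
  obtain ⟨G, h, hVA, hL, hV⟩ := (isBar_of hbarq hbarf hbarV).exists_globalBasis
  refine ⟨G, h, fun v => (hVA v).trans ?_, hL, hV⟩
  simp only [mem_Lring_iff]
  rfl

end
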